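/- arXiv:0905.1185 — 3 statements merged into one kernel-verified Lean document; each statement's English description precedes it below -/
import Mathlib

section
/- Let k be a field and let G and G' be finite groups. If G and G' are k-isocategorical, i.e., there exists an equivalence of categories E : Rep k G ≌ Rep k G' whose underlying functor is k-linear (additive and k-linear) and monoidal, then for every positive integer n, the number of elements of order n in G equals the number of elements of order n in G', i.e., Nat.card {g : G | orderOf g = n} = Nat.card {g : G' | orderOf g = n}. -/
open CategoryTheory

universe u v

section Rotation

open MonoidalCategory

variable {C : Type*} [Category C] [MonoidalCategory C]

/-- The right-bracketed tensor power `V ⊗ (V ⊗ (⋯ ⊗ 𝟙_ C))`. -/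
def tensorPow (V : C) : ℕ → C
  | 0 => 𝟙_ C
  | n + 1 => V ⊗ tensorPow V n

/-- The reassociation `v₀ ⊗ (v₁ ⊗ ⋯ ⊗ vₙ) ↦ (v₀ ⊗ ⋯ ⊗ vₙ₋₁) ⊗ vₙ`. -/
def tensorPowSplitLast (V : C) : ∀ n, V ⊗ tensorPow V n ⟶ tensorPow V n ⊗ V
  | 0 => (ρ_ V).hom ≫ (λ_ V).inv
  | n + 1 => V ◁ tensorPowSplitLast V n ≫ (α_ V (tensorPow V n) V).inv

/-- Moving the first tensor factor of the source of a form to the end, by means of a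
pairing and a copairing. -/
def rotateForm {V : C} (b : V ⊗ V ⟶ 𝟙_ C) (c : 𝟙_ C ⟶ V ⊗ V) {W : C} (φ : V ⊗ W ⟶ 𝟙_ C) :
    W ⊗ V ⟶ 𝟙_ C :=
  (λ_ (W ⊗ V)).inv ≫ c ▷ (W ⊗ V) ≫ (α_ V V (W ⊗ V)).hom ≫ V ◁ (α_ V W V).inv ≫
    V ◁ (φ ▷ V) ≫ V ◁ (λ_ V).hom ≫ b

/-- The cyclic rotation of forms on a tensor power. -/
def rotatePow {V : C} (b : V ⊗ V ⟶ 𝟙_ C) (c : 𝟙_ C ⟶ V ⊗ V) (n : ℕ)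
    (φ : tensorPow V (n + 1) ⟶ 𝟙_ C) : tensorPow V (n + 1) ⟶ 𝟙_ C :=
  tensorPowSplitLast V n ≫ rotateForm b c φ

lemma rotateForm_naturality {V : C} (b : V ⊗ V ⟶ 𝟙_ C) (c : 𝟙_ C ⟶ V ⊗ V) {W W' : C}
    (f : W' ⟶ W) (φ : V ⊗ W ⟶ 𝟙_ C) :
    rotateForm b c (V ◁ f ≫ φ) = f ▷ V ≫ rotateForm b c φ := by
  simp only [rotateForm, comp_whiskerRight, whiskerLeft_comp, Category.assoc]
  rw [← whiskerLeft_comp_assoc V (α_ V W' V).inv, ← associator_inv_naturality_middle,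
    whiskerLeft_comp_assoc, ← associator_naturality_right_assoc, ← whisker_exchange_assoc,
    leftUnitor_inv_naturality_assoc]

variable {D : Type*} [Category D] [MonoidalCategory D] (F : C ⥤ D) [F.Monoidal]

open Functor.LaxMonoidal Functor.Monoidal
open Functor.OplaxMonoidal (η δ)

/-- The image of a pairing under a monoidal functor. -/
def mapPairing {V W : C} (b : V ⊗ W ⟶ 𝟙_ C) : F.obj V ⊗ F.obj W ⟶ 𝟙_ D :=
  μ F V W ≫ F.map b ≫ η F

/-- The image of a copairing under a monoidal functor. -/
def mapCopairing {V W : C} (c : 𝟙_ C ⟶ V ⊗ W) : 𝟙_ D ⟶ F.obj V ⊗ F.obj W :=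
  ε F ≫ F.map c ≫ δ F V W

lemma rotateForm_mapPairing {V W : C} (b : V ⊗ V ⟶ 𝟙_ C) (c : 𝟙_ C ⟶ V ⊗ V)
    (φ : V ⊗ W ⟶ 𝟙_ C) :
    rotateForm (mapPairing F b) (mapCopairing F c) (mapPairing F φ) =
      mapPairing F (rotateForm b c φ) := by
  have hunit : (λ_ (F.obj V)).hom = ε F ▷ F.obj V ≫ μ F (𝟙_ C) V ≫ F.map (λ_ V).hom :=
    left_unitality F V
  have hφ : (μ F V W ≫ F.map φ ≫ η F) ▷ F.obj V ≫ (λ_ (F.obj V)).hom =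
      μ F V W ▷ F.obj V ≫ μ F (V ⊗ W) V ≫ F.map (φ ▷ V ≫ (λ_ V).hom) := by
    rw [hunit, ← comp_whiskerRight_assoc]
    simp
  have hinv : (α_ (F.obj V) (F.obj W) (F.obj V)).inv ≫ μ F V W ▷ F.obj V ≫ μ F (V ⊗ W) V =
      F.obj V ◁ μ F W V ≫ μ F V (W ⊗ V) ≫ F.map (α_ V W V).inv := by
    simp
  have hinner : (α_ (F.obj V) (F.obj W) (F.obj V)).inv ≫
      (μ F V W ≫ F.map φ ≫ η F) ▷ F.obj V ≫ (λ_ (F.obj V)).hom =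
      F.obj V ◁ μ F W V ≫ μ F V (W ⊗ V) ≫
        F.map ((α_ V W V).inv ≫ φ ▷ V ≫ (λ_ V).hom) := by
    rw [hφ, reassoc_of% hinv, ← F.map_comp]
  have hassoc : (ε F ≫ F.map c ≫ δ F V V) ▷ F.obj (W ⊗ V) ≫
      (α_ (F.obj V) (F.obj V) (F.obj (W ⊗ V))).hom ≫
      F.obj V ◁ μ F V (W ⊗ V) ≫ μ F V (V ⊗ (W ⊗ V)) =
      ε F ▷ F.obj (W ⊗ V) ≫ μ F (𝟙_ C) (W ⊗ V) ≫
        F.map (c ▷ (W ⊗ V) ≫ (α_ V V (W ⊗ V)).hom) := by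
    rw [← associativity F V V (W ⊗ V), ← comp_whiskerRight_assoc]
    simp
  have hlam : (λ_ (F.obj W ⊗ F.obj V)).inv ≫ (𝟙_ D) ◁ μ F W V ≫ ε F ▷ F.obj (W ⊗ V) ≫
      μ F (𝟙_ C) (W ⊗ V) = μ F W V ≫ F.map (λ_ (W ⊗ V)).inv := by
    rw [← leftUnitor_inv_naturality_assoc]
    simp
  simp only [rotateForm, mapPairing, mapCopairing]
  simp only [← whiskerLeft_comp_assoc]
  rw [hinner]
  simp only [whiskerLeft_comp, Category.assoc]
  rw [μ_natural_right_assoc, ← associator_naturality_right_assoc, ← whisker_exchange_assoc,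
    reassoc_of% hassoc, reassoc_of% hlam]
  simp only [← F.map_comp_assoc, Category.assoc, whiskerLeft_comp]

/-- The comparison between tensor powers for a monoidal functor. -/
def tensorPowMapIso (V : C) : ∀ n, tensorPow (F.obj V) n ≅ F.obj (tensorPow V n)
  | 0 => εIso F
  | n + 1 => whiskerLeftIso (F.obj V) (tensorPowMapIso V n) ≪≫ μIso F V (tensorPow V n)

lemma tensorPowSplitLast_map (V : C) (n : ℕ) :
    tensorPowSplitLast (F.obj V) n ≫ (tensorPowMapIso F V n).hom ▷ F.obj V ≫
      μ F (tensorPow V n) V =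
    (tensorPowMapIso F V (n + 1)).hom ≫ F.map (tensorPowSplitLast V n) := by
  induction n with
  | zero =>
    simp [tensorPowSplitLast, tensorPowMapIso, tensorPow]
  | succ n ih =>
    simp only [tensorPowSplitLast, tensorPowMapIso, tensorPow, Iso.trans_hom, whiskerLeftIso_hom,
      μIso_hom, Category.assoc, comp_whiskerRight, F.map_comp, whiskerLeft_comp] at ih ⊢
    have hinv : (α_ (F.obj V) (F.obj (tensorPow V n)) (F.obj V)).inv ≫
        μ F V (tensorPow V n) ▷ F.obj V ≫ μ F (V ⊗ tensorPow V n) V =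
      F.obj V ◁ μ F (tensorPow V n) V ≫ μ F V (tensorPow V n ⊗ V) ≫
        F.map (α_ V (tensorPow V n) V).inv := by
      simp
    rw [← associator_inv_naturality_middle_assoc, hinv]
    have := congrArg (F.obj V ◁ ·) ih
    simp only [whiskerLeft_comp] at this
    rw [reassoc_of% this, μ_natural_right_assoc]

/-- The action of a monoidal functor on forms on a tensor power. -/
def mapForm {V : C} (n : ℕ) (φ : tensorPow V n ⟶ 𝟙_ C) : tensorPow (F.obj V) n ⟶ 𝟙_ D :=
  (tensorPowMapIso F V n).hom ≫ F.map φ ≫ η F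

lemma rotatePow_mapForm {V : C} (b : V ⊗ V ⟶ 𝟙_ C) (c : 𝟙_ C ⟶ V ⊗ V) (n : ℕ)
    (φ : tensorPow V (n + 1) ⟶ 𝟙_ C) :
    rotatePow (mapPairing F b) (mapCopairing F c) n (mapForm F (n + 1) φ) =
      mapForm F (n + 1) (rotatePow b c n φ) := by
  have h (ψ : V ⊗ tensorPow V n ⟶ 𝟙_ C) : mapForm F (n + 1) ψ =
      F.obj V ◁ (tensorPowMapIso F V n).hom ≫ mapPairing F ψ := by
    simp [mapForm, mapPairing, tensorPowMapIso, tensorPow]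
  have h' (ψ : V ⊗ tensorPow V n ⟶ 𝟙_ C) : tensorPowSplitLast (F.obj V) n ≫
      rotateForm (mapPairing F b) (mapCopairing F c)
        (F.obj V ◁ (tensorPowMapIso F V n).hom ≫ mapPairing F ψ) =
      mapForm F (n + 1) (tensorPowSplitLast V n ≫ rotateForm b c ψ) := by
    rw [rotateForm_naturality, rotateForm_mapPairing, mapPairing,
      reassoc_of% tensorPowSplitLast_map F V n, mapForm]
    exact (Category.assoc _ _ _).trans
      (congrArg (CategoryStruct.comp _) (F.map_comp_assoc _ _ _).symm)
  exact (congrArg (rotatePow _ _ n) (h φ)).trans (h' φ)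

lemma mapForm_bijective [F.Full] [F.Faithful] {V : C} (n : ℕ) :
    Function.Bijective (mapForm F (V := V) n) := by
  refine ⟨fun φ ψ h ↦ ?_, fun φ ↦ ⟨F.preimage ((tensorPowMapIso F V n).inv ≫ φ ≫ ε F), ?_⟩⟩
  · exact F.map_injective (by simpa [mapForm, cancel_mono] using h)
  · simp [mapForm]

/-- A fully faithful linear monoidal functor identifies forms on a tensor power with forms on the
tensor power of the image. -/
noncomputable def mapFormEquiv (k : Type*) [Semiring k] [Preadditive C] [Preadditive D]
    [Linear k C] [Linear k D] [F.Additive] [F.Linear k] [F.Full] [F.Faithful] (V : C) (n : ℕ) :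
    (tensorPow V n ⟶ 𝟙_ C) ≃ₗ[k] (tensorPow (F.obj V) n ⟶ 𝟙_ D) :=
  LinearEquiv.ofBijective
    { toFun := mapForm F n
      map_add' := fun φ ψ ↦ by simp [mapForm]
      map_smul' := fun r φ ↦ by simp [mapForm] } (mapForm_bijective F n)

end Rotation

section FixedPoints

lemma MulAction.fixedBy_eq_of_zpowers_eq {C Q : Type*} [Group C] [MulAction C Q] {s t : C}
    (h : Subgroup.zpowers s = Subgroup.zpowers t) : fixedBy Q s = fixedBy Q t := by
  have key : ∀ {a b : C}, a ∈ Subgroup.zpowers b → fixedBy Q b ⊆ fixedBy Q a := by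
    rintro _ b ⟨n, rfl⟩
    exact fixedBy_subset_fixedBy_zpow Q b n
  exact Set.Subset.antisymm (key (h ▸ Subgroup.mem_zpowers t)) (key (h ▸ Subgroup.mem_zpowers s))

/-- Two finite actions of a finite group whose cyclic subgroups have equally many orbits have
equally many fixed points for each group element. -/
theorem MulAction.card_fixedBy_eq_of_card_orbits_zpowers_eq {C Q Q' : Type*} [Group C] [Finite C]
    [MulAction C Q] [MulAction C Q'] [Finite Q] [Finite Q']
    (h : ∀ t : C, Nat.card (orbitRel.Quotient (Subgroup.zpowers t) Q) =
      Nat.card (orbitRel.Quotient (Subgroup.zpowers t) Q')) (t : C) :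
    Nat.card (fixedBy Q t) = Nat.card (fixedBy Q' t) := by
  classical
  induction hn : orderOf t using Nat.strong_induction_on generalizing t with
  | _ n ih =>
  subst hn
  have := Fintype.ofFinite C
  have := Fintype.ofFinite Q
  have := Fintype.ofFinite Q'
  have burnside : ∑ s : Subgroup.zpowers t, Nat.card (fixedBy Q (s : C)) =
      ∑ s : Subgroup.zpowers t, Nat.card (fixedBy Q' (s : C)) := by
    have h₁ := sum_card_fixedBy_eq_card_orbits_mul_card_group (Subgroup.zpowers t) Q
    have h₂ := sum_card_fixedBy_eq_card_orbits_mul_card_group (Subgroup.zpowers t) Q'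
    simp only [← Nat.card_eq_fintype_card] at h₁ h₂
    have h₃ := h t
    simp only [orbitRel.Quotient] at h₃
    rw [h₃, ← h₂] at h₁
    exact h₁
  rw [← Finset.sum_filter_add_sum_filter_not _
      (fun s : Subgroup.zpowers t ↦ orderOf (s : C) = orderOf t),
    ← Finset.sum_filter_add_sum_filter_not (f := fun s : Subgroup.zpowers t ↦
      Nat.card (fixedBy Q' (s : C))) _ (fun s : Subgroup.zpowers t ↦ orderOf (s : C) = orderOf t)]
    at burnside
  have hlt : ∀ s ∈ Finset.univ.filter
      (fun s : Subgroup.zpowers t ↦ ¬ orderOf (s : C) = orderOf t),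
      Nat.card (fixedBy Q (s : C)) = Nat.card (fixedBy Q' (s : C)) := by
    intro s hs
    refine ih _ (lt_of_le_of_ne ?_ (Finset.mem_filter.1 hs).2) _ rfl
    exact Nat.le_of_dvd (orderOf_pos t) (orderOf_dvd_of_mem_zpowers s.2)
  have hgen : ∀ s : Subgroup.zpowers t, orderOf (s : C) = orderOf t →
      Subgroup.zpowers (s : C) = Subgroup.zpowers t := by
    intro s hs
    refine Subgroup.eq_of_le_of_card_ge (Subgroup.zpowers_le.2 s.2) ?_
    rw [Nat.card_zpowers, Nat.card_zpowers, hs]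
  rw [Finset.sum_congr rfl hlt, Nat.add_right_cancel_iff,
    Finset.sum_congr rfl fun s hs ↦ congrArg (fun A : Set Q ↦ Nat.card A)
      (fixedBy_eq_of_zpowers_eq (Q := Q) (hgen s (Finset.mem_filter.1 hs).2)),
    Finset.sum_congr rfl fun s hs ↦ congrArg (fun A : Set Q' ↦ Nat.card A)
      (fixedBy_eq_of_zpowers_eq (Q := Q') (hgen s (Finset.mem_filter.1 hs).2)),
    Finset.sum_const, Finset.sum_const, smul_eq_mul, smul_eq_mul] at burnside
  refine Nat.eq_of_mul_eq_mul_left (Finset.card_pos.2 ⟨⟨t, Subgroup.mem_zpowers t⟩, ?_⟩) burnside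
  exact Finset.mem_filter.2 ⟨Finset.mem_univ _, rfl⟩

/-- The functions invariant under a permutation. -/
def Equiv.Perm.invariantFunctions (k : Type*) [Semiring k] {Q : Type*} (σ : Equiv.Perm Q) :
    Submodule k (Q → k) where
  carrier := {f | f ∘ σ = f}
  add_mem' hf hg := funext fun q ↦ congr_arg₂ (· + ·) (congrFun hf q) (congrFun hg q)
  zero_mem' := rfl
  smul_mem' r _ hf := funext fun q ↦ congrArg (r • ·) (congrFun hf q)

lemma Equiv.Perm.finrank_invariantFunctions (k : Type*) [Field k] {C Q : Type*} [Group C]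
    [MulAction C Q] [Finite Q] (t : C) :
    Module.finrank k (invariantFunctions k (MulAction.toPerm t : Equiv.Perm Q)) =
      Nat.card (MulAction.orbitRel.Quotient (Subgroup.zpowers t) Q) := by
  have := Fintype.ofFinite (MulAction.orbitRel.Quotient (Subgroup.zpowers t) Q)
  rw [Nat.card_eq_fintype_card, ← Module.finrank_fintype_fun_eq_card k]
  refine LinearEquiv.finrank_eq
    { toFun := fun f ↦ Quotient.lift f.1 ?_
      invFun := fun f ↦ ⟨fun q ↦ f (Quotient.mk'' q), funext fun q ↦
        congrArg f (Quotient.sound' ⟨⟨t, Subgroup.mem_zpowers t⟩, rfl⟩)⟩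
      map_add' := ?_
      map_smul' := ?_
      left_inv := fun f ↦ rfl
      right_inv := ?_ }
  · rintro a b ⟨⟨_, n, rfl⟩, rfl⟩
    have hf : ∀ q, f.1 (t • q) = f.1 q := congrFun f.2
    change f.1 (t ^ n • b) = f.1 b
    induction n with
    | zero => simp
    | succ n ih => rw [add_comm, zpow_one_add, mul_smul, hf, ih]
    | pred n ih =>
      rw [← ih, ← hf (t ^ (-(n : ℤ) - 1) • b), ← mul_smul, ← zpow_one_add, add_sub_cancel]
  · rintro f g
    ext ⟨q⟩
    rfl
  · rintro r f
    ext ⟨q⟩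
    rfl
  · rintro f
    ext ⟨q⟩
    rfl

/-- **Brauer's permutation lemma**, over an arbitrary field. -/
theorem Equiv.Perm.card_fixedPoints_eq_of_linearEquiv {k Q Q' : Type*} [Field k] [Finite Q]
    [Finite Q'] (σ : Equiv.Perm Q) (σ' : Equiv.Perm Q') (e : (Q → k) ≃ₗ[k] (Q' → k))
    (he : ∀ f, e (f ∘ σ) = e f ∘ σ') :
    Nat.card {q // σ q = q} = Nat.card {q // σ' q = q} := by
  let c : Equiv.Perm Q × Equiv.Perm Q' := (σ, σ')
  let C := Subgroup.zpowers c
  let : MulAction C Q := MulAction.compHom Q ((MonoidHom.fst _ _).comp C.subtype)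
  let : MulAction C Q' := MulAction.compHom Q' ((MonoidHom.snd _ _).comp C.subtype)
  have he' : ∀ f, e (f ∘ (σ⁻¹ : Equiv.Perm Q)) = e f ∘ (σ'⁻¹ : Equiv.Perm Q') := by
    intro f
    have := he (f ∘ (σ⁻¹ : Equiv.Perm Q))
    rw [Function.comp_assoc, ← Equiv.Perm.coe_mul, inv_mul_cancel, Equiv.Perm.coe_one,
      Function.comp_id] at this
    rw [this, Function.comp_assoc, ← Equiv.Perm.coe_mul, mul_inv_cancel, Equiv.Perm.coe_one,
      Function.comp_id]
  have key : ∀ t : C, ∀ f : Q → k, e (fun q ↦ f (t • q)) = fun q ↦ e f (t • q) := by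
    rintro ⟨_, n, rfl⟩
    change ∀ f : Q → k, e (fun q ↦ f ((σ ^ n) q)) = fun q ↦ e f ((σ' ^ n) q)
    induction n with
    | zero => exact fun f ↦ rfl
    | succ n ih =>
      intro f
      simp only [zpow_add_one, Equiv.Perm.mul_apply]
      exact (he (fun q ↦ f ((σ ^ (n : ℤ)) q))).trans (congrArg (· ∘ σ') (ih f))
    | pred n ih =>
      intro f
      simp only [zpow_sub_one, Equiv.Perm.mul_apply]
      exact (he' (fun q ↦ f ((σ ^ (-n : ℤ)) q))).trans
        (congrArg (· ∘ (σ'⁻¹ : Equiv.Perm Q')) (ih f))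
  have h := MulAction.card_fixedBy_eq_of_card_orbits_zpowers_eq (C := C) (Q := Q) (Q' := Q') (by
    intro t
    rw [← finrank_invariantFunctions k, ← finrank_invariantFunctions k]
    refine LinearEquiv.finrank_eq (e.ofSubmodules _ _ ?_)
    ext f
    rw [Submodule.mem_map_equiv]
    change (fun q ↦ e.symm f (t • q)) = e.symm f ↔ (fun q ↦ f (t • q)) = f
    rw [← e.injective.eq_iff, key, e.apply_symm_apply]) ⟨c, Subgroup.mem_zpowers c⟩
  exact h

end FixedPoints

section CyclicShift

/-- The cyclic shift of a tuple, with the entry that moves to the front modified by `a`. -/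
def cyclicShift {S : Type*} (a : S → S) {n : ℕ} (v : Fin (n + 1) → S) : Fin (n + 1) → S :=
  Fin.cons (a (v (Fin.last n))) (Fin.init v)

section

variable {S : Type*} (a : S → S) {n : ℕ}

@[simp] lemma cyclicShift_zero (v : Fin (n + 1) → S) :
    cyclicShift a v 0 = a (v (Fin.last n)) := rfl

@[simp] lemma cyclicShift_succ (v : Fin (n + 1) → S) (i : Fin n) :
    cyclicShift a v i.succ = v i.castSucc := rfl

lemma cyclicShift_comp {S' : Type*} {a : S → S} {a' : S' → S'} {f : S → S'}
    (h : ∀ s, f (a s) = a' (f s)) (v : Fin (n + 1) → S) :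
    f ∘ cyclicShift a v = cyclicShift a' (f ∘ v) := by
  funext i
  cases i using Fin.cases <;> simp [h]

lemma cyclicShift_injective {a : S → S} (ha : Function.Injective a) :
    Function.Injective (cyclicShift a : (Fin (n + 1) → S) → Fin (n + 1) → S) := by
  intro v w h
  funext i
  cases i using Fin.lastCases with
  | last => exact ha (congrFun h 0)
  | cast i => exact congrFun h i.succ

lemma iterate_cyclicShift (v : Fin (n + 1) → S) : (cyclicShift a)^[n + 1] v = a ∘ v := by
  have key : ∀ j ≤ n + 1, ∀ i : Fin (n + 1), (cyclicShift a)^[j] v i =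
      if h : j ≤ i then v ⟨i - j, by omega⟩ else
        a (v ⟨(i + (n + 1) - j) % (n + 1), Nat.mod_lt _ n.succ_pos⟩) := by
    intro j
    induction j with
    | zero => simp
    | succ j ih =>
      intro hj i
      rw [Function.iterate_succ_apply']
      cases i using Fin.cases with
      | zero =>
        rw [cyclicShift_zero, ih (by omega), dif_pos (by simp; omega), dif_neg (by simp)]
        congr 2
        ext
        simp only [Fin.val_last, Fin.coe_ofNat_eq_mod, Nat.zero_mod]
        rw [Nat.mod_eq_of_lt (by omega)]
        simp
      | succ i =>
        rw [cyclicShift_succ, ih (by omega)]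
        have hi := i.2
        by_cases h : j ≤ (i : ℕ)
        · rw [dif_pos (by simpa using h), dif_pos (by simpa using h)]
          congr 1
          ext
          simp
        · rw [dif_neg (by simpa using h), dif_neg (by simpa using h)]
          congr 2
          ext
          simp only [Fin.val_castSucc, Fin.val_succ]
          congr 1
          omega
  funext i
  rw [key _ le_rfl, dif_neg (by omega)]
  simp [Nat.mod_eq_of_lt i.2]

end

variable {G Y : Type*} [Group G] [MulAction G Y]

/-- The permutation of orbits of tuples induced by a cyclic shift twisted by a central element. -/
noncomputable def orbitShift [Finite G] [Finite Y] (z : G) (hz : ∀ g : G, z * g = g * z) (n : ℕ) :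
    Equiv.Perm (MulAction.orbitRel.Quotient G (Fin (n + 1) → Y)) :=
  Equiv.ofBijective
    (Quotient.map (cyclicShift (z • ·)) (by
      rintro v w ⟨g, rfl⟩
      exact ⟨g, cyclicShift_comp (f := (g • ·))
        (fun s ↦ by simp only [← mul_smul, hz]) w⟩))
    (Finite.surjective_iff_bijective.1 (by
      rintro ⟨v⟩
      obtain ⟨w, hw⟩ := Finite.surjective_of_injective
        (cyclicShift_injective (n := n) (MulAction.injective (β := Y) z)) v
      exact ⟨Quotient.mk _ w, congrArg (Quotient.mk _) hw⟩))

lemma orbitShift_mk [Finite G] [Finite Y] (z : G) (hz : ∀ g : G, z * g = g * z) (n : ℕ)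
    (v : Fin (n + 1) → Y) :
    orbitShift z hz n (Quotient.mk'' v : MulAction.orbitRel.Quotient G (Fin (n + 1) → Y)) =
      Quotient.mk'' (cyclicShift (z • ·) v) := rfl

lemma card_fixedPoints_orbitShift [Finite G] [Finite Y]
    (hfree : ∀ (g : G) (y : Y), g • y = y → g = 1) (z : G) (hz : ∀ g : G, z * g = g * z) (n : ℕ) :
    Nat.card {q : MulAction.orbitRel.Quotient G (Fin (n + 1) → Y) // orbitShift z hz n q = q} *
      Nat.card G = Nat.card Y * Nat.card {h : G // h ^ (n + 1) = z} := by
  have hinj : ∀ {g h : G} {y : Y}, g • y = h • y → g = h := by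
    intro g h y e
    have := hfree (h⁻¹ * g) y (by rw [mul_smul, e, inv_smul_smul])
    exact (inv_mul_eq_one.1 this).symm
  let T := {v : Fin (n + 1) → Y // orbitShift z hz n (Quotient.mk'' v :
    MulAction.orbitRel.Quotient G (Fin (n + 1) → Y)) = Quotient.mk'' v}
  have hT : ∀ v : Fin (n + 1) → Y, orbitShift z hz n (Quotient.mk'' v :
      MulAction.orbitRel.Quotient G (Fin (n + 1) → Y)) = Quotient.mk'' v ↔
      ∃ h : G, h • v = cyclicShift (z • ·) v := by
    intro v
    rw [orbitShift_mk, Quotient.eq'']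
    rfl
  rw [← Nat.card_prod, ← Nat.card_prod]
  trans Nat.card T
  · refine Nat.card_congr (Equiv.ofBijective (fun p ↦ ⟨p.2 • p.1.1.out, ?_⟩) ⟨?_, ?_⟩)
    · have h₁ : (Quotient.mk'' (p.2 • p.1.1.out) :
          MulAction.orbitRel.Quotient G (Fin (n + 1) → Y)) = p.1.1 := by
        conv_rhs => rw [← Quotient.out_eq' p.1.1]
        exact Quotient.sound' ⟨p.2, rfl⟩
      rw [h₁, p.1.2]
    · rintro ⟨⟨q, hq⟩, g⟩ ⟨⟨q', hq'⟩, g'⟩ e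
      have e' : g • q.out = g' • q'.out := congrArg Subtype.val e
      have hqq : q = q' := by
        rw [← Quotient.out_eq' q, ← Quotient.out_eq' q']
        refine Quotient.sound' ⟨g⁻¹ * g', ?_⟩
        change (g⁻¹ * g') • q'.out = q.out
        rw [mul_smul, ← e', inv_smul_smul]
      subst hqq
      have := hinj (congrFun e' 0)
      subst this
      rfl
    · rintro ⟨v, hv⟩
      obtain ⟨g, hg⟩ : v ∈ MulAction.orbit G (Quotient.mk'' v :
          MulAction.orbitRel.Quotient G (Fin (n + 1) → Y)).out := by
        rw [← MulAction.orbitRel_apply]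
        exact Quotient.exact' (Quotient.out_eq' _).symm
      exact ⟨⟨⟨_, hv⟩, g⟩, Subtype.ext hg⟩
  · symm
    refine Nat.card_congr (Equiv.ofBijective
      (fun p ↦ ⟨fun i ↦ (p.2.1 ^ (n - i : ℕ)) • p.1, (hT _).2 ⟨p.2.1, ?_⟩⟩) ⟨?_, ?_⟩)
    · funext i
      cases i using Fin.cases with
      | zero => simp [← p.2.2, pow_succ', mul_smul]
      | succ i =>
        have hi := i.2
        simp only [Pi.smul_apply, cyclicShift_succ, ← mul_smul, ← pow_succ', Fin.val_succ,
          Fin.val_castSucc]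
        congr 2
        omega
    · rintro ⟨y, h, hh⟩ ⟨y', h', hh'⟩ e
      have e' : ∀ i : Fin (n + 1), h ^ (n - i : ℕ) • y = h' ^ (n - i : ℕ) • y' :=
        congrFun (congrArg Subtype.val e)
      obtain rfl : y = y' := by simpa using e' (Fin.last n)
      have : h ^ n = h' ^ n := by simpa using hinj (e' 0)
      obtain rfl : h = h' := by
        rw [pow_succ] at hh hh'
        rw [← hh', this] at hh
        exact mul_left_cancel hh
      rfl
    · rintro ⟨v, hv⟩
      obtain ⟨h, hh⟩ := (hT v).1 hv
      have hv' : ∀ j : ℕ, ∀ hj : j ≤ n,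
          v ⟨n - j, by omega⟩ = h ^ j • v (Fin.last n) := by
        intro j
        induction j with
        | zero => intro _; simp [Fin.last]
        | succ j ih =>
          intro hj
          have := congrFun hh (Fin.succ ⟨n - (j + 1), by omega⟩)
          rw [cyclicShift_succ] at this
          rw [pow_succ', mul_smul, ← ih (by omega)]
          refine this.symm.trans ?_
          rw [Pi.smul_apply]
          congr 2
          ext
          simp
          omega
      refine ⟨⟨v (Fin.last n), h, hinj (y := v (Fin.last n)) ?_⟩, Subtype.ext (funext fun i ↦ ?_)⟩
      · have := congrFun hh 0
        rw [cyclicShift_zero, Pi.smul_apply] at this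
        rw [← this, pow_succ', mul_smul, ← hv' n le_rfl]
        congr 2
        ext
        simp
      · have hi := i.2
        change h ^ (n - i : ℕ) • v (Fin.last n) = v i
        rw [← hv' (n - i) (by omega)]
        congr 1
        ext
        change n - (n - (i : ℕ)) = i
        omega

end CyclicShift

section RepForms

open MonoidalCategory TensorProduct

variable {k : Type u} {G : Type v} [Field k] [Group G] {V : Rep.{u} k G}

/-- The pure tensor in a tensor power with the given factors. -/
noncomputable def pureTensor (V : Rep.{u} k G) : ∀ n, (Fin n → V) → (tensorPow V n).V
  | 0, _ => (1 : k)
  | n + 1, v => v 0 ⊗ₜ[k] pureTensor V n (Fin.tail v)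

lemma ρ_pureTensor (n : ℕ) (g : G) (v : Fin n → V) :
    (tensorPow V n).ρ g (pureTensor V n v) = pureTensor V n (fun i ↦ V.ρ g (v i)) := by
  induction n with
  | zero => rfl
  | succ n ih => exact congrArg (V.ρ g (v 0) ⊗ₜ[k] ·) (ih (Fin.tail v))

lemma tensorPowSplitLast_pureTensor (n : ℕ) (v : Fin (n + 1) → V) :
    (tensorPowSplitLast V n).hom (pureTensor V (n + 1) v) =
      pureTensor V n (Fin.init v) ⊗ₜ[k] v (Fin.last n) := by
  induction n with
  | zero =>
    change (1 : k) ⊗ₜ[k] ((1 : k) • v 0) = (1 : k) ⊗ₜ[k] v 0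
    rw [one_smul]
  | succ n ih =>
    have h := ih (Fin.tail v)
    change (TensorProduct.assoc k V (tensorPow V n).V V).symm
      (v 0 ⊗ₜ[k] (tensorPowSplitLast V n).hom (pureTensor V (n + 1) (Fin.tail v))) = _
    rw [h]
    rfl

/-- The linear map `v ↦ ∑ b(cᵢ, v) cⁱ` attached to a pairing `b` and a copairing
`c = ∑ cᵢ ⊗ cⁱ`. -/
noncomputable def copairingTwist (b : V ⊗ V ⟶ 𝟙_ (Rep.{u} k G)) (c : 𝟙_ (Rep.{u} k G) ⟶ V ⊗ V) :
    V →ₗ[k] V where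
  toFun v := TensorProduct.lid k V
    (((TensorProduct.curry b.hom.toLinearMap).flip v).rTensor V (c.hom (1 : k)))
  map_add' v w := by simp [LinearMap.rTensor_add]
  map_smul' r v := by simp [LinearMap.rTensor_smul]

lemma rotateForm_apply (b : V ⊗ V ⟶ 𝟙_ (Rep.{u} k G)) (c : 𝟙_ (Rep.{u} k G) ⟶ V ⊗ V)
    {W : Rep.{u} k G} (φ : V ⊗ W ⟶ 𝟙_ (Rep.{u} k G)) (w : W) (v : V) :
    (rotateForm b c φ).hom (w ⊗ₜ[k] v) = φ.hom (copairingTwist b c v ⊗ₜ[k] w) := by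
  have key : ∀ t : V.V ⊗[k] V.V, ((α_ V V (W ⊗ V)).hom ≫ V ◁ (α_ V W V).inv ≫
    V ◁ (φ ▷ V) ≫ V ◁ (λ_ V).hom ≫ b).hom (t ⊗ₜ[k] (w ⊗ₜ[k] v)) =
      φ.hom (TensorProduct.lid k V
        (((TensorProduct.curry b.hom.toLinearMap).flip v).rTensor V t) ⊗ₜ[k] w) := by
    intro t
    induction t with
    | zero => simp
    | add s t hs ht =>
      rw [add_tmul, map_add, hs, ht, map_add, map_add, add_tmul, map_add]
    | tmul x y =>
      change b.hom (x ⊗ₜ[k] ((φ.hom (y ⊗ₜ[k] w) : k) • v)) =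
        φ.hom (((b.hom (x ⊗ₜ[k] v) : k) • y) ⊗ₜ[k] w)
      rw [tmul_smul, map_smul, ← smul_tmul', map_smul]
      exact mul_comm _ _
  exact key (c.hom (1 : k))

lemma rotatePow_apply (b : V ⊗ V ⟶ 𝟙_ (Rep.{u} k G)) (c : 𝟙_ (Rep.{u} k G) ⟶ V ⊗ V) (n : ℕ)
    (φ : tensorPow V (n + 1) ⟶ 𝟙_ (Rep.{u} k G)) (v : Fin (n + 1) → V) :
    (rotatePow b c n φ).hom (pureTensor V (n + 1) v) =
      φ.hom (pureTensor V (n + 1) (cyclicShift (copairingTwist b c) v)) := by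
  change (rotateForm b c φ).hom ((tensorPowSplitLast V n).hom (pureTensor V (n + 1) v)) = _
  rw [tensorPowSplitLast_pureTensor]
  exact rotateForm_apply b c φ _ _

lemma iterate_rotatePow_apply (b : V ⊗ V ⟶ 𝟙_ (Rep.{u} k G)) (c : 𝟙_ (Rep.{u} k G) ⟶ V ⊗ V)
    (n : ℕ) (φ : tensorPow V (n + 1) ⟶ 𝟙_ (Rep.{u} k G)) (v : Fin (n + 1) → V) (j : ℕ) :
    ((rotatePow b c n)^[j] φ).hom (pureTensor V (n + 1) v) =
      φ.hom (pureTensor V (n + 1) ((cyclicShift (copairingTwist b c))^[j] v)) := by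
  induction j generalizing v with
  | zero => rfl
  | succ j ih =>
    rw [Function.iterate_succ_apply', rotatePow_apply, ih, ← Function.iterate_succ_apply]

lemma copairingTwist_comm (b : V ⊗ V ⟶ 𝟙_ (Rep.{u} k G)) (c : 𝟙_ (Rep.{u} k G) ⟶ V ⊗ V)
    (g : G) (v : V) :
    copairingTwist b c (V.ρ g v) = V.ρ g (copairingTwist b c v) := by
  have key : ∀ t : V.V ⊗[k] V.V, TensorProduct.lid k V
      (((TensorProduct.curry b.hom.toLinearMap).flip (V.ρ g v)).rTensor V
        ((V.ρ.tprod V.ρ) g t)) = V.ρ g (TensorProduct.lid k V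
      (((TensorProduct.curry b.hom.toLinearMap).flip v).rTensor V t)) := by
    intro t
    induction t with
    | zero => simp
    | add s t hs ht => simp only [map_add, hs, ht]
    | tmul x y =>
      change (b.hom (V.ρ g x ⊗ₜ[k] V.ρ g v) : k) • V.ρ g y =
        V.ρ g ((b.hom (x ⊗ₜ[k] v) : k) • y)
      rw [map_smul]
      congr 1
      exact Rep.hom_comm_apply b g (x ⊗ₜ[k] v)
  have hc : (V.ρ.tprod V.ρ) g (c.hom (1 : k)) = c.hom (1 : k) :=
    (Rep.hom_comm_apply c g (1 : k)).symm
  have h := key (c.hom (1 : k))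
  rw [hc] at h
  exact h

variable {Y : Type*}

/-- The basis of a tensor power induced by a basis. -/
noncomputable def tensorPowBasis (e : Module.Basis Y k V) :
    ∀ n, Module.Basis (Fin n → Y) k (tensorPow V n).V
  | 0 => (Module.Basis.singleton (Fin 0 → Y) k : Module.Basis (Fin 0 → Y) k k)
  | n + 1 => (e.tensorProduct (tensorPowBasis e n)).reindex (Fin.consEquiv fun _ ↦ Y)

lemma tensorPowBasis_apply (e : Module.Basis Y k V) (n : ℕ) (y : Fin n → Y) :
    tensorPowBasis e n y = pureTensor V n (e ∘ y) := by
  induction n with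
  | zero => exact Module.Basis.singleton_apply (Fin 0 → Y) k y
  | succ n ih =>
    refine ((e.tensorProduct (tensorPowBasis e n)).reindex_apply _ _).trans ?_
    rw [Module.Basis.tensorProduct_apply]
    exact congrArg (e (y 0) ⊗ₜ[k] ·) (ih (Fin.tail y))

/-- The product of the coordinate functions attached to a tuple of basis indices. -/
noncomputable def coordProd (e : Module.Basis Y k V) :
    ∀ n, (Fin n → Y) → (tensorPow V n).V →ₗ[k] k
  | 0, _ => LinearMap.id
  | n + 1, w => LinearMap.mul' k k ∘ₗ
      TensorProduct.map (e.coord (w 0)) (coordProd e n (Fin.tail w))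

lemma coordProd_pureTensor (e : Module.Basis Y k V) (n : ℕ) (w : Fin n → Y) (v : Fin n → V) :
    coordProd e n w (pureTensor V n v) = ∏ i, e.coord (w i) (v i) := by
  induction n with
  | zero => rfl
  | succ n ih =>
    rw [Fin.prod_univ_succ]
    exact congrArg (e.coord (w 0) (v 0) * ·) (ih (Fin.tail w) (Fin.tail v))

/-- The sum over the group of the translates of a linear form. -/
noncomputable def sumTranslates [Fintype G] {W : Rep.{u} k G} (f : W →ₗ[k] k) :
    W ⟶ 𝟙_ (Rep.{u} k G) :=
  Rep.ofHom (σ := Representation.trivial k G k) (ρ := W.ρ) ⟨∑ h : G, f ∘ₗ W.ρ h, by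
    intro g
    ext w
    simp only [LinearMap.comp_apply, LinearMap.sum_apply, ← Module.End.mul_apply, ← map_mul]
    exact Fintype.sum_equiv (Equiv.mulRight g) _ _ fun h ↦ rfl⟩

lemma sumTranslates_apply [Fintype G] {W : Rep.{u} k G} (f : W →ₗ[k] k) (w : W) :
    (sumTranslates f).hom w = ∑ h : G, f (W.ρ h w) :=
  LinearMap.sum_apply _ _ _

lemma sum_prod_coord_copairingTwist [Fintype G] (e : Module.Basis Y k V)
    (b : V ⊗ V ⟶ 𝟙_ (Rep.{u} k G)) (c : 𝟙_ (Rep.{u} k G) ⟶ V ⊗ V) (n : ℕ)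
    (h : ∀ φ, (rotatePow b c n)^[n + 1] φ = φ) (w : Fin (n + 1) → Y) (v : Fin (n + 1) → V) :
    ∑ g : G, ∏ i, e.coord (w i) (V.ρ g (copairingTwist b c (v i))) =
      ∑ g : G, ∏ i, e.coord (w i) (V.ρ g (v i)) := by
  have := iterate_rotatePow_apply b c n (sumTranslates (coordProd e (n + 1) w)) v (n + 1)
  rw [h, iterate_cyclicShift, sumTranslates_apply, sumTranslates_apply] at this
  simpa only [ρ_pureTensor, coordProd_pureTensor, Function.comp_apply] using this.symm

end RepForms

section PermutationForms

open MonoidalCategory TensorProduct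

variable {k : Type u} {G : Type v} [Field k] [Group G] {V : Rep.{u} k G} {Y : Type*}
  [MulAction G Y]

lemma ρ_pureTensor_basis {e : Module.Basis Y k V} (he : ∀ g y, V.ρ g (e y) = e (g • y)) (n : ℕ)
    (g : G) (y : Fin n → Y) :
    (tensorPow V n).ρ g (pureTensor V n (e ∘ y)) = pureTensor V n (e ∘ (g • y)) := by
  rw [ρ_pureTensor]
  exact congrArg _ (funext fun i ↦ he g (y i))

/-- Forms on a tensor power of a permutation representation are functions on orbits of tuples. -/
noncomputable def permutationFormsEquiv {e : Module.Basis Y k V}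
    (he : ∀ g y, V.ρ g (e y) = e (g • y)) (n : ℕ) :
    (tensorPow V n ⟶ 𝟙_ (Rep.{u} k G)) ≃ₗ[k]
      (MulAction.orbitRel.Quotient G (Fin n → Y) → k) where
  toFun φ q := Quotient.liftOn' q (fun y ↦ (φ.hom (pureTensor V n (e ∘ y)) : k)) (by
    rintro _ y ⟨g, rfl⟩
    change φ.hom (pureTensor V n (e ∘ (g • y))) = φ.hom (pureTensor V n (e ∘ y))
    rw [← ρ_pureTensor_basis he]
    exact Rep.hom_comm_apply φ g _)
  map_add' φ ψ := by
    funext q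
    induction q using Quotient.inductionOn'
    rfl
  map_smul' r φ := by
    funext q
    induction q using Quotient.inductionOn'
    rfl
  invFun f := Rep.ofHom (σ := Representation.trivial k G k) (ρ := (tensorPow V n).ρ)
    ⟨(tensorPowBasis e n).constr k fun y ↦ f (Quotient.mk'' y), by
      intro g
      refine (tensorPowBasis e n).ext fun y ↦ ?_
      simp only [LinearMap.comp_apply]
      rw [tensorPowBasis_apply, ρ_pureTensor_basis he, ← tensorPowBasis_apply,
        ← tensorPowBasis_apply, Module.Basis.constr_basis, Module.Basis.constr_basis]
      exact congrArg f (Quotient.sound' ⟨g, rfl⟩)⟩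
  left_inv φ := by
    ext : 2
    refine (tensorPowBasis e n).ext fun y ↦ ?_
    refine ((tensorPowBasis e n).constr_basis k _ y).trans ?_
    rw [tensorPowBasis_apply]
    rfl
  right_inv f := by
    funext q
    induction q using Quotient.inductionOn' with | _ y
    change (tensorPowBasis e n).constr k (fun y ↦ f (Quotient.mk'' y)) (pureTensor V n (e ∘ y)) = _
    rw [← tensorPowBasis_apply, Module.Basis.constr_basis]

lemma permutationFormsEquiv_apply {e : Module.Basis Y k V}
    (he : ∀ g y, V.ρ g (e y) = e (g • y)) (n : ℕ) (φ : tensorPow V n ⟶ 𝟙_ (Rep.{u} k G))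
    (y : Fin n → Y) :
    permutationFormsEquiv he n φ (Quotient.mk'' y) = φ.hom (pureTensor V n (e ∘ y)) := rfl

lemma permutationFormsEquiv_rotatePow [Finite G] [Finite Y] {e : Module.Basis Y k V}
    (he : ∀ g y, V.ρ g (e y) = e (g • y)) (b : V ⊗ V ⟶ 𝟙_ (Rep.{u} k G))
    (c : 𝟙_ (Rep.{u} k G) ⟶ V ⊗ V) (z : G) (hz : ∀ g : G, z * g = g * z)
    (hbc : ∀ y, copairingTwist b c (e y) = e (z • y)) (n : ℕ)
    (φ : tensorPow V (n + 1) ⟶ 𝟙_ (Rep.{u} k G)) :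
    permutationFormsEquiv he (n + 1) (rotatePow b c n φ) =
      permutationFormsEquiv he (n + 1) φ ∘ orbitShift z hz n := by
  funext q
  induction q using Quotient.inductionOn' with | _ y
  rw [Function.comp_apply, orbitShift_mk, permutationFormsEquiv_apply, permutationFormsEquiv_apply,
    rotatePow_apply, ← cyclicShift_comp (f := e) (a := (z • ·)) fun y ↦ (hbc y).symm]

end PermutationForms

section Translations

lemma exists_eq_of_sum_monoidHom_eq {M k ι : Type*} [Monoid M] [Field k] [Fintype ι]
    {χ ψ : ι → M →* k} (hχ : Function.Injective χ) (h : ∀ m, ∑ i, χ i m = ∑ i, ψ i m) (i : ι) :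
    ∃ j, χ i = ψ j := by
  classical
  by_contra! hi
  have hl := (linearIndependent_iff.1 (linearIndependent_monoidHom M k))
    (∑ j, Finsupp.single (χ j) 1 - ∑ j, Finsupp.single (ψ j) 1) (by
      funext m
      simp [h m])
  have := DFunLike.congr_fun hl (χ i)
  simp [Finsupp.single_apply, hχ.eq_iff, (hi _).symm] at this

variable {k V G Y : Type*} [Field k] [AddCommGroup V] [Module k V] [Group G] [Fintype G]
  [MulAction G Y] {ρ : Representation k G V} {e : Module.Basis Y k V} {α : V →ₗ[k] V}

lemma injective_of_sum_prod_coord [Nonempty Y] (hfree : ∀ (g : G) (y : Y), g • y = y → g = 1)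
    (he : ∀ g y, ρ g (e y) = e (g • y))
    (hα : ∀ (w : Fin 2 → Y) (v : Fin 2 → V), ∑ g : G, ∏ i, e.coord (w i) (ρ g (α (v i))) =
      ∑ g : G, ∏ i, e.coord (w i) (ρ g (v i))) :
    Function.Injective α := by
  classical
  refine (injective_iff_map_eq_zero α).2 fun v hv ↦ e.ext_elem fun y ↦ ?_
  let y₀ : Y := Classical.arbitrary Y
  have hy : ∀ g : G, e.repr (ρ g (e y₀)) y₀ = if g = 1 then 1 else 0 := by
    intro g
    rw [he, e.repr_self, Finsupp.single_apply]
    exact if_congr ⟨hfree g y₀, fun h ↦ by rw [h, one_smul]⟩ rfl rfl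
  have h := hα ![y₀, y] ![e y₀, v]
  simpa [Fin.prod_univ_two, hv, hy] using h.symm

lemma exists_central_smul_of_sum_prod_coord [Nonempty Y] [Finite Y]
    (hfree : ∀ (g : G) (y : Y), g • y = y → g = 1) (he : ∀ g y, ρ g (e y) = e (g • y))
    (hcomm : ∀ g v, α (ρ g v) = ρ g (α v))
    (hα : ∀ (n : ℕ) (w : Fin (n + 1) → Y) (v : Fin (n + 1) → V),
      ∑ g : G, ∏ i, e.coord (w i) (ρ g (α (v i))) = ∑ g : G, ∏ i, e.coord (w i) (ρ g (v i))) :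
    ∃ z : G, (∀ g : G, z * g = g * z) ∧ ∀ y, α (e y) = e (z • y) := by
  have : Module.Finite k V := .of_basis e
  have hinj : ∀ {g h : G} {y : Y}, g • y = h • y → g = h := fun {g h y} H ↦
    (inv_mul_eq_one.1 (hfree (h⁻¹ * g) y (by rw [mul_smul, H, inv_smul_smul]))).symm
  have hsurj : Function.Surjective α :=
    LinearMap.surjective_of_injective (injective_of_sum_prod_coord hfree he (hα 1))
  let χ : G → FreeMonoid (Y × Y) →* k := fun g ↦
    FreeMonoid.lift fun p ↦ e.coord p.1 (ρ g (α (e p.2)))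
  let ψ : G → FreeMonoid (Y × Y) →* k := fun g ↦ FreeMonoid.lift fun p ↦ e.coord p.1 (ρ g (e p.2))
  have hχ : Function.Injective χ := by
    intro g h H
    have H' : ρ g ∘ₗ α = ρ h ∘ₗ α := e.ext fun x ↦ e.ext_elem fun w ↦ by
      simpa [χ] using DFunLike.congr_fun H (FreeMonoid.of (w, x))
    obtain ⟨v, hv⟩ := hsurj (e (Classical.arbitrary Y))
    have := LinearMap.congr_fun H' v
    simp only [LinearMap.comp_apply, hv, he] at this
    exact hinj (e.injective this)
  have hsum : ∀ m, ∑ g, χ g m = ∑ g, ψ g m := by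
    intro m
    simp only [χ, ψ, FreeMonoid.lift_apply]
    generalize m.toList = l
    cases l with
    | nil => simp
    | cons a l =>
      have := hα l.length (fun i ↦ ((a :: l)[i]).1) (fun i ↦ e ((a :: l)[i]).2)
      simp only [← Fin.prod_univ_fun_getElem]
      exact this
  obtain ⟨z, hz⟩ := exists_eq_of_sum_monoidHom_eq hχ hsum 1
  have hz' : ∀ y, α (e y) = e (z • y) := fun y ↦ e.ext_elem fun w ↦ by
    simpa [χ, ψ, he] using DFunLike.congr_fun hz (FreeMonoid.of (w, y))
  refine ⟨z, fun g ↦ ?_, hz'⟩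
  have := hcomm g (e (Classical.arbitrary Y))
  rw [he, hz', hz', he] at this
  exact hinj (by simpa [mul_smul] using e.injective this)

end Translations

section PermutationBasis

open MonoidalCategory TensorProduct

variable {k : Type u} {G : Type v} [Field k] [Group G] {V : Rep.{u} k G} {Y : Type*}
  [MulAction G Y]

/-- The pairing for which a basis permuted by the group is orthonormal. -/
noncomputable def permutationPairing {e : Module.Basis Y k V}
    (he : ∀ g y, V.ρ g (e y) = e (g • y)) : V ⊗ V ⟶ 𝟙_ (Rep.{u} k G) :=
  letI := Classical.decEq Y
  Rep.ofHom (σ := Representation.trivial k G k) (ρ := V.ρ.tprod V.ρ)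
    ⟨TensorProduct.lift e.toDual, fun g ↦ (e.tensorProduct e).ext fun y ↦ by
      simp [Module.Basis.tensorProduct_apply', he, Module.Basis.toDual_apply]⟩

lemma permutationPairing_tmul {e : Module.Basis Y k V}
    (he : ∀ g y, V.ρ g (e y) = e (g • y)) (y : Y) (v : V) :
    (permutationPairing he).hom (e y ⊗ₜ[k] v) = e.repr v y :=
  letI := Classical.decEq Y
  e.toDual_apply_right y v

variable [Fintype Y]

/-- The copairing dual to `permutationPairing`. -/
noncomputable def permutationCopairing {e : Module.Basis Y k V}
    (he : ∀ g y, V.ρ g (e y) = e (g • y)) : 𝟙_ (Rep.{u} k G) ⟶ V ⊗ V :=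
  Rep.ofHom (σ := V.ρ.tprod V.ρ) (ρ := Representation.trivial k G k)
    ⟨LinearMap.toSpanSingleton k (V.V ⊗[k] V.V) (∑ y, e y ⊗ₜ[k] e y), fun g ↦ by
      ext
      simp only [LinearMap.comp_apply, LinearMap.toSpanSingleton_apply, one_smul, map_sum,
        Representation.tprod_apply, TensorProduct.map_tmul, he, Representation.trivial_apply]
      exact (Fintype.sum_equiv (MulAction.toPerm g) _ _ fun y ↦ rfl).symm⟩

lemma permutationCopairing_one {e : Module.Basis Y k V}
    (he : ∀ g y, V.ρ g (e y) = e (g • y)) :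
    (permutationCopairing he).hom (1 : k) = ∑ y, e y ⊗ₜ[k] e y :=
  one_smul k _

lemma copairingTwist_permutation {e : Module.Basis Y k V}
    (he : ∀ g y, V.ρ g (e y) = e (g • y)) (v : V) :
    copairingTwist (permutationPairing he) (permutationCopairing he) v = v := by
  refine Eq.trans ?_ (e.sum_repr v)
  change TensorProduct.lid k V (((TensorProduct.curry
    (permutationPairing he).hom.toLinearMap).flip v).rTensor V
      ((permutationCopairing he).hom (1 : k))) = _
  rw [permutationCopairing_one, map_sum, map_sum]
  refine Finset.sum_congr rfl fun y _ ↦ ?_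
  exact congrArg (· • e y) (permutationPairing_tmul he y v)

lemma iterate_rotatePow_permutation {e : Module.Basis Y k V}
    (he : ∀ g y, V.ρ g (e y) = e (g • y)) (n : ℕ) (φ : tensorPow V (n + 1) ⟶ 𝟙_ (Rep.{u} k G)) :
    (rotatePow (permutationPairing he) (permutationCopairing he) n)^[n + 1] φ = φ := by
  ext : 2
  refine (tensorPowBasis e (n + 1)).ext fun y ↦ ?_
  rw [tensorPowBasis_apply]
  refine (iterate_rotatePow_apply _ _ n φ (e ∘ y) (n + 1)).trans ?_
  rw [iterate_cyclicShift]
  exact congrArg (fun v ↦ φ.hom (pureTensor V (n + 1) v))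
    (funext fun i ↦ copairingTwist_permutation he _)

/-- A finite-dimensional permutation representation is self-dual. -/
noncomputable abbrev exactPairingPermutation {e : Module.Basis Y k V}
    (he : ∀ g y, V.ρ g (e y) = e (g • y)) : ExactPairing V V where
  coevaluation' := permutationCopairing he
  evaluation' := permutationPairing he
  coevaluation_evaluation' := by
    ext : 2
    refine (e.tensorProduct (Module.Basis.singleton Unit k)).ext fun x ↦ ?_
    rw [Module.Basis.tensorProduct_apply', Module.Basis.singleton_apply]
    change ((α_ V V V).inv ≫ permutationPairing he ▷ V).hom
      (e x.1 ⊗ₜ[k] (permutationCopairing he).hom (1 : k)) = (1 : k) ⊗ₜ[k] ((1 : k) • e x.1)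
    rw [permutationCopairing_one, tmul_sum, map_sum, one_smul]
    trans ∑ y, (e.repr (e y) x.1) ⊗ₜ[k] e y
    · exact Finset.sum_congr rfl fun y _ ↦
        congrArg (· ⊗ₜ[k] e y) (permutationPairing_tmul he x.1 (e y))
    · classical simp [Finsupp.single_apply, ite_tmul]
  evaluation_coevaluation' := by
    ext : 2
    refine ((Module.Basis.singleton Unit k).tensorProduct e).ext fun x ↦ ?_
    rw [Module.Basis.tensorProduct_apply', Module.Basis.singleton_apply]
    change ((α_ V V V).hom ≫ V ◁ permutationPairing he).hom
      ((permutationCopairing he).hom (1 : k) ⊗ₜ[k] e x.2) = ((1 : k) • e x.2) ⊗ₜ[k] (1 : k)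
    rw [permutationCopairing_one, sum_tmul, map_sum, one_smul]
    trans ∑ y, e y ⊗ₜ[k] (e.repr (e x.2) y)
    · exact Finset.sum_congr rfl fun y _ ↦
        congrArg (e y ⊗ₜ[k] ·) (permutationPairing_tmul he y (e x.2))
    · classical simp [Finsupp.single_apply, tmul_ite]

lemma finite_of_exactPairing {V W : Rep.{u} k G} [ExactPairing V W] : Module.Finite k V := by
  classical
  have key : ∀ t : V.V ⊗[k] W.V, ∃ S : Finset V, ∀ v : V,
      ((α_ V W V).hom ≫ V ◁ ExactPairing.evaluation V W ≫ (ρ_ V).hom).hom (t ⊗ₜ[k] v) ∈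
        Submodule.span k (S : Set V) := by
    intro t
    induction t with
    | zero => exact ⟨∅, by simp⟩
    | add s t hs ht =>
      obtain ⟨S, hS⟩ := hs
      obtain ⟨T, hT⟩ := ht
      refine ⟨S ∪ T, fun v ↦ ?_⟩
      rw [add_tmul, map_add]
      exact add_mem (Submodule.span_mono (by simp) (hS v)) (Submodule.span_mono (by simp) (hT v))
    | tmul x y =>
      refine ⟨{x}, fun v ↦ ?_⟩
      change ((ExactPairing.evaluation V W).hom (y ⊗ₜ[k] v) : k) • x ∈ _
      exact Submodule.smul_mem _ _ (Submodule.subset_span (by simp))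
  obtain ⟨S, hS⟩ := key ((ExactPairing.coevaluation V W).hom (1 : k))
  refine ⟨⟨S, eq_top_iff.2 fun v _ ↦ ?_⟩⟩
  have h : (λ_ V).inv ≫ ExactPairing.coevaluation V W ▷ V ≫ (α_ V W V).hom ≫
      V ◁ ExactPairing.evaluation V W ≫ (ρ_ V).hom = 𝟙 V := by
    simp
  have hv := congrArg (fun f : V ⟶ V ↦ f.hom v) h
  rw [← show _ = v from hv]
  exact hS v

/-- The standard basis of the regular representation. -/
noncomputable def leftRegularBasis (k : Type u) (G : Type u) [Field k] [Group G] :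
    Module.Basis G k (Rep.leftRegular k G) :=
  .ofRepr (MonoidAlgebra.coeffLinearEquiv k)

lemma ρ_leftRegularBasis (k : Type u) (G : Type u) [Field k] [Group G] (g h : G) :
    (Rep.leftRegular k G).ρ g (leftRegularBasis k G h) = leftRegularBasis k G (g • h) := by
  simp [leftRegularBasis]

/-- The tensor product of a regular representation with a nonzero finite-dimensional
representation has a basis permuted freely by the group. -/
lemma exists_free_permutation_basis {G : Type u} [Group G] [Finite G] {A W : Rep.{u} k G}
    [Module.Finite k A] [Nontrivial A] (i : Rep.leftRegular k G ⊗ A ≅ W) :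
    ∃ (d : ℕ) (_ : MulAction G (G × Fin d)) (e : Module.Basis (G × Fin d) k W), 0 < d ∧
      (∀ (g : G) (y : G × Fin d), g • y = y → g = 1) ∧ ∀ g y, W.ρ g (e y) = e (g • y) := by
  classical
  let ρ' (g : G) : A ≃ₗ[k] A :=
    LinearEquiv.ofLinearMap (A.ρ g) (A.ρ g⁻¹) (by ext; simp) (by ext; simp)
  let u := Module.finBasis k A
  let act : MulAction G (G × Fin (Module.finrank k A)) :=
    { smul g y := (g * y.1, y.2)
      one_smul y := Prod.ext (one_mul _) rfl
      mul_smul g h y := Prod.ext (mul_assoc _ _ _) rfl }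
  let T : (Rep.leftRegular k G).V ⊗[k] A.V ≃ₗ[k] G →₀ A.V :=
    (leftRegularBasis k G).repr.rTensor A ≪≫ₗ finsuppScalarLeft k A G
  let e₀ := ((Finsupp.basis fun g ↦ u.map (ρ' g)).map T.symm).reindex (Equiv.sigmaEquivProd _ _)
  have he₀ (y) : e₀ y = leftRegularBasis k G y.1 ⊗ₜ[k] A.ρ y.1 (u y.2) := by
    have h₁ : e₀ y = T.symm (Finsupp.single y.1 (A.ρ y.1 (u y.2))) := by
      simp [e₀, Finsupp.coe_basis, ρ']
    rw [h₁, LinearEquiv.symm_apply_eq]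
    simp [T, finsuppScalarLeft_apply_tmul]
  refine ⟨Module.finrank k A, act, e₀.map (Representation.equivOfIso i).toLinearEquiv,
    Module.finrank_pos, fun g y h ↦ mul_eq_right.1 (congrArg Prod.fst h), fun g y ↦ ?_⟩
  rw [Module.Basis.map_apply, Module.Basis.map_apply, he₀, he₀]
  refine (Rep.hom_comm_apply i.hom g _).symm.trans ?_
  refine congrArg i.hom.hom ?_
  refine (congrArg₂ (· ⊗ₜ[k] ·) (ρ_leftRegularBasis k G g y.1) ?_ :
    (Rep.leftRegular k G).ρ g (leftRegularBasis k G y.1) ⊗ₜ[k] A.ρ g (A.ρ y.1 (u y.2)) = _)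
  rw [← Module.End.mul_apply, ← map_mul]
  rfl

end PermutationBasis

section Isocategorical

open MonoidalCategory

lemma nontrivial_of_not_isZero {k : Type u} {G : Type v} [Field k] [Group G] {V : Rep.{u} k G}
    (h : ¬ Limits.IsZero V) : Nontrivial V :=
  not_subsingleton_iff_nontrivial.1 fun h' ↦ h ((Rep.isZero_iff _ _ V).2 h')

variable {k G G' : Type u} [Field k] [Group G] [Group G']

lemma not_isZero_leftRegular : ¬ Limits.IsZero (Rep.leftRegular k G) := fun h ↦
  have := (Rep.isZero_iff _ _ _).1 h
  (leftRegularBasis k G).ne_zero 1 (Subsingleton.elim _ _)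

variable (E : Rep.{u} k G ≌ Rep.{u} k G')

lemma nontrivial_inverse_leftRegular : Nontrivial (E.inverse.obj (Rep.leftRegular k G')) :=
  nontrivial_of_not_isZero fun h ↦ not_isZero_leftRegular
    ((E.functor.map_isZero h).of_iso (E.counitIso.app _).symm)

lemma finite_inverse_leftRegular [Finite G'] [E.functor.Monoidal] :
    Module.Finite k (E.inverse.obj (Rep.leftRegular k G')) := by
  have := Fintype.ofFinite G'
  let : ExactPairing ((𝟭 (Rep.{u} k G')).obj (Rep.leftRegular k G'))
      ((𝟭 (Rep.{u} k G')).obj (Rep.leftRegular k G')) :=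
    exactPairingPermutation (ρ_leftRegularBasis k G')
  let : ExactPairing (E.functor.obj (E.inverse.obj (Rep.leftRegular k G')))
      (E.functor.obj (E.inverse.obj (Rep.leftRegular k G'))) :=
    exactPairingCongr (E.counitIso.app _) (E.counitIso.app _)
  let := ExactPairing.ofFullyFaithful E.functor (E.inverse.obj (Rep.leftRegular k G'))
    (E.inverse.obj (Rep.leftRegular k G'))
  exact finite_of_exactPairing (W := E.inverse.obj (Rep.leftRegular k G'))

/-- Given free permutation bases of a representation and of its image under a monoidal
equivalence, the shift of orbits of tuples has as many fixed points as a shift twisted by a central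
element. -/
lemma exists_central_card_eq [Finite G] [Finite G'] [E.functor.Additive] [E.functor.Linear k]
    [E.functor.Monoidal] {X : Rep.{u} k G} {Y Y' : Type*} [Finite Y] [Finite Y'] [Nonempty Y']
    [MulAction G Y] [MulAction G' Y'] {e : Module.Basis Y k X}
    {e' : Module.Basis Y' k (E.functor.obj X)}
    (he : ∀ g y, X.ρ g (e y) = e (g • y))
    (he' : ∀ g y, (E.functor.obj X).ρ g (e' y) = e' (g • y))
    (hfree' : ∀ (g : G') (y : Y'), g • y = y → g = 1) :
    ∃ (z : G') (hz : ∀ g, z * g = g * z), ∀ n,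
      Nat.card {q : MulAction.orbitRel.Quotient G (Fin (n + 1) → Y) //
        orbitShift 1 (fun g ↦ by simp) n q = q} =
      Nat.card {q : MulAction.orbitRel.Quotient G' (Fin (n + 1) → Y') //
        orbitShift z hz n q = q} := by
  have := Fintype.ofFinite Y
  have := Fintype.ofFinite G'
  let b := permutationPairing he
  let c := permutationCopairing he
  let b' := mapPairing E.functor b
  let c' := mapCopairing E.functor c
  have hrot (n : ℕ) (φ) : (rotatePow b' c' n)^[n + 1] φ = φ := by
    obtain ⟨φ, rfl⟩ := (mapFormEquiv E.functor k X (n + 1)).surjective φ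
    have hs : Function.Semiconj (mapFormEquiv E.functor k X (n + 1)) (rotatePow b c n)
        (rotatePow b' c' n) := fun φ ↦ (rotatePow_mapForm E.functor b c n φ).symm
    rw [← (hs.iterate_right (n + 1)).eq, iterate_rotatePow_permutation he]
  obtain ⟨z, hz, hz'⟩ := exists_central_smul_of_sum_prod_coord hfree' he'
    (copairingTwist_comm b' c') fun n ↦ sum_prod_coord_copairingTwist e' b' c' n (hrot n)
  refine ⟨z, hz, fun n ↦ Equiv.Perm.card_fixedPoints_eq_of_linearEquiv _ _
    ((permutationFormsEquiv he (n + 1)).symm ≪≫ₗ mapFormEquiv E.functor k X (n + 1) ≪≫ₗ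
      permutationFormsEquiv he' (n + 1)) fun f ↦ ?_⟩
  obtain ⟨φ, rfl⟩ := (permutationFormsEquiv he (n + 1)).surjective f
  rw [← permutationFormsEquiv_rotatePow he b c 1 _
    fun y ↦ by rw [one_smul]; exact copairingTwist_permutation he _]
  simp only [LinearEquiv.trans_apply, LinearEquiv.symm_apply_apply]
  rw [← permutationFormsEquiv_rotatePow he' b' c' z hz hz']
  exact congrArg _ (rotatePow_mapForm E.functor b c n φ).symm

lemma exists_card_pow_eq [Finite G] [Finite G'] [E.functor.Additive] [E.functor.Linear k]
    [E.functor.Monoidal] : ∃ (d d' : ℕ) (z : G'), 0 < d ∧ 0 < d' ∧ ∀ n,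
      d * Nat.card {g : G // g ^ (n + 1) = 1} = d' * Nat.card {h : G' // h ^ (n + 1) = z} := by
  have := finite_inverse_leftRegular E
  have := nontrivial_inverse_leftRegular E
  have : Module.Finite k (E.functor.obj (Rep.leftRegular k G)) :=
    letI := E.inverseMonoidal
    finite_inverse_leftRegular E.symm
  have : Nontrivial (E.functor.obj (Rep.leftRegular k G)) := nontrivial_inverse_leftRegular E.symm
  obtain ⟨d, _, e, hd, hfree, he⟩ := exists_free_permutation_basis
    (Iso.refl (Rep.leftRegular k G ⊗ E.inverse.obj (Rep.leftRegular k G')))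
  obtain ⟨d', _, e', hd', hfree', he'⟩ := exists_free_permutation_basis
    (β_ _ _ ≪≫ whiskerLeftIso (E.functor.obj (Rep.leftRegular k G)) (E.counitIso.app _).symm ≪≫
      Functor.Monoidal.μIso E.functor (Rep.leftRegular k G)
        (E.inverse.obj (Rep.leftRegular k G')))
  have := Fin.pos_iff_nonempty.1 hd'
  obtain ⟨z, hz, h⟩ := exists_central_card_eq E he he' hfree'
  refine ⟨d, d', z, hd, hd', fun n ↦ ?_⟩
  have h₁ := card_fixedPoints_orbitShift hfree 1 (fun g ↦ by simp) n
  have h₂ := card_fixedPoints_orbitShift hfree' z hz n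
  rw [Nat.card_prod, Nat.card_fin, mul_assoc, mul_comm] at h₁ h₂
  rw [← Nat.eq_of_mul_eq_mul_left Nat.card_pos h₁, h n, Nat.eq_of_mul_eq_mul_left Nat.card_pos h₂]

/-- Monoidally equivalent linear representation categories come from groups with the same number of
solutions of `g ^ n = 1`. -/
lemma card_pow_eq_one_eq_of_isocategorical [Finite G] [Finite G'] [E.functor.Additive]
    [E.functor.Linear k] [E.functor.Monoidal] {n : ℕ} (hn : 0 < n) :
    Nat.card {g : G // g ^ n = 1} = Nat.card {h : G' // h ^ n = 1} := by
  obtain ⟨d, d', z, hd, hd', h⟩ := exists_card_pow_eq E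
  have hdd : d = d' := by
    simpa using h 0
  subst hdd
  replace h n := Nat.eq_of_mul_eq_mul_left hd (h n)
  have hz : z = 1 := by
    have hN : 0 < Nat.card G * Nat.card G' := Nat.mul_pos Nat.card_pos Nat.card_pos
    have := h (Nat.card G * Nat.card G' - 1)
    rw [Nat.sub_add_cancel hN] at this
    have hpos : 0 < Nat.card {g : G // g ^ (Nat.card G * Nat.card G') = 1} :=
      have : Nonempty {g : G // g ^ (Nat.card G * Nat.card G') = 1} := ⟨⟨1, one_pow _⟩⟩
      Nat.card_pos
    rw [this] at hpos
    obtain ⟨h, hh⟩ := (Nat.card_pos_iff.1 hpos).1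
    rw [← hh, pow_mul', pow_card_eq_one', one_pow]
  subst hz
  obtain ⟨n, rfl⟩ := Nat.exists_eq_succ_of_ne_zero hn.ne'
  exact h n

end Isocategorical

lemma sum_natCard_orderOf_eq {G : Type*} [Group G] [Finite G] {n : ℕ} (hn : 0 < n) :
    ∑ m ∈ n.divisors, Nat.card {g : G // orderOf g = m} = Nat.card {g : G // g ^ n = 1} := by
  classical
  have := Fintype.ofFinite G
  simp only [Nat.card_eq_fintype_card, Fintype.card_subtype]
  convert sum_card_orderOf_eq_card_pow_eq_one (G := G) hn.ne'

lemma card_orderOf_eq_of_card_pow_eq_one {G G' : Type*} [Group G] [Group G'] [Finite G] [Finite G']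
    (h : ∀ n, 0 < n → Nat.card {g : G // g ^ n = 1} = Nat.card {g : G' // g ^ n = 1}) {n : ℕ}
    (hn : 0 < n) :
    Nat.card {g : G // orderOf g = n} = Nat.card {g : G' // orderOf g = n} := by
  induction n using Nat.strong_induction_on with | _ n ih
  have key := h n hn
  rw [← sum_natCard_orderOf_eq hn, ← sum_natCard_orderOf_eq hn,
    ← Nat.cons_self_properDivisors hn.ne', Finset.sum_cons, Finset.sum_cons,
    Finset.sum_congr rfl fun m hm ↦ ih m (Nat.mem_properDivisors.1 hm).2
      (Nat.pos_of_mem_properDivisors hm)] at key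
  exact Nat.add_right_cancel key

/-- If two finite groups `G` and `G'` are `k`-isocategorical, i.e. there is an equivalence
of categories `Rep k G ≌ Rep k G'` whose underlying functor is `k`-linear and monoidal,
then for every positive integer `n` the number of elements of order `n` in `G` equals the
number of elements of order `n` in `G'`. -/
theorem number_of_elements_of_order_eq_of_isocategorical
    (k : Type) [Field k] (G G' : Type) [Group G] [Fintype G] [Group G'] [Fintype G']
    (E : Rep k G ≌ Rep k G')
    [E.functor.Additive] [E.functor.Linear k] [E.functor.Monoidal]
    (n : ℕ) (hn : 0 < n) :
    Nat.card {g : G | orderOf g = n} = Nat.card {g : G' | orderOf g = n} := by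
  exact card_orderOf_eq_of_card_pow_eq_one
    (fun _ h ↦ card_pow_eq_one_eq_of_isocategorical E h) hn
end

section
/- Let k be a field and let G and G' be finite groups with Nat.card G < 32. If G and G' are k-isocategorical, i.e., there exists an equivalence of categories E : Rep k G ≌ Rep k G' whose underlying functor is k-linear (additive and k-linear) and monoidal, then G and G' are isomorphic as groups (there exists a group isomorphism G ≃* G'). -/
open CategoryTheory

open scoped TensorProduct

/-- Commuting actions of two finite groups on a finite-dimensional algebra `A`, such that `A` is a
Galois algebra for the first group, and the second group acts faithfully with trivial invariants. -/
structure IsGaloisPair {K A G G' : Type*} [Field K] [Ring A] [Algebra K A] [Group G] [Group G']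
    (ρ : G →* (A ≃ₐ[K] A)) (ρ' : G' →* (A ≃ₐ[K] A)) : Prop where
  comm : ∀ g g' a, ρ g (ρ' g' a) = ρ' g' (ρ g a)
  nontrivial : Nontrivial A
  finite : Module.Finite K A
  finrank_eq : Module.finrank K A = Nat.card G
  exists_dual : ∃ (n : ℕ) (x y : Fin n → A), (∑ i, x i * y i = 1) ∧
    ∀ g, g ≠ 1 → ∑ i, x i * ρ g (y i) = 0
  fixed : ∀ a, (∀ g', ρ' g' a = a) → ∃ c : K, a = algebraMap K A c
  faithful : ∀ g', (∀ a, ρ' g' a = a) → g' = 1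

namespace IsGaloisPair

variable {K A G G' : Type*} [Field K] [Ring A] [Algebra K A] [Group G'] [Group G]

/-- The canonical map `A ⊗ A → (G → A)`, `a ⊗ b ↦ (g ↦ a * g b)`. -/
noncomputable def canonicalMap (ρ : G →* (A ≃ₐ[K] A)) : A ⊗[K] A →ₗ[K] (G → A) :=
  LinearMap.pi fun g => LinearMap.mul' K A ∘ₗ
    TensorProduct.map LinearMap.id (ρ g).toLinearMap

@[simp]
lemma canonicalMap_tmul (ρ : G →* (A ≃ₐ[K] A)) (a b : A) (g : G) :
    canonicalMap ρ (a ⊗ₜ b) g = a * ρ g b := by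
  simp [canonicalMap]

variable {ρ : G →* (A ≃ₐ[K] A)} {ρ' : G' →* (A ≃ₐ[K] A)}

lemma canonicalMap_sum_apply {n : ℕ} {x y : Fin n → A} (h1 : ∑ i, x i * y i = 1)
    (h2 : ∀ g, g ≠ 1 → ∑ i, x i * ρ g (y i) = 0) (a b : A) (g h : G) [Decidable (g = h)] :
    canonicalMap ρ (∑ i, (a * x i) ⊗ₜ (ρ h⁻¹ (y i) * b)) g =
      if g = h then a * ρ h b else 0 := by
  have key : canonicalMap ρ (∑ i, (a * x i) ⊗ₜ (ρ h⁻¹ (y i) * b)) g =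
      a * (∑ i, x i * ρ (g * h⁻¹) (y i)) * ρ g b := by
    simp [Finset.mul_sum, Finset.sum_mul, mul_assoc]
  rw [key]
  split_ifs with hgh
  · subst hgh
    simp [h1]
  · rw [h2 _ (fun h' => hgh (mul_inv_eq_one.mp h'))]
    simp

lemma canonicalMap_injective (P : IsGaloisPair ρ ρ') [Finite G] :
    Function.Injective (canonicalMap ρ) := by
  classical
  have := P.finite
  have := Fintype.ofFinite G
  obtain ⟨n, x, y, h1, h2⟩ := P.exists_dual
  rw [LinearMap.injective_iff_surjective_of_finrank_eq_finrank]
  · intro f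
    refine ⟨∑ h, ∑ i, (f h * x i) ⊗ₜ (ρ h⁻¹ (y i) * 1), ?_⟩
    ext g
    rw [map_sum, Finset.sum_apply]
    simp_rw [canonicalMap_sum_apply h1 h2]
    simp
  · rw [Module.finrank_tensorProduct, P.finrank_eq]
    simp [Module.finrank_pi_fintype, P.finrank_eq]

/-- The orbit of a nonzero element generates the unit right ideal. -/
lemma exists_one_eq_sum (P : IsGaloisPair ρ ρ') [Fintype G] {b : A} (hb : b ≠ 0) :
    ∃ a : G → A, 1 = ∑ h, ρ h b * a h := by
  classical
  obtain ⟨n, x, y, h1, h2⟩ := P.exists_dual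
  have key : (1 : A) ⊗ₜ[K] b = ∑ h, ∑ i, (ρ h b * x i) ⊗ₜ (ρ h⁻¹ (y i) * 1) := by
    apply P.canonicalMap_injective
    ext g
    rw [map_sum, Finset.sum_apply]
    simp_rw [canonicalMap_sum_apply h1 h2]
    simp
  obtain ⟨f, hf⟩ := Module.exists_dual_forall_apply_eq_one (K := K) (s := Set.univ)
    (v := fun _ : Unit => b) ((LinearIndependent.of_subsingleton () hb).linearIndepOn _)
  let r : A ⊗[K] A →ₗ[K] A := (TensorProduct.rid K A).toLinearMap ∘ₗ
    TensorProduct.map LinearMap.id f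
  have hr (a b : A) : r (a ⊗ₜ b) = f b • a := by simp [r]
  refine ⟨fun h => ∑ i, f (ρ h⁻¹ (y i)) • x i, ?_⟩
  have hfb : f b = 1 := hf () trivial
  simpa [hr, hfb, Finset.mul_sum] using congrArg r key

/-- `A` is the sum of the spaces of elements `u` with `u * b = ρ h b * u`. -/
lemma exists_decomposition (P : IsGaloisPair ρ ρ') [Fintype G] :
    ∃ p : G → A → A, (∀ h z b, p h z * b = ρ h b * p h z) ∧ ∀ z, z = ∑ h, p h z := by
  classical
  obtain ⟨n, x, y, h1, h2⟩ := P.exists_dual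
  let s (z : A) : A ⊗[K] A →ₗ[K] A := LinearMap.mul' K A ∘ₗ
    TensorProduct.map (LinearMap.mulRight K z) LinearMap.id
  have hs (z a b : A) : s z (a ⊗ₜ b) = a * z * b := by simp [s]
  refine ⟨fun h z => ∑ i, x i * z * ρ h⁻¹ (y i), fun h z b => ?_, fun z => ?_⟩
  · have key : ∑ i, (1 * x i) ⊗ₜ[K] (ρ h⁻¹ (y i) * b) =
        ∑ i, (ρ h b * x i) ⊗ₜ (ρ h⁻¹ (y i) * 1) := by
      apply P.canonicalMap_injective
      ext g
      rw [canonicalMap_sum_apply h1 h2, canonicalMap_sum_apply h1 h2]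
      simp
    simpa [hs, Finset.sum_mul, Finset.mul_sum, mul_assoc] using congrArg (s z) key
  · have key : (1 : A) ⊗ₜ[K] (1 : A) = ∑ h, ∑ i, (1 * x i) ⊗ₜ (ρ h⁻¹ (y i) * 1) := by
      apply P.canonicalMap_injective
      ext g
      rw [map_sum, Finset.sum_apply]
      simp_rw [canonicalMap_sum_apply h1 h2]
      simp
    simpa [hs] using congrArg (s z) key

end IsGaloisPair

/-- `e` is a central idempotent cutting out a full matrix algebra over `K`. -/
structure IsMatrixBlock (K : Type*) {A : Type*} [Field K] [Ring A] [Algebra K A] (e : A) :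
    Prop where
  ne_zero : e ≠ 0
  mul_self : e * e = e
  comm : ∀ a, e * a = a * e
  center : ∀ z, (∀ a, z * a = a * z) → ∃ c : K, e * z = c • e
  simple : ∀ u, u ≠ 0 → e * u = u → ∃ (m : ℕ) (a b : Fin m → A), e = ∑ i, a i * u * b i
  finrank_eq : ∃ d : ℕ, Module.finrank K (LinearMap.range (LinearMap.mulLeft K e)) = d ^ 2

lemma exists_isMatrixBlock (K : Type*) {A : Type*} [Field K] [IsAlgClosed K] [Ring A] [Algebra K A]
    [Nontrivial A] [Module.Finite K A] [IsSemisimpleRing A] :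
    ∃ e : A, IsMatrixBlock K e := by
  classical
  obtain ⟨n, d, hd, ⟨φ⟩⟩ := IsSemisimpleRing.exists_algEquiv_pi_matrix_of_isAlgClosed K A
  have hn : Nonempty (Fin n) := by
    by_contra h
    rw [not_nonempty_iff] at h
    have := φ.toEquiv.subsingleton
    exact not_subsingleton A this
  obtain ⟨i₀⟩ := hn
  have hφ (P : ∀ i, Matrix (Fin (d i)) (Fin (d i)) K) : φ (φ.symm P) = P := φ.apply_symm_apply P
  let E : ∀ i, Matrix (Fin (d i)) (Fin (d i)) K := Pi.single i₀ 1
  have hE (a) : E * a = Pi.single i₀ (a i₀) := by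
    ext1 i
    rcases eq_or_ne i i₀ with rfl | h
    · simp [E]
    · simp [E, h]
  have hE' (a) : a * E = Pi.single i₀ (a i₀) := by
    ext1 i
    rcases eq_or_ne i i₀ with rfl | h
    · simp [E]
    · simp [E, h]
  have hE0 : E ≠ 0 := by
    intro h
    have := congrFun h i₀
    simp [E] at this
  refine ⟨φ.symm E, ?_, ?_, ?_, ?_, ?_, d i₀, ?_⟩
  · simpa using hE0
  · apply φ.injective
    simp [hφ, hE, E]
  · intro a
    apply φ.injective
    simp [hφ, hE, hE']
  · intro z hz
    have hc : φ z i₀ ∈ Set.range (Matrix.scalar (Fin (d i₀))) := by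
      rw [Matrix.mem_range_scalar_iff_commute_single]
      intro i j hij
      have := congrFun (congrArg φ (hz (φ.symm (Pi.single i₀ (Matrix.single i j 1))))) i₀
      simpa [Commute, SemiconjBy] using this.symm
    obtain ⟨c, hc⟩ := hc
    refine ⟨c, φ.injective ?_⟩
    rw [map_mul, map_smul, hφ, hE, ← hc]
    ext1 i
    rcases eq_or_ne i i₀ with rfl | h
    · simp [E, Matrix.smul_one_eq_diagonal]
    · simp [E, h]
  · intro u hu hu'
    have hu1 : φ u = Pi.single i₀ (φ u i₀) := by
      rw [← hE, ← hφ E, ← map_mul, hu']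
    have hu2 : φ u i₀ ≠ 0 := by
      intro h
      rw [h, Pi.single_zero] at hu1
      exact hu (by simpa using hu1)
    obtain ⟨p, q, hpq⟩ : ∃ p q, φ u i₀ p q ≠ 0 := by
      by_contra! h
      exact hu2 (Matrix.ext h)
    refine ⟨d i₀, fun k => φ.symm (Pi.single i₀ (Matrix.single k p ((φ u i₀ p q)⁻¹))),
      fun k => φ.symm (Pi.single i₀ (Matrix.single q k 1)), φ.injective ?_⟩
    simp only [map_sum, map_mul, hφ]
    ext1 i
    rcases eq_or_ne i i₀ with rfl | h
    · simp only [E, Pi.single_eq_same, Finset.sum_apply, Pi.mul_apply,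
        Matrix.single_mul_mul_single, inv_mul_cancel₀ hpq, mul_one]
      exact Matrix.sum_single_one.symm
    · simp [E, h]
  · set S : Submodule K A := LinearMap.range (LinearMap.mulLeft K (φ.symm E))
    let f : Matrix (Fin (d i₀)) (Fin (d i₀)) K →ₗ[K] A :=
      φ.symm.toLinearMap ∘ₗ LinearMap.single K (fun i => Matrix (Fin (d i)) (Fin (d i)) K) i₀
    have hf : Function.Injective f := fun x y h =>
      Pi.single_injective i₀ (φ.symm.injective h)
    have hr : LinearMap.range f = S := by
      ext a
      constructor
      · rintro ⟨x, rfl⟩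
        refine ⟨φ.symm (Pi.single i₀ x), φ.injective ?_⟩
        simp [hφ, hE, f]
      · rintro ⟨x, rfl⟩
        refine ⟨φ x i₀, φ.injective ?_⟩
        simp [hφ, hE, f]
    rw [← hr, LinearMap.finrank_range_of_inj hf, Module.finrank_matrix]
    simp [sq]

namespace IsGaloisPair

variable {K A G G' : Type*} [Field K] [Ring A] [Algebra K A] [Group G] [Group G']
  {ρ : G →* (A ≃ₐ[K] A)} {ρ' : G' →* (A ≃ₐ[K] A)}

lemma isSemisimpleRing (P : IsGaloisPair ρ ρ') [Finite G] : IsSemisimpleRing A := by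
  have := Fintype.ofFinite G
  have := P.finite
  have := P.nontrivial
  have := IsArtinianRing.of_finite K A
  rw [IsArtinianRing.isSemisimpleRing_iff_jacobson, eq_bot_iff]
  intro b hb
  by_contra hb0
  obtain ⟨a, ha⟩ := P.exists_one_eq_sum hb0
  have h1 : (1 : A) ∈ Ring.jacobson A := by
    rw [ha]
    refine sum_mem fun h _ => Ideal.mul_mem_right _ _ ?_
    have : RingHomSurjective (ρ h : A →+* A) := ⟨(ρ h).surjective⟩
    exact Ring.le_comap_jacobson (ρ h : A →+* A) hb
  exact (Ring.jacobson_lt_top A).ne ((Ideal.eq_top_iff_one _).mpr h1)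

/-- The joint action of `G × G'`. -/
def act (P : IsGaloisPair ρ ρ') : G × G' →* (A ≃ₐ[K] A) :=
  MonoidHom.noncommCoprod ρ ρ' fun g g' => by
    ext a
    exact P.comm g g' a

lemma act_apply (P : IsGaloisPair ρ ρ') (γ : G × G') (a : A) :
    P.act γ a = ρ γ.1 (ρ' γ.2 a) := rfl

/-- The stabilizer of `e` in `G × G'`. -/
def stab (P : IsGaloisPair ρ ρ') (e : A) : Subgroup (G × G') where
  carrier := {γ | P.act γ e = e}
  one_mem' := by simp
  mul_mem' {γ δ} hγ hδ := by
    simp only [Set.mem_ofPred_eq] at *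
    simp [hγ, hδ]
  inv_mem' {γ} hγ := by
    simp only [Set.mem_ofPred_eq] at *
    rw [map_inv, AlgEquiv.aut_inv, AlgEquiv.symm_apply_eq, hγ]

lemma mem_stab {P : IsGaloisPair ρ ρ'} {e : A} {γ : G × G'} :
    γ ∈ P.stab e ↔ P.act γ e = e := Iff.rfl

end IsGaloisPair

namespace IsMatrixBlock

variable {K A G G' : Type*} [Field K] [Ring A] [Algebra K A] {e : A}

lemma exists_smul_eq_mul (B : IsMatrixBlock K e) (σ : A ≃ₐ[K] A) {z : A}
    (hz : ∀ a, z * a = a * z) : ∃ c : K, σ e * z = c • σ e := by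
  obtain ⟨c, hc⟩ := B.center (σ.symm z) fun a => σ.injective (by simp [hz])
  exact ⟨c, by simpa using congrArg σ hc⟩

lemma comm_map (B : IsMatrixBlock K e) (σ : A ≃ₐ[K] A) (a : A) : σ e * a = a * σ e :=
  σ.symm.injective (by simp [B.comm])

lemma map_mul_self (B : IsMatrixBlock K e) (σ : A ≃ₐ[K] A) : σ e * σ e = σ e := by
  rw [← map_mul, B.mul_self]

lemma map_eq_map_of_mul_ne_zero (B : IsMatrixBlock K e) (σ τ : A ≃ₐ[K] A)
    (h : σ e * τ e ≠ 0) : σ e = τ e := by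
  have key (σ τ : A ≃ₐ[K] A) (h : σ e * τ e ≠ 0) : σ e * τ e = σ e := by
    obtain ⟨c, hc⟩ := B.exists_smul_eq_mul σ (B.comm_map τ)
    have h1 : c • (σ e * τ e) = (1 : K) • (σ e * τ e) := by
      rw [← smul_mul_assoc, ← hc, mul_assoc, B.map_mul_self, one_smul]
    have h2 : c = 1 := smul_left_injective K h h1
    rw [hc, h2, one_smul]
  rw [← key σ τ h, B.comm_map σ, key τ σ (by rwa [← B.comm_map σ])]

end IsMatrixBlock

namespace IsGaloisPair

variable {K A G G' : Type*} [Field K] [Ring A] [Algebra K A] [Group G] [Group G']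
  {ρ : G →* (A ≃ₐ[K] A)} {ρ' : G' →* (A ≃ₐ[K] A)} {e : A}

/-- The sum over the `G'`-orbit of an element of the block is a scalar. -/
lemma exists_orbit_sum (P : IsGaloisPair ρ ρ') (B : IsMatrixBlock K e) [Finite G'] {a : A}
    (ha : e * a = a) (hfix : ∀ g', ρ' g' e = e → ρ' g' a = a) :
    ∃ (S : Finset A) (c : K), (∀ f ∈ S, ∃ g', f = ρ' g' a) ∧
      ∑ f ∈ S, f = algebraMap K A c ∧ e * ∑ f ∈ S, f = a := by
  classical
  have := Fintype.ofFinite G'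
  rcases eq_or_ne a 0 with rfl | ha0
  · exact ⟨∅, 0, by simp⟩
  let S : Finset A := Finset.univ.image fun g' => ρ' g' a
  have hS (g') : ρ' g' (∑ f ∈ S, f) = ∑ f ∈ S, f := by
    rw [map_sum]
    refine Finset.sum_bij (fun f _ => ρ' g' f) ?_ (fun _ _ _ _ h => (ρ' g').injective h) ?_
      (fun _ _ => rfl)
    · simp only [S, Finset.mem_image, Finset.mem_univ, true_and]
      rintro _ ⟨h, rfl⟩
      exact ⟨g' * h, by simp⟩
    · simp only [S, Finset.mem_image, Finset.mem_univ, true_and]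
      rintro _ ⟨h, rfl⟩
      exact ⟨_, ⟨g'⁻¹ * h, rfl⟩, by simp⟩
  obtain ⟨c, hc⟩ := P.fixed _ hS
  refine ⟨S, c, fun f hf => ?_, hc, ?_⟩
  · obtain ⟨g', -, h⟩ := Finset.mem_image.mp hf
    exact ⟨g', h.symm⟩
  · have key : ∀ f ∈ S, e * f = if f = a then a else 0 := by
      simp only [S, Finset.mem_image, Finset.mem_univ, true_and]
      rintro _ ⟨h, rfl⟩
      have h1 : ρ' h e * ρ' h a = ρ' h a := by rw [← map_mul, ha]
      by_cases hh : ρ' h e = e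
      · rw [hfix h hh, if_pos rfl, ha]
      · have h0 : e * ρ' h e = 0 := by
          by_contra h0
          exact hh (B.map_eq_map_of_mul_ne_zero AlgEquiv.refl (ρ' h) h0).symm
        have h2 : e * ρ' h a = 0 := by rw [← h1, ← mul_assoc, h0, zero_mul]
        rw [h2, if_neg]
        intro h3
        rw [h3, ha] at h2
        exact ha0 h2
    rw [Finset.mul_sum, Finset.sum_congr rfl key, Finset.sum_ite_eq' S a, if_pos]
    exact Finset.mem_image.mpr ⟨1, by simp⟩

/-- An element of the block that is fixed by the stabilizer of `e` in `G'` is a scalar. -/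
lemma exists_eq_smul_of_fixed (P : IsGaloisPair ρ ρ') (B : IsMatrixBlock K e) [Finite G'] {a : A}
    (ha : e * a = a) (hfix : ∀ g', ρ' g' e = e → ρ' g' a = a) : ∃ c : K, a = c • e := by
  obtain ⟨S, c, -, hc, hS⟩ := P.exists_orbit_sum B ha hfix
  refine ⟨c, ?_⟩
  rw [← hS, hc, Algebra.algebraMap_eq_smul_one, mul_smul_comm, mul_one]

/-- The orbits of `e` under the two groups agree. -/
lemma exists_map_eq_right (P : IsGaloisPair ρ ρ') (B : IsMatrixBlock K e) [Finite G'] (g : G) :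
    ∃ g', ρ g e = ρ' g' e := by
  by_contra! hg
  obtain ⟨S, c, hS, hc, he⟩ := P.exists_orbit_sum B B.mul_self fun _ h => h
  apply B.ne_zero
  apply (ρ g).injective
  rw [map_zero, ← he, map_mul, hc, AlgEquiv.commutes, ← hc, Finset.mul_sum]
  refine Finset.sum_eq_zero fun f hf => ?_
  obtain ⟨g', rfl⟩ := hS f hf
  by_contra h0
  exact hg g' (B.map_eq_map_of_mul_ne_zero (ρ g) (ρ' g') h0)

lemma exists_map_eq_left (P : IsGaloisPair ρ ρ') (B : IsMatrixBlock K e) [Finite G] (g' : G') :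
    ∃ g, ρ g e = ρ' g' e := by
  have := Fintype.ofFinite G
  by_contra! hg
  obtain ⟨a, ha⟩ := P.exists_one_eq_sum B.ne_zero
  have h0 (g) : ρ' g' e * ρ g e = 0 := by
    by_contra h0
    exact hg g (B.map_eq_map_of_mul_ne_zero (ρ' g') (ρ g) h0).symm
  apply B.ne_zero
  apply (ρ' g').injective
  rw [map_zero, ← mul_one (ρ' g' e), ha, Finset.mul_sum]
  simp [← mul_assoc, h0]

end IsGaloisPair

/-- The elements `u` of the block of `e` such that `u * b = ρ h b * u` for all `b`. -/
def homogeneousPart {K A G : Type*} [Field K] [Ring A] [Algebra K A] [Group G]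
    (ρ : G →* (A ≃ₐ[K] A)) (e : A) (h : G) : Submodule K A where
  carrier := {u | e * u = u ∧ ∀ b, u * b = ρ h b * u}
  add_mem' {u v} hu hv := ⟨by rw [mul_add, hu.1, hv.1], fun b => by
    rw [add_mul, mul_add, hu.2, hv.2]⟩
  zero_mem' := by simp
  smul_mem' c u hu := ⟨by rw [mul_smul_comm, hu.1], fun b => by
    rw [smul_mul_assoc, mul_smul_comm, hu.2]⟩

section

variable {K A G : Type*} [Field K] [Ring A] [Algebra K A] [Group G]
  {ρ : G →* (A ≃ₐ[K] A)} {e : A} {g h : G} {u v : A}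

lemma mul_mem_homogeneousPart (hu : u ∈ homogeneousPart ρ e g) (hv : v ∈ homogeneousPart ρ e h) :
    u * v ∈ homogeneousPart ρ e (g * h) :=
  ⟨by rw [← mul_assoc, hu.1], fun b => by
    rw [mul_assoc, hv.2, ← mul_assoc, hu.2, map_mul, AlgEquiv.mul_apply, mul_assoc]⟩

namespace IsMatrixBlock

variable (B : IsMatrixBlock K e)
include B

lemma self_mem_homogeneousPart : e ∈ homogeneousPart ρ e 1 :=
  ⟨B.mul_self, fun b => by simp [B.comm]⟩

lemma exists_inverse (hu : u ∈ homogeneousPart ρ e h) (hu0 : u ≠ 0) :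
    ∃ w ∈ homogeneousPart ρ e h⁻¹, u * w = e ∧ w * u = e := by
  obtain ⟨m, a, b, hab⟩ := B.simple u hu0 hu.1
  have h1 : e = u * ∑ i, (ρ h).symm (a i) * b i := by
    rw [Finset.mul_sum]
    exact hab.trans (Finset.sum_congr rfl fun i _ => by
      rw [← mul_assoc, hu.2, AlgEquiv.apply_symm_apply])
  have h2 : e = (∑ i, a i * ρ h (b i)) * u := by
    rw [Finset.sum_mul]
    exact hab.trans (Finset.sum_congr rfl fun i _ => by rw [mul_assoc, hu.2, mul_assoc])
  set w := ∑ i, (ρ h).symm (a i) * b i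
  set w' := ∑ i, a i * ρ h (b i)
  have h3 : e * w = w' * e := by
    calc e * w = w' * (u * w) := by rw [← mul_assoc, ← h2]
      _ = w' * e := by rw [← h1]
  have h4 : u * (e * w) = e := by rw [← mul_assoc, ← B.comm, hu.1, ← h1]
  have h5 : e * w * u = e := by rw [h3, mul_assoc, hu.1, ← h2]
  refine ⟨e * w, ⟨by rw [← mul_assoc, B.mul_self], fun b => ?_⟩, h4, h5⟩
  calc e * w * b = e * w * (b * e) := by rw [← B.comm b, ← mul_assoc, mul_assoc _ w e, ← B.comm w,
        ← mul_assoc, B.mul_self]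
    _ = e * w * (u * (ρ h⁻¹ b)) * (e * w) := by
        rw [hu.2, ← AlgEquiv.mul_apply, ← map_mul, mul_inv_cancel, map_one, AlgEquiv.one_apply,
          mul_assoc (e * w), mul_assoc b, h4]
    _ = ρ h⁻¹ b * (e * w) := by
        rw [← mul_assoc _ u, h5, B.comm, mul_assoc, ← mul_assoc e e w, B.mul_self]

lemma mul_ne_zero (hu : u ∈ homogeneousPart ρ e g) (hu0 : u ≠ 0)
    (hv : v ∈ homogeneousPart ρ e h) (hv0 : v ≠ 0) : u * v ≠ 0 := by
  intro huv
  obtain ⟨w, -, -, hw⟩ := B.exists_inverse hu hu0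
  apply hv0
  rw [← hv.1, ← hw, mul_assoc, huv, mul_zero]

lemma exists_eq_smul (hu : u ∈ homogeneousPart ρ e h) (hu0 : u ≠ 0)
    (hv : v ∈ homogeneousPart ρ e h) : ∃ c : K, v = c • u := by
  obtain ⟨w, hw, -, hwu⟩ := B.exists_inverse hu hu0
  have hvw := mul_mem_homogeneousPart hv hw
  obtain ⟨c, hc⟩ := B.center (v * w) fun b => by
    rw [hvw.2, mul_inv_cancel, map_one, AlgEquiv.one_apply]
  refine ⟨c, ?_⟩
  rw [hvw.1] at hc
  rw [← hu.1, ← smul_mul_assoc, ← hc, mul_assoc, hwu, ← B.comm, hv.1]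

end IsMatrixBlock

end

/-- The stabilizer of `e`. -/
def fixer {K A G : Type*} [Field K] [Ring A] [Algebra K A] [Group G]
    (ρ : G →* (A ≃ₐ[K] A)) (e : A) : Subgroup G where
  carrier := {g | ρ g e = e}
  one_mem' := by simp
  mul_mem' {g h} hg hh := by
    simp only [Set.mem_ofPred_eq] at *
    simp [hg, hh]
  inv_mem' {g} hg := by
    simp only [Set.mem_ofPred_eq] at *
    rw [map_inv, AlgEquiv.aut_inv, AlgEquiv.symm_apply_eq, hg]

section

variable {K A G G' : Type*} [Field K] [Ring A] [Algebra K A] [Group G] [Group G']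
  {ρ : G →* (A ≃ₐ[K] A)} {ρ' : G' →* (A ≃ₐ[K] A)} {e : A}

lemma mem_fixer {g : G} : g ∈ fixer ρ e ↔ ρ g e = e := Iff.rfl

lemma IsMatrixBlock.mem_fixer_of_ne_zero (B : IsMatrixBlock K e) {h : G} {u : A}
    (hu : u ∈ homogeneousPart ρ e h) (hu0 : u ≠ 0) : h ∈ fixer ρ e := by
  refine B.map_eq_map_of_mul_ne_zero (ρ h) AlgEquiv.refl fun h0 => hu0 ?_
  rw [AlgEquiv.coe_refl, id] at h0
  rw [← hu.1, B.comm, hu.2, ← hu.1, ← mul_assoc, h0, zero_mul]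

/-- The block of `e` has a basis of homogeneous elements indexed by the stabilizer of `e`. -/
structure IsHomogeneousBasis (ρ : G →* (A ≃ₐ[K] A)) (e : A) (u : fixer ρ e → A) : Prop where
  mem : ∀ h : fixer ρ e, u h ∈ homogeneousPart ρ e (h : G)
  linearIndependent : LinearIndependent K u
  mem_span : ∀ a, e * a = a → a ∈ Submodule.span K (Set.range u)

namespace IsGaloisPair

lemma card_le (P : IsGaloisPair ρ ρ') (B : IsMatrixBlock K e) [Finite G] :
    Nat.card (fixer ρ e) ≤ Module.finrank K (LinearMap.range (LinearMap.mulLeft K e)) := by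
  classical
  have := Fintype.ofFinite G
  have := P.finite
  have := Fintype.ofFinite (G ⧸ fixer ρ e)
  let W := LinearMap.range (LinearMap.mulLeft K e)
  let F : (G ⧸ fixer ρ e → W) →ₗ[K] A :=
    LinearMap.lsum K (fun _ => W) K fun q => (ρ q.out).toLinearMap ∘ₗ W.subtype
  have hF (a) : F a = ∑ q, ρ q.out (a q) := by simp [F]
  have hsurj : Function.Surjective F := by
    intro z
    obtain ⟨a, ha⟩ := P.exists_one_eq_sum B.ne_zero
    have h1 : z = ∑ h, ρ h e * (a h * z) := by
      calc z = (∑ h, ρ h e * a h) * z := by rw [← ha, one_mul]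
        _ = _ := by simp [Finset.sum_mul, mul_assoc]
    have h2 (h : G) : ∃ w, F w = ρ h e * (a h * z) := by
      refine ⟨Pi.single (h : G ⧸ fixer ρ e) ⟨e * ρ (h : G ⧸ fixer ρ e).out⁻¹ (a h * z), by
        exact ⟨_, rfl⟩⟩, ?_⟩
      rw [hF, Finset.sum_eq_single (h : G ⧸ fixer ρ e)]
      · have h3 : ρ (h : G ⧸ fixer ρ e).out e = ρ h e := by
          obtain ⟨k, hk⟩ := QuotientGroup.mk_out_eq_mul (fixer ρ e) h
          rw [hk, map_mul, AlgEquiv.mul_apply, mem_fixer.mp k.2]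
        rw [Pi.single_eq_same, map_mul, h3, ← AlgEquiv.mul_apply, ← map_mul, mul_inv_cancel,
          map_one, AlgEquiv.one_apply]
      · intro q _ hq
        rw [Pi.single_eq_of_ne hq, ZeroMemClass.coe_zero, map_zero]
      · simp
    choose w hw using h2
    exact ⟨∑ h, w h, by
      rw [map_sum]
      exact (Finset.sum_congr rfl fun h _ => hw h).trans h1.symm⟩
  have h1 := LinearMap.finrank_le_finrank_of_surjective hsurj
  rw [P.finrank_eq, Module.finrank_pi_fintype, Finset.sum_const, smul_eq_mul, Finset.card_univ,
    ← Nat.card_eq_fintype_card, Subgroup.card_eq_card_quotient_mul_card_subgroup (fixer ρ e)] at h1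
  exact Nat.le_of_mul_le_mul_left h1 Nat.card_pos

lemma exists_isHomogeneousBasis (P : IsGaloisPair ρ ρ') (B : IsMatrixBlock K e) [Finite G] :
    (∃ u, IsHomogeneousBasis ρ e u) ∧ ∃ d, Nat.card (fixer ρ e) = d ^ 2 := by
  classical
  have := Fintype.ofFinite G
  have := P.finite
  let W := LinearMap.range (LinearMap.mulLeft K e)
  have h1 (h : fixer ρ e) : ∃ u ∈ homogeneousPart ρ e (h : G),
      ∀ v ∈ homogeneousPart ρ e (h : G), ∃ c : K, v = c • u := by
    by_cases hh : ∃ u ∈ homogeneousPart ρ e (h : G), u ≠ 0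
    · obtain ⟨u, hu, hu0⟩ := hh
      exact ⟨u, hu, fun v hv => B.exists_eq_smul hu hu0 hv⟩
    · push Not at hh
      exact ⟨0, zero_mem _, fun v hv => ⟨0, by simp [hh v hv]⟩⟩
  choose u hu hspan using h1
  have h2 (a) (ha : e * a = a) : a ∈ Submodule.span K (Set.range u) := by
    obtain ⟨p, hp1, hp2⟩ := P.exists_decomposition
    rw [← ha, hp2 a, Finset.mul_sum]
    refine sum_mem fun h _ => ?_
    have h3 : e * p h a ∈ homogeneousPart ρ e h :=
      ⟨by rw [← mul_assoc, B.mul_self], fun b => by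
        rw [mul_assoc, hp1, ← mul_assoc, B.comm, mul_assoc]⟩
    by_cases h0 : e * p h a = 0
    · rw [h0]
      exact zero_mem _
    · obtain ⟨c, hc⟩ := hspan ⟨h, B.mem_fixer_of_ne_zero h3 h0⟩ _ h3
      rw [hc]
      exact Submodule.smul_mem _ _ (Submodule.subset_span ⟨_, rfl⟩)
  have h3 : Submodule.span K (Set.range u) = W := by
    apply le_antisymm
    · rw [Submodule.span_le]
      rintro _ ⟨h, rfl⟩
      exact ⟨u h, (hu h).1⟩
    · rintro _ ⟨a, rfl⟩
      exact h2 _ (by simp [← mul_assoc, B.mul_self])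
  have h4 := P.card_le B
  have h5 : Module.finrank K W ≤ Nat.card (fixer ρ e) := by
    rw [← h3, Nat.card_eq_fintype_card]
    exact finrank_range_le_card u
  refine ⟨⟨u, hu, ?_, h2⟩, ?_⟩
  · rw [linearIndependent_iff_card_le_finrank_span, Set.finrank, h3, ← Nat.card_eq_fintype_card]
    exact h4
  · obtain ⟨d, hd⟩ := B.finrank_eq
    exact ⟨d, by rw [← hd]; exact le_antisymm h4 h5⟩

end IsGaloisPair

end

section

variable {K A G G' : Type*} [Field K] [Ring A] [Algebra K A] [Group G] [Group G']
  {ρ : G →* (A ≃ₐ[K] A)} {ρ' : G' →* (A ≃ₐ[K] A)} {e : A} {u : fixer ρ e → A}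

namespace IsHomogeneousBasis

lemma ne_zero (U : IsHomogeneousBasis ρ e u) (h : fixer ρ e) : u h ≠ 0 :=
  U.linearIndependent.ne_zero h

lemma exists_eq_smul (U : IsHomogeneousBasis ρ e u) (B : IsMatrixBlock K e) {h : fixer ρ e} {v : A}
    (hv : v ∈ homogeneousPart ρ e (h : G)) : ∃ c : K, v = c • u h :=
  B.exists_eq_smul (U.mem h) (U.ne_zero h) hv

lemma exists_mul_eq (U : IsHomogeneousBasis ρ e u) (B : IsMatrixBlock K e) (h k : fixer ρ e) :
    ∃ c : K, c ≠ 0 ∧ u h * u k = c • u (h * k) := by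
  obtain ⟨c, hc⟩ := U.exists_eq_smul B (h := h * k) (mul_mem_homogeneousPart (U.mem h) (U.mem k))
  refine ⟨c, ?_, hc⟩
  rintro rfl
  exact B.mul_ne_zero (U.mem h) (U.ne_zero h) (U.mem k) (U.ne_zero k) (by simpa using hc)

lemma exists_one_eq (U : IsHomogeneousBasis ρ e u) (B : IsMatrixBlock K e) :
    ∃ c : K, c ≠ 0 ∧ e = c • u 1 := by
  obtain ⟨c, hc⟩ := U.exists_eq_smul B (h := 1) (v := e) B.self_mem_homogeneousPart
  refine ⟨c, ?_, hc⟩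
  rintro rfl
  exact B.ne_zero (by simpa using hc)

lemma eq_one_of_eq_smul (U : IsHomogeneousBasis ρ e u) (B : IsMatrixBlock K e) {h : fixer ρ e}
    {c : K} (hc : u h = c • e) : h = 1 := by
  obtain ⟨d, -, hd⟩ := U.exists_one_eq B
  by_contra h1
  rw [hd, smul_smul] at hc
  exact U.linearIndependent.notMem_span_image (s := {1}) (x := h) (by simpa using h1)
    (by rw [Set.image_singleton, hc]; exact
      Submodule.smul_mem _ _ (Submodule.mem_span_singleton_self _))

lemma eqOn_block (U : IsHomogeneousBasis ρ e u) {σ τ : A ≃ₐ[K] A} (h : ∀ k, σ (u k) = τ (u k))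
    {a : A} (ha : e * a = a) : σ a = τ a := by
  have h1 := LinearMap.eqOn_span (f := σ.toLinearMap) (g := τ.toLinearMap) (s := Set.range u)
    (by rintro _ ⟨k, rfl⟩; exact h k)
  exact h1 (U.mem_span a ha)

/-- An automorphism preserving the homogeneous parts acts on them by a character. -/
lemma exists_character (U : IsHomogeneousBasis ρ e u) (B : IsMatrixBlock K e) (σ : A ≃ₐ[K] A)
    (he : σ e = e) (hσ : ∀ k : fixer ρ e, σ (u k) ∈ homogeneousPart ρ e (k : G)) :
    ∃ ψ : fixer ρ e →* K, ∀ k, σ (u k) = ψ k • u k := by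
  choose c hc using fun k => U.exists_eq_smul B (hσ k)
  refine ⟨⟨⟨c, ?_⟩, fun h k => ?_⟩, hc⟩
  · obtain ⟨d, hd0, hd⟩ := U.exists_one_eq B
    rw [hd, map_smul, hc, smul_smul] at he
    have := smul_left_injective K (U.ne_zero 1) he
    exact mul_left_cancel₀ hd0 (by simpa using this)
  · obtain ⟨d, hd0, hd⟩ := U.exists_mul_eq B h k
    have h1 := congrArg σ hd
    rw [map_mul, map_smul, hc, hc, hc, smul_mul_smul_comm, hd, smul_smul, smul_smul] at h1
    have := smul_left_injective K (U.ne_zero _) h1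
    exact mul_left_cancel₀ hd0 (by simp only at this ⊢; rw [← this]; ring)

end IsHomogeneousBasis

lemma finite_monoidHom (H : Type*) [Group H] [Finite H] (K : Type*) [Field K] :
    Finite (H →* K) :=
  (linearIndependent_monoidHom H K).finite

lemma card_monoidHom_le (H : Type*) [Group H] [Finite H] (K : Type*) [Field K] :
    Nat.card (H →* K) ≤ Nat.card H := by
  have := finite_monoidHom H K
  have := Fintype.ofFinite H
  have := Fintype.ofFinite (H →* K)
  have h := (linearIndependent_monoidHom H K).fintype_card_le_finrank
  simpa [Nat.card_eq_fintype_card] using h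

namespace IsGaloisPair

lemma map_mem_homogeneousPart (P : IsGaloisPair ρ ρ') {γ : G × G'} (hγ : γ ∈ P.stab e) {h : G}
    {v : A} (hv : v ∈ homogeneousPart ρ e h) :
    P.act γ v ∈ homogeneousPart ρ e (γ.1 * h * γ.1⁻¹) := by
  refine ⟨?_, fun b => ?_⟩
  · conv_lhs => rw [← mem_stab.mp hγ, ← map_mul, hv.1]
  · have h1 := congrArg (P.act γ) (hv.2 ((P.act γ).symm b))
    rw [map_mul, map_mul, AlgEquiv.apply_symm_apply] at h1
    rw [h1]
    congr 1
    have h2 : P.act γ * ρ h = ρ (γ.1 * h * γ.1⁻¹) * P.act γ := by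
      ext a
      simp only [AlgEquiv.mul_apply, act_apply, map_mul, P.comm]
      rw [← AlgEquiv.mul_apply (ρ γ.1⁻¹), ← map_mul, inv_mul_cancel, map_one, AlgEquiv.one_apply]
    have h3 := DFunLike.congr_fun h2 ((P.act γ).symm b)
    simpa using h3

lemma eq_one_of_forall_right (P : IsGaloisPair ρ ρ') (B : IsMatrixBlock K e) [Finite G] {g' : G'}
    (h : ∀ a, e * a = a → ρ' g' a = a) : g' = 1 := by
  have := Fintype.ofFinite G
  refine P.faithful g' fun z => ?_
  obtain ⟨a, ha⟩ := P.exists_one_eq_sum B.ne_zero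
  have h1 : z = ∑ k, ρ k (e * ρ k⁻¹ (a k * z)) := by
    calc z = (∑ h, ρ h e * a h) * z := by rw [← ha, one_mul]
      _ = _ := by
        rw [Finset.sum_mul]
        refine Finset.sum_congr rfl fun k _ => ?_
        rw [map_mul (ρ k), ← AlgEquiv.mul_apply, ← map_mul, mul_inv_cancel, map_one,
          AlgEquiv.one_apply, mul_assoc]
  rw [h1, map_sum]
  refine Finset.sum_congr rfl fun k _ => ?_
  rw [← P.comm, h _ (by rw [← mul_assoc, B.mul_self])]

lemma eq_one_of_forall_left (P : IsGaloisPair ρ ρ') (B : IsMatrixBlock K e) {g : G}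
    (h : ∀ a, e * a = a → ρ g a = a) : g = 1 := by
  by_contra hg
  obtain ⟨n, x, y, h1, h2⟩ := P.exists_dual
  have he := h e B.mul_self
  apply B.ne_zero
  calc e = (∑ i, x i * y i) * e := by rw [h1, one_mul]
    _ = (∑ i, x i * ρ g (y i)) * e := by
      rw [Finset.sum_mul, Finset.sum_mul]
      refine Finset.sum_congr rfl fun i _ => ?_
      rw [mul_assoc, mul_assoc, ← B.comm (y i), ← h (e * y i) (by rw [← mul_assoc, B.mul_self]),
        map_mul, he, B.comm]
    _ = 0 := by rw [h2 g hg, zero_mul]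

lemma exists_eq_of_forall (P : IsGaloisPair ρ ρ') (B : IsMatrixBlock K e)
    (U : IsHomogeneousBasis ρ e u) [Finite G'] {h : fixer ρ e}
    (hfix : ∀ g' ∈ fixer ρ' e, ρ' g' (u h) = u h) : h = 1 := by
  obtain ⟨c, hc⟩ := P.exists_eq_smul_of_fixed B (U.mem h).1 hfix
  exact U.eq_one_of_eq_smul B hc

/-- The commutator pairing on the stabilizer of a block. -/
structure IsPairing (ρ : G →* (A ≃ₐ[K] A)) (ρ' : G' →* (A ≃ₐ[K] A)) (e : A) (u : fixer ρ e → A)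
    (R : fixer ρ e → fixer ρ e →* K) : Prop where
  comm : ∀ h k : fixer ρ e, h * k = k * h
  injective : Function.Injective R
  surjective : Function.Surjective R
  map_apply : ∀ h k : fixer ρ e, ρ (h : G) (u k) = R h k • u k
  self : ∀ h, R h h = 1
  exists_right : ∀ h : fixer ρ e, ∃ h' : fixer ρ' e, ∀ a, e * a = a → ρ h a = ρ' h' a
  exists_left : ∀ h' : fixer ρ' e, ∃ h : fixer ρ e, ∀ a, e * a = a → ρ h a = ρ' h' a

lemma exists_isPairing (P : IsGaloisPair ρ ρ') (B : IsMatrixBlock K e)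
    (U : IsHomogeneousBasis ρ e u) [Finite G] [Finite G'] :
    ∃ R, IsPairing ρ ρ' e u R := by
  have hright (h' : fixer ρ' e) : ∃ ψ : fixer ρ e →* K, ∀ k, ρ' h' (u k) = ψ k • u k := by
    refine U.exists_character B (ρ' h') h'.2 fun k => ?_
    have := P.map_mem_homogeneousPart (e := e) (γ := (1, (h' : G')))
      (by rw [mem_stab, act_apply]; simpa using mem_fixer.mp h'.2) (U.mem k)
    simpa [act_apply] using this
  choose χ hχ using hright
  have hχinj : Function.Injective χ := by
    intro h' k' hhk
    have : ((k' : G')⁻¹ * h' : G') = 1 := by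
      refine P.eq_one_of_forall_right B fun a ha => ?_
      rw [map_mul, AlgEquiv.mul_apply,
        U.eqOn_block (σ := ρ' h') (τ := ρ' k') (fun k => by rw [hχ, hχ, hhk]) ha,
        ← AlgEquiv.mul_apply, ← map_mul, inv_mul_cancel, map_one, AlgEquiv.one_apply]
    exact Subtype.ext (inv_mul_eq_one.mp this).symm
  have hχmul (h' k' k) : χ (h' * k') k = χ h' k * χ k' k := by
    have h1 := hχ (h' * k') k
    rw [Subgroup.coe_mul, map_mul, AlgEquiv.mul_apply, hχ, map_smul, hχ, smul_smul] at h1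
    rw [← smul_left_injective K (U.ne_zero k) h1, mul_comm]
  have hχone (k) : χ 1 k = 1 := by
    have h1 := hχ 1 k
    rw [OneMemClass.coe_one, map_one, AlgEquiv.one_apply] at h1
    exact (smul_left_injective K (U.ne_zero k) (by simpa using h1)).symm
  let X (k : fixer ρ e) : fixer ρ' e →* K :=
    ⟨⟨fun h' => χ h' k, hχone k⟩, fun h' k' => hχmul h' k' k⟩
  have hXinj : Function.Injective X := by
    intro h k hhk
    have h1 (h') : χ h' h = χ h' k := DFunLike.congr_fun hhk h'
    rw [← mul_inv_eq_one]
    refine P.exists_eq_of_forall B U fun g' hg' => ?_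
    rw [hχ ⟨g', hg'⟩, map_mul, h1, ← map_mul, mul_inv_cancel, map_one, one_smul]
  have hcomm (h k : fixer ρ e) : h * k = k * h := by
    apply hXinj
    ext h'
    exact (map_mul (χ h') h k).trans ((mul_comm _ _).trans (map_mul (χ h') k h).symm)
  have hleft (h : fixer ρ e) : ∃ ψ : fixer ρ e →* K, ∀ k, ρ h (u k) = ψ k • u k := by
    refine U.exists_character B (ρ h) h.2 fun k => ?_
    have := P.map_mem_homogeneousPart (e := e) (γ := ((h : G), 1))
      (by rw [mem_stab, act_apply]; simpa using mem_fixer.mp h.2) (U.mem k)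
    have h1 : (h * k * (h : G)⁻¹ : G) = k := by
      rw [← Subgroup.coe_mul, hcomm, Subgroup.coe_mul, mul_inv_cancel_right]
    simpa [act_apply, h1] using this
  choose R hR using hleft
  have hRinj : Function.Injective R := by
    intro h k hhk
    have : ((k : G)⁻¹ * h : G) = 1 := by
      refine P.eq_one_of_forall_left B fun a ha => ?_
      rw [map_mul, AlgEquiv.mul_apply,
        U.eqOn_block (σ := ρ h) (τ := ρ k) (fun k => by rw [hR, hR, hhk]) ha,
        ← AlgEquiv.mul_apply, ← map_mul, inv_mul_cancel, map_one, AlgEquiv.one_apply]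
    exact Subtype.ext (inv_mul_eq_one.mp this).symm
  have := finite_monoidHom (fixer ρ e) K
  have := finite_monoidHom (fixer ρ' e) K
  have hRbij := (Nat.bijective_iff_injective_and_card R).mpr ⟨hRinj,
    le_antisymm (Nat.card_le_card_of_injective R hRinj) (card_monoidHom_le _ K)⟩
  have hcard : Nat.card (fixer ρ e) ≤ Nat.card (fixer ρ' e) :=
    (Nat.card_le_card_of_injective X hXinj).trans (card_monoidHom_le _ K)
  have hχbij := (Nat.bijective_iff_injective_and_card χ).mpr ⟨hχinj,
    le_antisymm (Nat.card_le_card_of_injective χ hχinj) ((card_monoidHom_le _ K).trans hcard)⟩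
  refine ⟨R, hcomm, hRinj, hRbij.2, hR, fun h => ?_, fun h => ?_, fun h' => ?_⟩
  · have h1 : u h * u h = R h h • (u h * u h) := by
      conv_lhs => rw [(U.mem h).2, hR, smul_mul_assoc]
    have h2 := B.mul_ne_zero (U.mem h) (U.ne_zero h) (U.mem h) (U.ne_zero h)
    exact (smul_left_injective K h2 (by simpa using h1)).symm
  · obtain ⟨h', hh⟩ := hχbij.2 (R h)
    exact ⟨h', fun a ha => U.eqOn_block (fun k => by rw [hR, hχ, hh]) ha⟩
  · obtain ⟨h, hh⟩ := hRbij.2 (χ h')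
    exact ⟨h, fun a ha => U.eqOn_block (fun k => by rw [hR, hχ, hh]) ha⟩

end IsGaloisPair

end

/-- A subgroup of a product which is the graph of an isomorphism. -/
lemma nonempty_mulEquiv_of_graph {G G' : Type*} [Group G] [Group G'] (C : Subgroup (G × G'))
    (hfst : ∀ g, ∃ g', (g, g') ∈ C) (hsnd : ∀ g', ∃ g, (g, g') ∈ C)
    (hl : ∀ g, (g, 1) ∈ C → g = 1) (hr : ∀ g', (1, g') ∈ C → g' = 1) : Nonempty (G ≃* G') := by
  have h1 : Function.Bijective ((MonoidHom.fst G G').comp C.subtype) := by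
    refine ⟨(injective_iff_map_eq_one _).mpr ?_, fun g => ?_⟩
    · rintro ⟨⟨g, g'⟩, hC⟩ (rfl : g = 1)
      exact Subtype.ext (Prod.ext rfl (hr g' hC))
    · obtain ⟨g', hg⟩ := hfst g
      exact ⟨⟨_, hg⟩, rfl⟩
  have h2 : Function.Bijective ((MonoidHom.snd G G').comp C.subtype) := by
    refine ⟨(injective_iff_map_eq_one _).mpr ?_, fun g' => ?_⟩
    · rintro ⟨⟨g, g'⟩, hC⟩ (rfl : g' = 1)
      exact Subtype.ext (Prod.ext (hl g hC) rfl)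
    · obtain ⟨g, hg⟩ := hsnd g'
      exact ⟨⟨_, hg⟩, rfl⟩
  exact ⟨(MulEquiv.ofBijective _ h1).symm.trans (MulEquiv.ofBijective _ h2)⟩

namespace IsGaloisPair

variable {K A G G' : Type*} [Field K] [Ring A] [Algebra K A] [Group G] [Group G']
  {ρ : G →* (A ≃ₐ[K] A)} {ρ' : G' →* (A ≃ₐ[K] A)} {e : A} {u : fixer ρ e → A}
  {R : fixer ρ e → fixer ρ e →* K}

lemma mk_one_mem_stab (P : IsGaloisPair ρ ρ') (h : fixer ρ e) : ((h : G), (1 : G')) ∈ P.stab e := by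
  rw [mem_stab, act_apply]
  simpa using mem_fixer.mp h.2

lemma one_mk_mem_stab (P : IsGaloisPair ρ ρ') (h' : fixer ρ' e) :
    ((1 : G), (h' : G')) ∈ P.stab e := by
  rw [mem_stab, act_apply]
  simpa using mem_fixer.mp h'.2

lemma act_mem_block {P : IsGaloisPair ρ ρ'} {γ : G × G'} (hγ : γ ∈ P.stab e) {a : A}
    (ha : e * a = a) : e * P.act γ a = P.act γ a := by
  conv_lhs => rw [← mem_stab.mp hγ, ← map_mul, ha]

/-- A complement of the stabilizers in the joint stabilizer gives an isomorphism. -/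
lemma nonempty_mulEquiv (P : IsGaloisPair ρ ρ') (B : IsMatrixBlock K e) (T : IsPairing ρ ρ' e u R)
    [Finite G] [Finite G'] (C : Subgroup (G × G')) (hC : C ≤ P.stab e)
    (hsat : ∀ γ ∈ C, ∀ δ ∈ P.stab e, (∀ a, e * a = a → P.act γ a = P.act δ a) → δ ∈ C)
    (hmul : ∀ γ ∈ P.stab e, ∃ h : fixer ρ e, γ * ((h : G), (1 : G')) ∈ C)
    (hone : ∀ h : fixer ρ e, ((h : G), (1 : G')) ∈ C → h = 1) : Nonempty (G ≃* G') := by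
  refine nonempty_mulEquiv_of_graph C (fun g => ?_) (fun g' => ?_) (fun g hg => ?_)
    (fun g' hg' => ?_)
  · obtain ⟨g', hg'⟩ := P.exists_map_eq_right B g⁻¹
    have hγ : (g, g') ∈ P.stab e := by
      rw [mem_stab, act_apply, ← hg', ← AlgEquiv.mul_apply, ← map_mul, mul_inv_cancel, map_one,
        AlgEquiv.one_apply]
    obtain ⟨h, hh⟩ := hmul _ hγ
    obtain ⟨h', hh'⟩ := T.exists_right h
    refine ⟨g' * h', hsat _ hh _ ?_ fun a ha => ?_⟩
    · simpa using mul_mem hγ (P.one_mk_mem_stab h')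
    · simp [act_apply, P.comm, hh' a ha]
  · obtain ⟨g, hg⟩ := P.exists_map_eq_left B g'⁻¹
    have hγ : (g, g') ∈ P.stab e := by
      rw [mem_stab, act_apply, P.comm, hg, ← AlgEquiv.mul_apply, ← map_mul, mul_inv_cancel,
        map_one, AlgEquiv.one_apply]
    obtain ⟨h, hh⟩ := hmul _ hγ
    exact ⟨g * h, by simpa using hh⟩
  · have hs := mem_stab.mp (hC hg)
    rw [act_apply, map_one, AlgEquiv.one_apply] at hs
    exact congrArg Subtype.val (hone ⟨g, hs⟩ hg)
  · have hs := mem_stab.mp (hC hg')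
    rw [act_apply, map_one, AlgEquiv.one_apply] at hs
    obtain ⟨h, hh⟩ := T.exists_left ⟨g', hs⟩
    have h1 : h = 1 := by
      refine hone h (hsat _ hg' _ (P.mk_one_mem_stab h) fun a ha => ?_)
      simp [act_apply, hh a ha]
    refine P.eq_one_of_forall_right B fun a ha => ?_
    rw [← hh a ha, h1]
    simp

/-- The elements of the joint stabilizer acting trivially on the block. -/
def kernel (P : IsGaloisPair ρ ρ') (e : A) : Subgroup (P.stab e) where
  carrier := {γ | ∀ a, e * a = a → P.act γ a = a}
  one_mem' := by simp
  mul_mem' {γ δ} hγ hδ a ha := by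
    rw [Subgroup.coe_mul, map_mul, AlgEquiv.mul_apply, hδ a ha, hγ a ha]
  inv_mem' {γ} hγ a ha := by
    rw [Subgroup.coe_inv, map_inv, AlgEquiv.aut_inv, AlgEquiv.symm_apply_eq, hγ a ha]

instance (P : IsGaloisPair ρ ρ') (e : A) : (P.kernel e).Normal where
  conj_mem γ hγ δ a ha := by
    have h1 := hγ _ (act_mem_block (δ⁻¹).2 ha)
    rw [Subgroup.coe_mul, Subgroup.coe_mul, map_mul, map_mul, AlgEquiv.mul_apply,
      AlgEquiv.mul_apply, h1, ← AlgEquiv.mul_apply, ← map_mul, ← Subgroup.coe_mul, mul_inv_cancel]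
    simp

/-- The map from the stabilizer of `e` in `G` to the automorphisms of the block. -/
def toQuotient (P : IsGaloisPair ρ ρ') (e : A) : fixer ρ e →* P.stab e ⧸ P.kernel e :=
  (QuotientGroup.mk' (P.kernel e)).comp
    (((MonoidHom.inl G G').comp (fixer ρ e).subtype).codRestrict (P.stab e) P.mk_one_mem_stab)

lemma toQuotient_apply (P : IsGaloisPair ρ ρ') (h : fixer ρ e) :
    P.toQuotient e h = QuotientGroup.mk' (P.kernel e) ⟨_, P.mk_one_mem_stab h⟩ := rfl

instance (P : IsGaloisPair ρ ρ') (e : A) : (P.toQuotient e).range.Normal where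
  conj_mem := by
    rintro _ ⟨h, rfl⟩ q
    obtain ⟨⟨γ, hγ⟩, rfl⟩ := QuotientGroup.mk'_surjective _ q
    have hh : γ.1 * h * γ.1⁻¹ ∈ fixer ρ e := by
      have h1 := mul_mem (mul_mem hγ (P.mk_one_mem_stab h)) (inv_mem hγ)
      have h2 := mem_stab.mp h1
      rw [act_apply] at h2
      simpa [mem_fixer] using h2
    refine ⟨⟨_, hh⟩, ?_⟩
    rw [toQuotient_apply, toQuotient_apply, ← map_mul, ← map_inv, ← map_mul]
    congr 1
    exact Subtype.ext (Prod.ext rfl (by simp))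

lemma nonempty_mulEquiv_of_isComplement' (P : IsGaloisPair ρ ρ') (B : IsMatrixBlock K e)
    (T : IsPairing ρ ρ' e u R) [Finite G] [Finite G'] (C : Subgroup (P.stab e ⧸ P.kernel e))
    (hC : (P.toQuotient e).range.IsComplement' C) : Nonempty (G ≃* G') := by
  have hmem {γ : G × G'} (hγ : γ ∈ P.stab e) :
      γ ∈ (C.comap (QuotientGroup.mk' (P.kernel e))).map (P.stab e).subtype ↔
        QuotientGroup.mk' (P.kernel e) ⟨γ, hγ⟩ ∈ C := by
    constructor
    · rintro ⟨δ, hδ, rfl⟩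
      exact hδ
    · exact fun h => ⟨⟨γ, hγ⟩, h, rfl⟩
  refine P.nonempty_mulEquiv B T ((C.comap (QuotientGroup.mk' (P.kernel e))).map (P.stab e).subtype)
    (Subgroup.map_subtype_le _) (fun γ hγ δ hδ hγδ => ?_) (fun γ hγ => ?_) (fun h hh => ?_)
  · have hγ' := Subgroup.map_subtype_le _ hγ
    rw [hmem hγ'] at hγ
    rw [hmem hδ]
    convert hγ using 1
    refine (QuotientGroup.eq.mpr ?_).symm
    intro a ha
    rw [Subgroup.coe_mul, Subgroup.coe_inv, map_mul, AlgEquiv.mul_apply, map_inv, AlgEquiv.aut_inv,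
      AlgEquiv.symm_apply_eq, hγδ a ha]
  · obtain ⟨⟨⟨c, hc⟩, ⟨_, h, rfl⟩⟩, hch⟩ := hC.symm.2 (QuotientGroup.mk' (P.kernel e) ⟨γ, hγ⟩)
    refine ⟨h⁻¹, ?_⟩
    rw [hmem (mul_mem hγ (P.mk_one_mem_stab h⁻¹))]
    have h1 := P.toQuotient_apply h⁻¹
    rw [map_inv] at h1
    have h2 : c = _ := eq_mul_inv_of_mul_eq hch
    rw [h1, ← map_mul] at h2
    rw [h2] at hc
    exact hc
  · rw [hmem (P.mk_one_mem_stab h), ← toQuotient_apply] at hh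
    have h1 : P.toQuotient e h = 1 := by
      have := hC.disjoint.le_bot (x := P.toQuotient e h) ⟨⟨h, rfl⟩, hh⟩
      simpa using this
    rw [toQuotient_apply, QuotientGroup.mk'_apply, QuotientGroup.eq_one_iff] at h1
    refine Subtype.ext (P.eq_one_of_forall_left B fun a ha => ?_)
    simpa [act_apply] using h1 a ha

lemma index_range_dvd (P : IsGaloisPair ρ ρ') (B : IsMatrixBlock K e)
    (T : IsPairing ρ ρ' e u R) [Finite G'] :
    (P.toQuotient e).range.index ∣ (fixer ρ e).index := by
  let f : P.stab e →* G := (MonoidHom.fst G G').comp (P.stab e).subtype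
  have hf : Function.Surjective f := fun g => by
    obtain ⟨g', hg'⟩ := P.exists_map_eq_right B g⁻¹
    refine ⟨⟨(g, g'), ?_⟩, rfl⟩
    rw [mem_stab, act_apply, ← hg', ← AlgEquiv.mul_apply, ← map_mul, mul_inv_cancel, map_one,
      AlgEquiv.one_apply]
  rw [← Subgroup.index_comap_of_surjective _ (QuotientGroup.mk'_surjective (P.kernel e)),
    ← Subgroup.index_map_eq (f := f) _ hf]
  · refine Subgroup.index_dvd_of_le fun h hh => ?_
    exact ⟨⟨_, P.mk_one_mem_stab ⟨h, hh⟩⟩, ⟨⟨h, hh⟩, rfl⟩, rfl⟩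
  · rintro ⟨⟨g, g'⟩, hγ⟩ (rfl : g = 1)
    have hs := mem_stab.mp hγ
    rw [act_apply, map_one, AlgEquiv.one_apply] at hs
    obtain ⟨h, hh⟩ := T.exists_left ⟨g', hs⟩
    refine ⟨h, ?_⟩
    rw [toQuotient_apply, QuotientGroup.mk'_apply, QuotientGroup.mk'_apply, QuotientGroup.eq]
    intro a ha
    rw [Subgroup.coe_mul, Subgroup.coe_inv, map_mul, AlgEquiv.mul_apply, map_inv, AlgEquiv.aut_inv,
      AlgEquiv.symm_apply_eq]
    simp [act_apply, hh a ha]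

lemma nonempty_mulEquiv_of_coprime (P : IsGaloisPair ρ ρ') (B : IsMatrixBlock K e)
    (T : IsPairing ρ ρ' e u R) [Finite G] [Finite G']
    (hco : (Nat.card (fixer ρ e)).Coprime (P.toQuotient e).range.index) : Nonempty (G ≃* G') := by
  have h1 : (Nat.card (P.toQuotient e).range).Coprime (P.toQuotient e).range.index :=
    hco.coprime_dvd_left (Subgroup.card_range_dvd _)
  obtain ⟨C, hC⟩ := Subgroup.exists_right_complement'_of_coprime h1
  exact P.nonempty_mulEquiv_of_isComplement' B T C hC

end IsGaloisPair

section

variable {K A G G' : Type*} [Field K] [Ring A] [Algebra K A] [Group G] [Group G']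
  {ρ : G →* (A ≃ₐ[K] A)} {ρ' : G' →* (A ≃ₐ[K] A)} {e : A} {u : fixer ρ e → A}
  {R : fixer ρ e → fixer ρ e →* K}

namespace IsGaloisPair.IsPairing

lemma eq_one_of_forall (T : IsPairing ρ ρ' e u R) (hu : ∀ h, u h ≠ 0) {h : fixer ρ e}
    (hh : ∀ k, R h k = 1) : h = 1 := by
  apply T.injective
  ext k
  have h1 := T.map_apply 1 k
  rw [OneMemClass.coe_one, map_one, AlgEquiv.one_apply] at h1
  rw [hh, ← smul_left_injective K (hu k) ((one_smul K _).trans h1)]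

lemma pow_eq_one (T : IsPairing ρ ρ' e u R) (hu : ∀ h, u h ≠ 0) {p : ℕ} (hp : p.Prime)
    (hcard : Nat.card (fixer ρ e) = p ^ 2) (h : fixer ρ e) : h ^ p = 1 := by
  obtain ⟨i, hi, hord⟩ := (Nat.dvd_prime_pow hp).mp (hcard ▸ orderOf_dvd_natCard h)
  rcases hi.lt_or_eq with hi | rfl
  · rw [← orderOf_dvd_iff_pow_eq_one, hord]
    simpa using pow_dvd_pow p (Nat.lt_succ_iff.mp hi)
  · have : Finite (fixer ρ e) := Nat.finite_of_card_ne_zero (by simp [hcard, hp.ne_zero])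
    have htop : Subgroup.zpowers h = ⊤ := by
      rw [← Subgroup.card_eq_iff_eq_top, Nat.card_zpowers, hord, hcard]
    rw [T.eq_one_of_forall hu (h := h) fun k => ?_, one_pow]
    obtain ⟨n, rfl⟩ := Subgroup.mem_zpowers_iff.mp (htop ▸ Subgroup.mem_top k)
    have h1 : (R h).toHomUnits h = 1 := Units.ext (T.self h)
    have h2 : (R h).toHomUnits (h ^ n) = 1 := by rw [map_zpow, h1, one_zpow]
    exact congrArg Units.val h2

end IsGaloisPair.IsPairing

namespace IsGaloisPair

lemma conj_mem_fixer (P : IsGaloisPair ρ ρ') {γ : G × G'} (hγ : γ ∈ P.stab e) (h : fixer ρ e) :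
    γ.1 * h * γ.1⁻¹ ∈ fixer ρ e := by
  have h2 := mem_stab.mp (mul_mem (mul_mem hγ (P.mk_one_mem_stab h)) (inv_mem hγ))
  rw [act_apply] at h2
  simpa [mem_fixer] using h2

lemma act_pow_three (P : IsGaloisPair ρ ρ') (B : IsMatrixBlock K e)
    (U : IsHomogeneousBasis ρ e u) (T : IsPairing ρ ρ' e u R)
    (hpow : ∀ h : fixer ρ e, h ^ 3 = 1)
    (hcomm : ∀ (g h x : G), x * (g * h * g⁻¹ * h⁻¹) = g * h * g⁻¹ * h⁻¹ * x)
    {γ : G × G'} (hγ : γ ∈ P.stab e) (a : A) (ha : e * a = a) : P.act (γ ^ 3) a = a := by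
  refine (U.eqOn_block (τ := AlgEquiv.refl) (fun y => ?_) ha).trans rfl
  rw [AlgEquiv.coe_refl, id]
  set c : G := γ.1 * y * γ.1⁻¹ * (y : G)⁻¹ with hc
  have hcx (x : G) : x * c = c * x := hcomm _ _ x
  have hcy : γ.1 * y * γ.1⁻¹ = c * y := by rw [hc]; group
  have hc3 : c ^ 3 = 1 :=
    congrArg Subtype.val (hpow (⟨_, P.conj_mem_fixer hγ y⟩ * y⁻¹))
  have hy3 : (y : G) ^ 3 = 1 := congrArg Subtype.val (hpow y)
  have h1 : P.act γ (u y) ∈ homogeneousPart ρ e (c * y) := by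
    have := P.map_mem_homogeneousPart hγ (U.mem y)
    rwa [hcy] at this
  have conj_c : γ.1 * c * γ.1⁻¹ = c := by rw [hcx, mul_inv_cancel_right]
  have h2 : P.act γ (P.act γ (u y)) ∈ homogeneousPart ρ e (c * (c * y)) := by
    have := P.map_mem_homogeneousPart hγ h1
    rwa [show γ.1 * (c * y) * γ.1⁻¹ = (γ.1 * c * γ.1⁻¹) * (γ.1 * y * γ.1⁻¹) by group, hcy,
      conj_c] at this
  have h3 : P.act γ (P.act γ (P.act γ (u y))) ∈ homogeneousPart ρ e (y : G) := by
    have := P.map_mem_homogeneousPart hγ h2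
    rwa [show γ.1 * (c * (c * y)) * γ.1⁻¹ =
      (γ.1 * c * γ.1⁻¹) * ((γ.1 * c * γ.1⁻¹) * (γ.1 * y * γ.1⁻¹)) by group, hcy,
      conj_c, show c * (c * (c * y)) = c ^ 3 * y by
        simp only [pow_succ, pow_zero, one_mul, mul_assoc], hc3, one_mul]
      at this
  set v := P.act γ (u y) * P.act γ (P.act γ (u y)) with hv
  have hv1 : v ∈ homogeneousPart ρ e ((y⁻¹ : fixer ρ e) : G) := by
    have := mul_mem_homogeneousPart h1 h2
    have h4 : c * y * (c * (c * y)) = (y : G)⁻¹ := by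
      refine eq_inv_of_mul_eq_one_left ?_
      calc c * y * (c * (c * y)) * y = c * (y * c) * c * y * y := by simp only [mul_assoc]
        _ = c * (c * y) * c * y * y := by rw [hcx y]
        _ = c * c * (y * c) * y * y := by simp only [mul_assoc]
        _ = c ^ 3 * (y : G) ^ 3 := by
          rw [hcx y]; simp only [pow_succ, pow_zero, one_mul, mul_assoc]
        _ = 1 := by rw [hc3, hy3, one_mul]
    rwa [h4] at this
  have hact0 {w : A} (hw : w ≠ 0) : P.act γ w ≠ 0 := by
    rwa [Ne, EmbeddingLike.map_eq_zero_iff]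
  have hv0 : v ≠ 0 :=
    B.mul_ne_zero h1 (hact0 (U.ne_zero y)) h2 (hact0 (hact0 (U.ne_zero y)))
  have huv0 : u y * v ≠ 0 := B.mul_ne_zero (U.mem y) (U.ne_zero y) hv1 hv0
  obtain ⟨l, hl⟩ := U.exists_eq_smul B h3
  have hfix : P.act γ (u y * v) = u y * v := by
    have := mul_mem_homogeneousPart (U.mem y) hv1
    rw [← Subgroup.coe_mul, mul_inv_cancel] at this
    obtain ⟨t, ht⟩ := B.exists_eq_smul B.self_mem_homogeneousPart B.ne_zero this
    rw [ht, map_smul, mem_stab.mp hγ]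
  have hswap : u y * v = v * u y := by
    obtain ⟨t, ht⟩ := U.exists_eq_smul B hv1
    have h4 : R y y⁻¹ = 1 := by
      have := map_mul (R y) y y⁻¹
      rwa [mul_inv_cancel, map_one, T.self, one_mul, eq_comm] at this
    rw [(U.mem y).2, ht, map_smul, T.map_apply, h4, one_smul]
  have hl1 : u y * v = l • (u y * v) := by
    conv_lhs => rw [← hfix, map_mul, hv, map_mul, hl, ← mul_assoc, ← hv, mul_smul_comm, ← hswap]
  have : l = 1 := (smul_left_injective K huv0 (by simpa using hl1)).symm
  rw [this, one_smul] at hl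
  rw [pow_succ, pow_two, map_mul, map_mul, AlgEquiv.mul_apply, AlgEquiv.mul_apply, hl]

lemma nonempty_mulEquiv_of_card_eq_27 (P : IsGaloisPair ρ ρ') (B : IsMatrixBlock K e)
    (U : IsHomogeneousBasis ρ e u) (T : IsPairing ρ ρ' e u R) [Finite G] [Finite G']
    (hcard : Nat.card (fixer ρ e) = 9) (hindex : (fixer ρ e).index = 3) :
    Nonempty (G ≃* G') := by
  have hG : Nat.card G = 3 ^ 3 := by
    rw [← Subgroup.card_mul_index (fixer ρ e), hcard, hindex]
    norm_num
  have : Fact (Nat.Prime 3) := ⟨Nat.prime_three⟩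
  have hcomm : ∀ (g h x : G), x * (g * h * g⁻¹ * h⁻¹) = g * h * g⁻¹ * h⁻¹ * x := by
    have hp : IsPGroup 3 G := IsPGroup.of_card hG
    have hnt : Nontrivial G := by
      rw [← Finite.one_lt_card_iff_nontrivial, hG]
      norm_num
    have hZ := hp.center_nontrivial
    have hQcard : ∃ i ≤ 2, Nat.card (G ⧸ Subgroup.center G) = 3 ^ i := by
      have h1 := Subgroup.card_eq_card_quotient_mul_card_subgroup (Subgroup.center G)
      rw [hG] at h1
      obtain ⟨i, hi, hi'⟩ := (Nat.dvd_prime_pow Nat.prime_three).mp (Dvd.intro _ h1.symm)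
      refine ⟨i, ?_, hi'⟩
      rw [← Finite.one_lt_card_iff_nontrivial] at hZ
      by_contra! hlt
      obtain rfl : i = 3 := by omega
      rw [hi'] at h1
      omega
    have hQ (a b : G ⧸ Subgroup.center G) : a * b = b * a := by
      obtain ⟨i, hi, hc⟩ := hQcard
      interval_cases i
      · have : Subsingleton (G ⧸ Subgroup.center G) :=
          (Nat.card_eq_one_iff_unique.mp (by simpa using hc)).1
        exact Subsingleton.elim _ _
      · have : IsCyclic (G ⧸ Subgroup.center G) := isCyclic_of_prime_card (by simpa using hc)
        exact IsCyclic.commGroup.mul_comm a b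
      · exact (IsPGroup.commGroupOfCardEqPrimeSq hc).mul_comm a b
    intro g h x
    have h1 : g * h * g⁻¹ * h⁻¹ ∈ Subgroup.center G := by
      rw [← QuotientGroup.eq_one_iff]
      have := hQ g h
      simp [this]
    exact Subgroup.mem_center_iff.mp h1 x
  have hcube (q : P.stab e ⧸ P.kernel e) : q ^ 3 = 1 := by
    obtain ⟨γ, rfl⟩ := QuotientGroup.mk'_surjective _ q
    rw [← map_pow, QuotientGroup.mk'_apply, QuotientGroup.eq_one_iff]
    exact fun a ha => P.act_pow_three B U T (T.pow_eq_one U.ne_zero Nat.prime_three hcard) hcomm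
      γ.2 a ha
  rcases (Nat.dvd_prime Nat.prime_three).mp (hindex ▸ P.index_range_dvd B T) with h1 | h3
  · exact P.nonempty_mulEquiv_of_coprime B T (by simp [h1])
  · have hne : (P.toQuotient e).range ≠ ⊤ := by
      rw [Ne, ← Subgroup.index_eq_one, h3]
      norm_num
    obtain ⟨q, hq⟩ := not_forall.mp (mt (Subgroup.eq_top_iff' _).mpr hne)
    have hq1 : q ≠ 1 := fun h => hq (h ▸ one_mem _)
    have hord : Nat.card (Subgroup.zpowers q) = 3 := by
      rw [Nat.card_zpowers]
      exact orderOf_eq_prime (hcube q) hq1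
    refine P.nonempty_mulEquiv_of_isComplement' B T (Subgroup.zpowers q)
      (Subgroup.isComplement'_of_card_mul_and_disjoint ?_ ?_)
    · rw [hord, ← h3, Subgroup.card_mul_index]
    · rw [disjoint_iff]
      set I := (P.toQuotient e).range ⊓ Subgroup.zpowers q
      have hdvd : Nat.card I ∣ 3 := hord ▸ Subgroup.card_dvd_of_le inf_le_right
      rcases (Nat.dvd_prime Nat.prime_three).mp hdvd with h | h
      · exact Subgroup.card_eq_one.mp h
      · have : I = Subgroup.zpowers q := Subgroup.eq_of_le_of_card_ge inf_le_right (by rw [h, hord])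
        exact absurd (this.ge (Subgroup.mem_zpowers q)).1 hq

end IsGaloisPair

end

/-- In a group of order four, two distinct nontrivial elements of order two determine all
elements. -/
lemma eq_one_or_eq_or_eq_of_card_eq_four {H : Type*} [Group H] (hcard : Nat.card H = 4)
    (hpow : ∀ h : H, h ^ 2 = 1) {x y : H} (hx : x ≠ 1) (hy : y ≠ 1) (hxy : x ≠ y) (k : H) :
    k = 1 ∨ k = x ∨ k = y ∨ k = x * y := by
  classical
  have : Finite H := Nat.finite_of_card_ne_zero (by simp [hcard])
  have := Fintype.ofFinite H
  have h1 : x * y ≠ 1 := fun h => hxy (by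
    rw [eq_inv_of_mul_eq_one_left h, inv_eq_of_mul_eq_one_left (by rw [← pow_two, hpow])])
  have h2 : ({1, x, y, x * y} : Finset H) = Finset.univ := by
    apply Finset.eq_univ_of_card
    rw [← Nat.card_eq_fintype_card, hcard, Finset.card_insert_of_notMem,
      Finset.card_insert_of_notMem, Finset.card_insert_of_notMem, Finset.card_singleton]
    · simpa using hx
    · simpa [hxy] using hy
    · simpa [eq_comm, hx, hy] using h1
  simpa using h2.ge (Finset.mem_univ k)

lemma pairing_eq_neg_one {H K : Type*} [Group H] [Field K] (hcard : Nat.card H = 4)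
    (hpow : ∀ h : H, h ^ 2 = 1) {R : H → H →* K} (hself : ∀ h, R h h = 1)
    (hR : ∀ h, (∀ k, R h k = 1) → h = 1) {x y : H} (hx : x ≠ 1) (hy : y ≠ 1) (hxy : x ≠ y) :
    R x y = -1 := by
  have h1 : R x y * R x y = 1 := by rw [← map_mul, ← pow_two, hpow, map_one]
  refine (mul_self_eq_one_iff.mp h1).resolve_left fun h2 => hx (hR x fun k => ?_)
  rcases eq_one_or_eq_or_eq_of_card_eq_four hcard hpow hx hy hxy k with rfl | rfl | rfl | rfl <;>
    simp [hself, h2]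

lemma exists_pairing_mul_eq {H K : Type*} [Group H] [Field K] (hcard : Nat.card H = 4)
    (hpow : ∀ h : H, h ^ 2 = 1) {R : H → H →* K} (hself : ∀ h, R h h = 1)
    (hR : ∀ h, (∀ k, R h k = 1) → h = 1) (hone : ∀ k, R 1 k = 1) (ε : H → K)
    (hε : ∀ k, ε k = 1 ∨ ε k = -1) :
    ∃ h, ∃ c : K, (c = 1 ∨ c = -1) ∧ ∀ k, k ≠ 1 → R h k * ε k = c := by
  by_cases hw : ∃ w ≠ 1, ∀ k, k ≠ 1 → k ≠ w → ε k = -ε w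
  · obtain ⟨w, hw1, hw⟩ := hw
    refine ⟨w, ε w, hε w, fun k hk => ?_⟩
    rcases eq_or_ne k w with rfl | hkw
    · rw [hself, one_mul]
    · rw [pairing_eq_neg_one hcard hpow hself hR hw1 hk hkw.symm, hw k hk hkw]
      ring
  · push Not at hw
    have hsame (w : H) (hw1 : w ≠ 1) : ∃ k, k ≠ 1 ∧ k ≠ w ∧ ε k = ε w := by
      obtain ⟨k, hk1, hkw, hk⟩ := hw w hw1
      refine ⟨k, hk1, hkw, ?_⟩
      rcases hε k with h1 | h1 <;> rcases hε w with h2 | h2 <;> simp_all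
    have : Finite H := Nat.finite_of_card_ne_zero (by simp [hcard])
    have : Nontrivial H := by
      rw [← Finite.one_lt_card_iff_nontrivial, hcard]
      norm_num
    obtain ⟨x, hx⟩ := exists_ne (1 : H)
    obtain ⟨y, hy, hyx, hxy⟩ := hsame x hx
    refine ⟨1, ε x, hε x, fun k hk => ?_⟩
    rw [hone, one_mul]
    by_cases hkx : k = x
    · rw [hkx]
    by_cases hky : k = y
    · rw [hky, hxy]
    obtain ⟨l, hl1, hlk, hl⟩ := hsame k hk
    rcases eq_one_or_eq_or_eq_of_card_eq_four hcard hpow hx hy hyx.symm k with h | h | h | h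
    · exact absurd h hk
    · exact absurd h hkx
    · exact absurd h hky
    · rcases eq_one_or_eq_or_eq_of_card_eq_four hcard hpow hx hy hyx.symm l with h' | h' | h' | h'
      · exact absurd h' hl1
      · rw [← hl, h']
      · rw [← hl, h', hxy]
      · exact absurd (h'.trans h.symm) hlk

section

variable {K A G G' : Type*} [Field K] [Ring A] [Algebra K A] [Group G] [Group G']
  {ρ : G →* (A ≃ₐ[K] A)} {ρ' : G' →* (A ≃ₐ[K] A)} {e : A} {u : fixer ρ e → A}
  {R : fixer ρ e → fixer ρ e →* K}

lemma IsHomogeneousBasis.exists_mul_self_eq [IsAlgClosed K] (U : IsHomogeneousBasis ρ e u)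
    (B : IsMatrixBlock K e) (hpow : ∀ h : fixer ρ e, h ^ 2 = 1) :
    ∃ v, IsHomogeneousBasis ρ e v ∧ ∀ h, v h * v h = e := by
  have h1 (h : fixer ρ e) : ∃ s : Kˣ, (s • u h) * (s • u h) = e := by
    obtain ⟨c, hc0, hc⟩ := U.exists_mul_eq B h h
    obtain ⟨d, hd0, hd⟩ := U.exists_one_eq B
    rw [← pow_two h, hpow] at hc
    obtain ⟨s, hs⟩ := IsAlgClosed.exists_pow_nat_eq (d / c) (n := 2) (by norm_num)
    have hs0 : s ≠ 0 := by
      rintro rfl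
      rw [zero_pow two_ne_zero, eq_comm, div_eq_zero_iff] at hs
      tauto
    refine ⟨Units.mk0 s hs0, ?_⟩
    rw [smul_mul_smul_comm, hc, Units.smul_def, Units.val_mul, Units.val_mk0, ← pow_two, hs,
      smul_smul, div_mul_cancel₀ _ hc0, ← hd]
  choose s hs using h1
  refine ⟨fun h => s h • u h, ⟨fun h => Submodule.smul_mem _ _ (U.mem h),
    U.linearIndependent.units_smul s, fun a ha => ?_⟩, hs⟩
  refine Submodule.span_le.mpr ?_ (U.mem_span a ha)
  rintro _ ⟨h, rfl⟩
  have : u h = ((s h)⁻¹ : Kˣ) • (s h • u h) := by rw [smul_smul, inv_mul_cancel, one_smul]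
  rw [this]
  exact Submodule.smul_mem _ _ (Submodule.subset_span ⟨h, rfl⟩)

namespace IsGaloisPair

lemma nonempty_mulEquiv_of_card_eq_four (P : IsGaloisPair ρ ρ') (B : IsMatrixBlock K e)
    (U : IsHomogeneousBasis ρ e u) (T : IsPairing ρ ρ' e u R) [Finite G] [Finite G']
    (hcard : Nat.card (fixer ρ e) = 4) (hsq : ∀ h, u h * u h = e) : Nonempty (G ≃* G') := by
  classical
  have := Fintype.ofFinite (fixer ρ e)
  have hpow := T.pow_eq_one U.ne_zero Nat.prime_two hcard
  have hone (k) : R 1 k = 1 := by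
    have h1 := T.map_apply 1 k
    rw [OneMemClass.coe_one, map_one, AlgEquiv.one_apply] at h1
    exact (smul_left_injective K (U.ne_zero k) ((one_smul K _).trans h1)).symm
  let σ : A := ∑ k ∈ Finset.univ.erase (1 : fixer ρ e), u k
  have hσ : e * σ = σ := by
    simp only [σ, Finset.mul_sum]
    exact Finset.sum_congr rfl fun k _ => (U.mem k).1
  let C : Subgroup (G × G') :=
    { carrier := {γ | γ ∈ P.stab e ∧ (P.act γ σ = σ ∨ P.act γ σ = -σ)}
      one_mem' := ⟨one_mem _, by simp⟩
      mul_mem' := by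
        rintro γ δ ⟨hγ, h1⟩ ⟨hδ, h2⟩
        refine ⟨mul_mem hγ hδ, ?_⟩
        rw [map_mul, AlgEquiv.mul_apply]
        rcases h1 with h1 | h1 <;> rcases h2 with h2 | h2 <;> simp [h1, h2]
      inv_mem' := by
        rintro γ ⟨hγ, h1⟩
        refine ⟨inv_mem hγ, ?_⟩
        rw [map_inv, AlgEquiv.aut_inv, AlgEquiv.symm_apply_eq, AlgEquiv.symm_apply_eq, map_neg]
        rcases h1 with h1 | h1 <;> simp [h1] }
  refine P.nonempty_mulEquiv B T C (fun γ hγ => hγ.1) (fun γ hγ δ hδ h => ⟨hδ, ?_⟩)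
    (fun γ hγ => ?_) (fun h hh => ?_)
  · rw [← h σ hσ]
    exact hγ.2
  · let π (k : fixer ρ e) : fixer ρ e := ⟨_, P.conj_mem_fixer hγ k⟩
    have hπ : Function.Injective π := fun k l hkl => by
      have := congrArg Subtype.val hkl
      exact Subtype.ext (by simpa [π] using this)
    have hπ1 : π 1 = 1 := Subtype.ext (by simp [π])
    have hεex (k : fixer ρ e) : ∃ t : K, (t = 1 ∨ t = -1) ∧ P.act γ (u k) = t • u (π k) := by
      obtain ⟨t, ht⟩ := U.exists_eq_smul B (h := π k) (P.map_mem_homogeneousPart hγ (U.mem k))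
      refine ⟨t, mul_self_eq_one_iff.mp ?_, ht⟩
      have h1 := congrArg (P.act γ) (hsq k)
      rw [map_mul, ht, smul_mul_smul_comm, hsq, mem_stab.mp hγ] at h1
      exact smul_left_injective K B.ne_zero (by simpa using h1)
    choose ε hε hγu using hεex
    obtain ⟨h, c, hc, hhc⟩ := exists_pairing_mul_eq hcard hpow T.self
      (fun h => T.eq_one_of_forall U.ne_zero) hone ε hε
    refine ⟨h, mul_mem hγ (P.mk_one_mem_stab h), ?_⟩
    have h1 : P.act (γ * ((h : G), (1 : G'))) σ = c • σ := by
      have h2 (k) : P.act ((h : G), (1 : G')) (u k) = R h k • u k := by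
        simp [act_apply, T.map_apply]
      rw [map_mul, AlgEquiv.mul_apply]
      simp only [σ, map_sum, h2, map_smul, hγu, smul_smul]
      rw [Finset.smul_sum]
      refine Finset.sum_bij (fun k _ => π k) (fun k hk => ?_) (fun k _ l _ hkl => hπ hkl)
        (fun k hk => ?_) (fun k hk => ?_)
      · refine Finset.mem_erase.mpr ⟨fun h => ?_, Finset.mem_univ _⟩
        exact (Finset.mem_erase.mp hk).1 (hπ (h.trans hπ1.symm))
      · obtain ⟨l, rfl⟩ := Finite.surjective_of_injective hπ k
        refine ⟨l, Finset.mem_erase.mpr ⟨?_, Finset.mem_univ _⟩, rfl⟩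
        rintro rfl
        exact (Finset.mem_erase.mp hk).1 hπ1
      · rw [hhc k (Finset.mem_erase.mp hk).1]
    rw [h1]
    exact hc.imp (fun h => by rw [h, one_smul]) (fun h => by rw [h, neg_one_smul])
  · by_contra h1
    have hc : ∃ c : K, P.act ((h : G), (1 : G')) σ = c • σ := by
      rcases hh.2 with h2 | h2
      · exact ⟨1, by rw [h2, one_smul]⟩
      · exact ⟨-1, by rw [h2, neg_one_smul]⟩
    obtain ⟨c, hc⟩ := hc
    have h2 : ∑ k ∈ Finset.univ.erase (1 : fixer ρ e), (R h k - c) • u k = 0 := by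
      simp only [sub_smul, Finset.sum_sub_distrib, ← Finset.smul_sum]
      rw [sub_eq_zero, ← hc]
      simp [σ, act_apply, T.map_apply]
    have h3 (k) (hk : k ≠ 1) : R h k = c := by
      have := linearIndependent_iff'.mp U.linearIndependent _ _ h2 k
        (Finset.mem_erase.mpr ⟨hk, Finset.mem_univ _⟩)
      exact sub_eq_zero.mp this
    have h4 : c = 1 := by rw [← h3 h h1, T.self]
    refine h1 (T.eq_one_of_forall U.ne_zero fun k => ?_)
    rcases eq_or_ne k 1 with rfl | hk
    · exact map_one _
    · rw [h3 k hk, h4]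

theorem nonempty_mulEquiv_of_card_lt (P : IsGaloisPair ρ ρ') [IsAlgClosed K] [Finite G] [Finite G']
    (hcard : Nat.card G < 32) : Nonempty (G ≃* G') := by
  have := P.finite
  have := P.nontrivial
  have := P.isSemisimpleRing
  obtain ⟨e, B⟩ := exists_isMatrixBlock K (A := A)
  obtain ⟨⟨u, U⟩, d, hd⟩ := P.exists_isHomogeneousBasis B
  obtain ⟨R, T⟩ := P.exists_isPairing B U
  have hG := Subgroup.card_mul_index (fixer ρ e)
  have hdvd := P.index_range_dvd B T
  have hd0 : 0 < Nat.card (fixer ρ e) := Nat.card_pos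
  have hm0 : (fixer ρ e).index ≠ 0 := Subgroup.index_ne_zero_of_finite
  set m := (fixer ρ e).index with hm
  have hd6 : d < 6 := by
    by_contra! h
    have : 36 ≤ d ^ 2 := by nlinarith
    have : d ^ 2 ≤ d ^ 2 * m := Nat.le_mul_of_pos_right _ (Nat.pos_of_ne_zero hm0)
    rw [hd] at hG
    omega
  have hco (h : (d ^ 2).Coprime m) : Nonempty (G ≃* G') :=
    P.nonempty_mulEquiv_of_coprime B T (hd ▸ h.coprime_dvd_right hdvd)
  rw [hd] at hG hd0
  interval_cases d
  · simp at hd0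
  · exact hco (by simp)
  · obtain ⟨v, V, hv⟩ := U.exists_mul_self_eq B (T.pow_eq_one U.ne_zero Nat.prime_two hd)
    obtain ⟨S, T'⟩ := P.exists_isPairing B V
    exact P.nonempty_mulEquiv_of_card_eq_four B V T' hd hv
  · have hm3 : m ≤ 3 := by omega
    clear_value m
    interval_cases m
    · exact absurd rfl hm0
    · exact hco (by norm_num)
    · exact hco (by norm_num)
    · exact P.nonempty_mulEquiv_of_card_eq_27 B U T hd hm.symm
  · have hm1 : m = 1 := by omega
    exact hco (by simp [hm1])
  · have hm1 : m = 1 := by omega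
    exact hco (by simp [hm1])

end IsGaloisPair

end

section

variable {K A G G' : Type*} [Field K] [Ring A] [Algebra K A] [Group G] [Group G']
  {ρ : G →* (A ≃ₐ[K] A)} {ρ' : G' →* (A ≃ₐ[K] A)}

namespace IsGaloisPair

lemma of_bijective [Nontrivial A] [Finite G] (hcomm : ∀ g g' a, ρ g (ρ' g' a) = ρ' g' (ρ g a))
    (hbij : Function.Bijective (canonicalMap ρ))
    (hfixed : ∀ a, (∀ g', ρ' g' a = a) → ∃ c : K, a = algebraMap K A c)
    (hfaithful : ∀ g', (∀ a, ρ' g' a = a) → g' = 1) : IsGaloisPair ρ ρ' := by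
  classical
  have := Fintype.ofFinite G
  have hdual : ∃ (n : ℕ) (x y : Fin n → A), (∑ i, x i * y i = 1) ∧
      ∀ g, g ≠ 1 → ∑ i, x i * ρ g (y i) = 0 := by
    obtain ⟨t, ht⟩ := hbij.2 (Pi.single 1 1)
    obtain ⟨S, rfl⟩ := TensorProduct.exists_finset t
    have h1 (g : G) : ∑ i : Fin S.card, (S.equivFin.symm i).1.1 * ρ g (S.equivFin.symm i).1.2 =
        (Pi.single 1 1 : G → A) g := by
      rw [← ht, map_sum, Finset.sum_apply, ← Finset.sum_coe_sort S]
      simp only [canonicalMap_tmul]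
      exact Equiv.sum_comp S.equivFin.symm fun s => s.1.1 * ρ g s.1.2
    refine ⟨S.card, fun i => (S.equivFin.symm i).1.1, fun i => (S.equivFin.symm i).1.2, ?_,
      fun g hg => ?_⟩
    · simpa using h1 1
    · rw [h1, Pi.single_eq_of_ne hg]
  have hinv (a : A) (ha : ∀ g, ρ g a = a) : ∃ c : K, a = c • 1 := by
    have h1 : a ⊗ₜ[K] (1 : A) = 1 ⊗ₜ a := hbij.1 (by ext g; simp [ha])
    obtain ⟨f, hf⟩ := Module.exists_dual_forall_apply_eq_one (K := K) (s := Set.univ)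
      (v := fun _ : Unit => (1 : A))
      ((LinearIndependent.of_subsingleton () one_ne_zero).linearIndepOn _)
    refine ⟨f a, ?_⟩
    have := congrArg ((TensorProduct.rid K A).toLinearMap ∘ₗ TensorProduct.map LinearMap.id f) h1
    simpa [hf ()] using this
  obtain ⟨n, x, y, h1, h2⟩ := hdual
  have hfin : Module.Finite K A := by
    refine ⟨Finset.univ.image x, eq_top_iff.mpr fun a _ => ?_⟩
    have h3 (i) : ∃ c : K, ∑ g, ρ g (y i * a) = c • 1 := hinv _ fun g => by
      rw [map_sum, ← Equiv.sum_comp (Equiv.mulLeft g) fun x => ρ x (y i * a)]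
      exact Finset.sum_congr rfl fun x _ => by
        rw [Equiv.coe_mulLeft, map_mul ρ, AlgEquiv.mul_apply]
    choose c hc using h3
    have h4 : a = ∑ i, c i • x i := by
      calc a = ∑ g, (∑ i, x i * ρ g (y i)) * ρ g a := by
            rw [Finset.sum_eq_single 1]
            · simp [h1]
            · intro g _ hg
              rw [h2 g hg, zero_mul]
            · simp
        _ = ∑ i, x i * ∑ g, ρ g (y i * a) := by
            simp only [Finset.sum_mul, Finset.mul_sum, map_mul, mul_assoc]
            exact Finset.sum_comm
        _ = _ := by simp only [hc, mul_smul_comm, mul_one]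
    rw [h4]
    exact sum_mem fun i _ => Submodule.smul_mem _ _ (Submodule.subset_span (by simp))
  refine ⟨hcomm, inferInstance, hfin, ?_, ⟨n, x, y, h1, h2⟩, hfixed, hfaithful⟩
  have h5 := (LinearEquiv.ofBijective _ hbij).finrank_eq
  rw [Module.finrank_tensorProduct, Module.finrank_pi_fintype, Finset.sum_const, smul_eq_mul,
    Finset.card_univ, ← Nat.card_eq_fintype_card] at h5
  exact Nat.eq_of_mul_eq_mul_right Module.finrank_pos h5

/-- The action on the base change of an algebra. -/
noncomputable def baseChangeHom (L : Type*) [Field L] [Algebra K L] (ρ : G →* (A ≃ₐ[K] A)) :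
    G →* ((L ⊗[K] A) ≃ₐ[L] (L ⊗[K] A)) where
  toFun g := Algebra.TensorProduct.congr AlgEquiv.refl (ρ g)
  map_one' := by
    ext x
    induction x with
    | zero => simp
    | add x y hx hy => rw [map_add, hx, hy, map_add]
    | tmul x y => simp
  map_mul' g h := by
    ext x
    induction x with
    | zero => simp
    | add x y hx hy => rw [map_add, hx, hy, map_add]
    | tmul x y => simp

@[simp]
lemma baseChangeHom_tmul (L : Type*) [Field L] [Algebra K L] (ρ : G →* (A ≃ₐ[K] A)) (g : G)
    (x : L) (a : A) : baseChangeHom L ρ g (x ⊗ₜ a) = x ⊗ₜ ρ g a := by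
  simp [baseChangeHom]

lemma baseChange (P : IsGaloisPair ρ ρ') (L : Type*) [Field L] [Algebra K L] :
    IsGaloisPair (baseChangeHom L ρ) (baseChangeHom L ρ') where
  comm g g' x := by
    induction x with
    | zero => simp
    | add x y hx hy => simp only [map_add, hx, hy]
    | tmul x y => simp [P.comm]
  nontrivial := by
    have := P.nontrivial
    infer_instance
  finite := by
    have := P.finite
    infer_instance
  finrank_eq := by rw [Module.finrank_baseChange, P.finrank_eq]
  exists_dual := by
    obtain ⟨n, x, y, h1, h2⟩ := P.exists_dual
    refine ⟨n, fun i => 1 ⊗ₜ x i, fun i => 1 ⊗ₜ y i, ?_, fun g hg => ?_⟩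
    · simp [← TensorProduct.tmul_sum, h1, Algebra.TensorProduct.one_def]
    · simp [← TensorProduct.tmul_sum, h2 g hg]
  fixed x hx := by
    classical
    let b := Module.Basis.ofVectorSpace K L
    let F := TensorProduct.equivFinsuppOfBasisLeft (N := A) b
    have h1 (g' : G') (x : L ⊗[K] A) (i) : F (baseChangeHom L ρ' g' x) i = ρ' g' (F x i) := by
      induction x with
      | zero => simp
      | add x y hx hy => simp only [map_add, Finsupp.add_apply, hx, hy]
      | tmul x y => simp [F]
    have h2 (i) : ∃ c : K, F x i = algebraMap K A c := P.fixed _ fun g' => by rw [← h1, hx]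
    choose c hc using h2
    have h3 : x = (F x).sum fun i a => b i ⊗ₜ a := by
      rw [← TensorProduct.equivFinsuppOfBasisLeft_symm_apply, F.symm_apply_apply]
    refine ⟨(F x).sum fun i _ => c i • b i, ?_⟩
    conv_lhs => rw [h3]
    simp [Finsupp.sum, hc, Algebra.algebraMap_eq_smul_one, Algebra.TensorProduct.one_def,
      TensorProduct.smul_tmul']
  faithful g' h := by
    refine P.faithful g' fun a => ?_
    apply Algebra.TensorProduct.includeRight_injective (R := K) (A := L) (B := A)
      (algebraMap K L).injective
    simpa using h (1 ⊗ₜ a)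

end IsGaloisPair

end

section

open MonoidalCategory MonObj

universe u

namespace Rep

variable {k H : Type u} [Field k] [Group H]

/-- The ring structure on the underlying space of a monoid object in representations. -/
noncomputable abbrev ringOfMonObj (A : Rep.{u} k H) [MonObj A] : Ring A.V where
  __ := (inferInstance : AddCommGroup A.V)
  mul a b := (μ[A]).hom (a ⊗ₜ[k] b)
  one := (η[A]).hom (1 : k)
  left_distrib a b c := by
    change (μ[A]).hom (a ⊗ₜ[k] (b + c)) = (μ[A]).hom (a ⊗ₜ[k] b) + (μ[A]).hom (a ⊗ₜ[k] c)
    rw [TensorProduct.tmul_add, map_add]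
  right_distrib a b c := by
    change (μ[A]).hom ((a + b) ⊗ₜ[k] c) = (μ[A]).hom (a ⊗ₜ[k] c) + (μ[A]).hom (b ⊗ₜ[k] c)
    rw [TensorProduct.add_tmul, map_add]
  zero_mul a := by
    change (μ[A]).hom ((0 : A.V) ⊗ₜ[k] a) = 0
    rw [TensorProduct.zero_tmul, map_zero]
  mul_zero a := by
    change (μ[A]).hom (a ⊗ₜ[k] (0 : A.V)) = 0
    rw [TensorProduct.tmul_zero, map_zero]
  mul_assoc a b c := congr(($(MonObj.mul_assoc A)).hom ((a ⊗ₜ[k] b) ⊗ₜ[k] c))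
  one_mul a := by
    have : (μ[A]).hom ((η[A]).hom (1 : k) ⊗ₜ[k] a) = (1 : k) • a :=
      congr(($(MonObj.one_mul A)).hom ((1 : k) ⊗ₜ[k] a))
    rwa [one_smul] at this
  mul_one a := by
    have : (μ[A]).hom (a ⊗ₜ[k] (η[A]).hom (1 : k)) = (1 : k) • a :=
      congr(($(MonObj.mul_one A)).hom (a ⊗ₜ[k] (1 : k)))
    rwa [one_smul] at this

attribute [local instance] ringOfMonObj

lemma mul_def_of_monObj (A : Rep.{u} k H) [MonObj A] (a b : A.V) :
    a * b = (μ[A]).hom (a ⊗ₜ[k] b) := rfl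

/-- The algebra structure on the underlying space of a monoid object in representations. -/
noncomputable abbrev algebraOfMonObj (A : Rep.{u} k H) [MonObj A] : Algebra k A.V :=
  Algebra.ofModule
    (fun r x y => by
      rw [mul_def_of_monObj, mul_def_of_monObj]
      exact map_smul (μ[A]).hom r (x ⊗ₜ[k] y))
    (fun r x y => by
      simp only [mul_def_of_monObj, TensorProduct.tmul_smul]
      exact map_smul (μ[A]).hom r (x ⊗ₜ[k] y))

attribute [local instance] algebraOfMonObj

/-- The group acts on a monoid object by algebra automorphisms. -/
noncomputable def algEquivHom (A : Rep.{u} k H) [MonObj A] : H →* (A.V ≃ₐ[k] A.V) where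
  toFun h := AlgEquiv.ofLinearEquiv
    (LinearEquiv.ofLinearMap (A.ρ h) (A.ρ h⁻¹)
      (by rw [← ρ_mul, mul_inv_cancel, map_one]; rfl)
      (by rw [← ρ_mul, inv_mul_cancel, map_one]; rfl))
    (by
      change A.ρ h ((η[A]).hom (1 : k)) = (η[A]).hom (1 : k)
      rw [← hom_comm_apply]
      rfl)
    (fun x y => by
      change A.ρ h ((μ[A]).hom (x ⊗ₜ[k] y)) = (μ[A]).hom (A.ρ h x ⊗ₜ[k] A.ρ h y)
      rw [← hom_comm_apply]
      rfl)
  map_one' := by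
    ext x
    change A.ρ 1 x = x
    simp
  map_mul' g h := by
    ext x
    change A.ρ (g * h) x = A.ρ g (A.ρ h x)
    simp

/-- The algebra homomorphism underlying a homomorphism of monoid objects. -/
noncomputable def algHomOfIsMonHom {A B : Rep.{u} k H} [MonObj A] [MonObj B] (f : A ⟶ B)
    [IsMonHom f] : A.V →ₐ[k] B.V :=
  AlgHom.ofLinearMap f.hom.toLinearMap
    congr(($(IsMonHom.one_hom f)).hom (1 : k))
    (fun x y => congr(($(IsMonHom.mul_hom f)).hom (x ⊗ₜ[k] y)))

/-- A group of automorphisms of a monoid object acts by algebra automorphisms. -/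
noncomputable def algEquivHomOfAut {G : Type*} [Group G] (A : Rep.{u} k H) [MonObj A]
    (f : G → (A ⟶ A)) [∀ g, IsMonHom (f g)] (h1 : f 1 = 𝟙 A) (hmul : ∀ g h, f (g * h) = f h ≫ f g) :
    G →* (A.V ≃ₐ[k] A.V) where
  toFun g := AlgEquiv.ofAlgHom (algHomOfIsMonHom (f g)) (algHomOfIsMonHom (f g⁻¹))
    (by
      ext x
      change (f g⁻¹ ≫ f g).hom x = x
      rw [← hmul, mul_inv_cancel, h1]
      rfl)
    (by
      ext x
      change (f g ≫ f g⁻¹).hom x = x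
      rw [← hmul, inv_mul_cancel, h1]
      rfl)
  map_one' := by
    ext x
    change (f 1).hom x = x
    rw [h1]
    rfl
  map_mul' g h := by
    ext x
    change (f (g * h)).hom x = (f h ≫ f g).hom x
    rw [hmul]

end Rep

end

section

open MonoidalCategory MonObj

universe u

namespace Rep

variable (k G : Type u) [Field k] [Group G]

/-- The representation on functions on a group by right translation. -/
abbrev functionRep : Rep.{u} k G := Rep.of (X := G → k)
  { toFun g := LinearMap.funLeft k k (· * g)
    map_one' := by
      ext
      simp [LinearMap.funLeft]
    map_mul' g h := by
      ext
      simp [LinearMap.funLeft, _root_.mul_assoc] }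

variable {k G}

lemma functionRep_ρ_apply (g : G) (f : G → k) (x : G) :
    ((functionRep k G).ρ g f : G → k) x = f (x * g) := rfl

variable (k G)

noncomputable instance : MonObj (functionRep k G) where
  one := ofHom (σ := (functionRep k G).ρ) (ρ := (𝟙_ (Rep k G)).ρ)
    ⟨LinearMap.toSpanSingleton k (G → k) 1, fun g => by ext; simp⟩
  mul := ofHom (σ := (functionRep k G).ρ) (ρ := (functionRep k G ⊗ functionRep k G).ρ)
    ⟨LinearMap.mul' k (G → k), fun g => by
      refine TensorProduct.ext' fun a b => ?_
      rfl⟩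
  one_mul := by
    ext1
    refine Representation.IntertwiningMap.ext (TensorProduct.ext' fun a b => ?_)
    change (a • (1 : G → k)) * b = a • b
    simp
  mul_one := by
    ext1
    refine Representation.IntertwiningMap.ext (TensorProduct.ext' fun a b => ?_)
    change a * (b • (1 : G → k)) = b • a
    simp
  mul_assoc := by
    ext1
    refine Representation.IntertwiningMap.ext (TensorProduct.ext_threefold fun a b c => ?_)
    change ((a : G → k) * b) * c = a * (b * c)
    rw [_root_.mul_assoc]

variable {k G}

/-- Left translation on functions. -/
noncomputable def leftTranslation (g : G) : functionRep k G ⟶ functionRep k G :=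
  ofHom ⟨LinearMap.funLeft k k (g⁻¹ * ·), fun h => by
    ext
    simp [LinearMap.funLeft, _root_.mul_assoc]⟩

instance (g : G) : IsMonHom (leftTranslation (k := k) g) where
  one_hom := by
    ext1
    refine Representation.IntertwiningMap.ext (LinearMap.ext fun a => ?_)
    rfl
  mul_hom := by
    ext1
    refine Representation.IntertwiningMap.ext (TensorProduct.ext' fun a b => ?_)
    rfl

lemma leftTranslation_one : leftTranslation (k := k) (1 : G) = 𝟙 _ := by
  ext f x
  change f ((1 : G)⁻¹ * x) = f x
  simp

lemma leftTranslation_mul (g h : G) :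
    leftTranslation (k := k) (g * h) = leftTranslation h ≫ leftTranslation g := by
  ext f x
  change f ((g * h)⁻¹ * x) = f (h⁻¹ * (g⁻¹ * x))
  simp [_root_.mul_assoc]

/-- A component of the canonical map of the function algebra. -/
noncomputable def canonicalComponent (g : G) :
    functionRep k G ⊗ functionRep k G ⟶ functionRep k G :=
  functionRep k G ◁ leftTranslation g ≫ μ

/-- A section of a component of the canonical map of the function algebra. -/
noncomputable def canonicalSection [Fintype G] [DecidableEq G] (g : G) :
    functionRep k G ⟶ functionRep k G ⊗ functionRep k G :=
  ofHom (σ := (functionRep k G ⊗ functionRep k G).ρ) (ρ := (functionRep k G).ρ)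
    ⟨∑ x : G, LinearMap.toSpanSingleton k _
      ((Pi.single x 1 : G → k) ⊗ₜ[k] (Pi.single (g⁻¹ * x) 1 : G → k)) ∘ₗ LinearMap.proj x,
    fun h => by
      refine LinearMap.ext fun f => ?_
      simp only [LinearMap.comp_apply, LinearMap.sum_apply, map_sum]
      refine Fintype.sum_equiv (Equiv.mulRight h) _ _ fun x => ?_
      simp only [LinearMap.proj_apply, LinearMap.toSpanSingleton_apply, map_smul]
      change f (x * h) • _ = f (x * h) • TensorProduct.map ((functionRep k G).ρ h)
        ((functionRep k G).ρ h) _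
      congr 1
      rw [TensorProduct.map_tmul]
      congr 1
      · ext y
        rw [functionRep_ρ_apply]
        simp [Pi.single_apply]
      · ext y
        rw [functionRep_ρ_apply]
        simp [Pi.single_apply, ← _root_.mul_assoc]⟩

lemma canonicalSection_apply [Fintype G] [DecidableEq G] (g : G) (f : G → k) :
    (canonicalSection g).hom f = ∑ x : G, f x •
      ((Pi.single x 1 : G → k) ⊗ₜ[k] (Pi.single (g⁻¹ * x) 1 : G → k)) := by
  change (∑ x : G, LinearMap.toSpanSingleton k _
      ((Pi.single x 1 : G → k) ⊗ₜ[k] (Pi.single (g⁻¹ * x) 1 : G → k)) ∘ₗ LinearMap.proj x) f = _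
  simp

lemma canonicalSection_comp_canonicalComponent [Fintype G] [DecidableEq G] (g h : G) :
    canonicalSection (k := k) g ≫ canonicalComponent h = if g = h then 𝟙 _ else 0 := by
  ext1
  refine Representation.IntertwiningMap.ext (LinearMap.ext fun f => funext fun y => ?_)
  have h1 : ((canonicalSection g ≫ canonicalComponent h).hom f : G → k) y =
      ∑ x, f x * ((Pi.single x 1 : G → k) y * (Pi.single (g⁻¹ * x) 1 : G → k) (h⁻¹ * y)) := by
    change ((canonicalComponent h).hom ((canonicalSection g).hom f) : G → k) y = _
    rw [canonicalSection_apply, map_sum, Finset.sum_apply]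
    exact Finset.sum_congr rfl fun x _ =>
      congrFun (map_smul (canonicalComponent h).hom (f x) _) y
  refine h1.trans ?_
  rw [Finset.sum_eq_single y (fun x _ hx => by simp [Pi.single_eq_of_ne hx.symm]) (by simp)]
  split_ifs with hgh
  · subst hgh
    simp
  · have : h⁻¹ * y ≠ g⁻¹ * y := by simpa using Ne.symm hgh
    simp [Pi.single_eq_of_ne this]

lemma sum_hom_apply {A B : Rep.{u} k G} {J : Type*} (s : Finset J) (f : J → (A ⟶ B)) (a : A.V) :
    (∑ i ∈ s, f i).hom a = ∑ i ∈ s, (f i).hom a :=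
  map_sum (AddMonoidHom.mk' (fun f : A ⟶ B => f.hom a) fun _ _ => rfl) f s

lemma sum_canonicalComponent_comp_canonicalSection [Fintype G] [DecidableEq G] :
    ∑ g : G, canonicalComponent (k := k) g ≫ canonicalSection g = 𝟙 _ := by
  ext1
  refine Representation.IntertwiningMap.ext (TensorProduct.ext' fun a b => ?_)
  refine (sum_hom_apply (A := functionRep k G ⊗ functionRep k G) _ _ (a ⊗ₜ[k] b)).trans ?_
  have h1 (g : G) : (canonicalComponent g ≫ canonicalSection g).hom (a ⊗ₜ[k] b) =
      ∑ x : G, (a x * b (g⁻¹ * x)) •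
        ((Pi.single x 1 : G → k) ⊗ₜ[k] (Pi.single (g⁻¹ * x) 1 : G → k)) :=
    canonicalSection_apply g _
  have h2 (f : G → k) : f = ∑ x, f x • (Pi.single x 1 : G → k) := by
    ext y
    simp [Pi.single_apply]
  simp only [h1]
  rw [Finset.sum_comm]
  calc _ = ∑ x : G, ∑ y : G, (a x * b y) •
        ((Pi.single x 1 : G → k) ⊗ₜ[k] (Pi.single y 1 : G → k)) :=
      Finset.sum_congr rfl fun x _ => Fintype.sum_equiv ((Equiv.inv G).trans (Equiv.mulRight x))
        _ _ fun g => by simp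
    _ = (∑ x, a x • (Pi.single x 1 : G → k)) ⊗ₜ[k] (∑ y, b y • (Pi.single y 1 : G → k)) := by
      simp only [TensorProduct.sum_tmul, TensorProduct.tmul_sum, TensorProduct.smul_tmul_smul]
      exact Finset.sum_comm
    _ = a ⊗ₜ[k] b := by rw [← h2, ← h2]

end Rep

end

section

open MonoidalCategory MonObj Functor.LaxMonoidal Functor.OplaxMonoidal
open scoped Obj

universe u

namespace Rep

variable {k G G' : Type u} [Field k] [Group G] [Group G']
  (F : Rep.{u} k G ⥤ Rep.{u} k G')

attribute [local instance] ringOfMonObj algebraOfMonObj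

/-- The action of `G` on the image of the function algebra induced by left translations. -/
noncomputable def translationHom [F.Monoidal] :
    G →* ((F.obj (functionRep k G)).V ≃ₐ[k] (F.obj (functionRep k G)).V) :=
  algEquivHomOfAut _ (fun g => F.map (leftTranslation g))
    (by rw [leftTranslation_one, F.map_id])
    (fun g h => by rw [leftTranslation_mul, F.map_comp])

lemma canonicalMap_translationHom_apply [F.Monoidal] (g : G)
    (t : (F.obj (functionRep k G)).V ⊗[k] (F.obj (functionRep k G)).V) :
    IsGaloisPair.canonicalMap (translationHom F) t g =
      (Functor.LaxMonoidal.μ F _ _ ≫ F.map (canonicalComponent g)).hom t := by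
  have h1 : Functor.LaxMonoidal.μ F _ _ ≫ F.map (canonicalComponent (k := k) g) =
      F.obj (functionRep k G) ◁ F.map (leftTranslation g) ≫ μ := by
    rw [canonicalComponent, F.map_comp, ← μ_natural_right_assoc, Functor.obj.μ_def]
  rw [h1]
  induction t with
  | zero => rw [map_zero]; exact (map_zero _).symm
  | add x y hx hy =>
    rw [map_add, Pi.add_apply, hx, hy]
    exact (map_add _ _ _).symm
  | tmul a b => exact IsGaloisPair.canonicalMap_tmul _ _ _ _

lemma canonicalMap_translationHom_bijective [F.Monoidal] [F.Additive] [Finite G] :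
    Function.Bijective (IsGaloisPair.canonicalMap (translationHom F)) := by
  classical
  have := Fintype.ofFinite G
  let S (g : G) := F.map (canonicalSection (k := k) g) ≫ δ F _ _
  have h1 (g h : G) : S g ≫ Functor.LaxMonoidal.μ F _ _ ≫ F.map (canonicalComponent h) =
      if g = h then 𝟙 _ else 0 := by
    simp only [S, Category.assoc, Functor.Monoidal.δ_μ_assoc]
    rw [← F.map_comp, canonicalSection_comp_canonicalComponent]
    split_ifs <;> simp
  have h2 : ∑ g, (Functor.LaxMonoidal.μ F _ _ ≫ F.map (canonicalComponent g)) ≫ S g = 𝟙 _ := by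
    have : (Functor.LaxMonoidal.μ F _ _ ≫ F.map (∑ g : G, canonicalComponent (k := k) g ≫
        canonicalSection g)) ≫ δ F _ _ = 𝟙 _ := by
      rw [sum_canonicalComponent_comp_canonicalSection]
      simp
    rw [← this, F.map_sum, Preadditive.comp_sum, Preadditive.sum_comp]
    simp [S]
  refine ⟨fun s t hst => ?_, fun f => ⟨∑ g, (S g).hom (f g), ?_⟩⟩
  · have h3 (t : (F.obj (functionRep k G)).V ⊗[k] (F.obj (functionRep k G)).V) :
        t = ∑ g, (S g).hom (IsGaloisPair.canonicalMap (translationHom F) t g) := by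
      simp only [canonicalMap_translationHom_apply]
      have := sum_hom_apply Finset.univ
        (fun g => (Functor.LaxMonoidal.μ F _ _ ≫ F.map (canonicalComponent (k := k) g)) ≫ S g) t
      rw [h2] at this
      exact this
    rw [h3 s, h3 t, hst]
  · ext g
    rw [map_sum, Finset.sum_apply]
    have h3 (h : G) : IsGaloisPair.canonicalMap (translationHom F) ((S h).hom (f h)) g =
        if h = g then f h else 0 := by
      rw [canonicalMap_translationHom_apply]
      refine congr(($(h1 h g)).hom (f h)).trans ?_
      split_ifs <;> rfl
    simp [h3]

lemma exists_eq_algebraMap_of_fixed [F.Monoidal] [F.Linear k] [F.Full]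
    (a : (F.obj (functionRep k G)).V)
    (ha : ∀ g', (F.obj (functionRep k G)).ρ g' a = a) : ∃ c : k, a = algebraMap k _ c := by
  let φ : 𝟙_ (Rep.{u} k G') ⟶ F.obj (functionRep k G) :=
    ofHom (σ := (F.obj (functionRep k G)).ρ) (ρ := (𝟙_ (Rep.{u} k G')).ρ)
      ⟨LinearMap.toSpanSingleton k _ a, fun g' => by ext; simp [ha]⟩
  obtain ⟨ψ, hψ⟩ := F.map_surjective (Functor.OplaxMonoidal.η F ≫ φ)
  let f : G → k := ψ.hom (1 : k)
  have hf (x : G) : f x = f 1 := by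
    have := congrFun (hom_comm_apply ψ x (1 : k)) 1
    change f 1 = f (1 * x) at this
    rw [this, _root_.one_mul]
  have hψ' : ψ = f 1 • η := by
    ext1
    refine Representation.IntertwiningMap.ext (LinearMap.ext_ring (funext fun x => ?_))
    change f x = f 1 • ((1 : k) • (1 : G → k)) x
    simp [hf x]
  have hφ : φ = f 1 • η := by
    rw [Functor.obj.η_def, ← Linear.comp_smul, ← F.map_smul, ← hψ', hψ]
    simp
  refine ⟨f 1, ?_⟩
  rw [Algebra.algebraMap_eq_smul_one]
  have h : φ.hom (1 : k) = f 1 • (1 : (F.obj (functionRep k G)).V) := by rw [hφ]; rfl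
  rw [← h]
  exact (one_smul k a).symm

/-- A linear functional on a representation induces a morphism to the functions on the group. -/
noncomputable def toFunctionRep {A : Rep.{u} k G} (ξ : Module.Dual k A.V) :
    A ⟶ functionRep k G :=
  ofHom (σ := (functionRep k G).ρ) (ρ := A.ρ)
    ⟨LinearMap.pi fun x => ξ ∘ₗ A.ρ x, fun g => by
      refine LinearMap.ext fun v => funext fun x => ?_
      change ξ (A.ρ x (A.ρ g v)) = ξ (A.ρ (x * g) v)
      rw [map_mul]
      rfl⟩

lemma exists_comp_ne_zero {A B : Rep.{u} k G} {f : A ⟶ B} (hf : f ≠ 0) :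
    ∃ p : B ⟶ functionRep k G, f ≫ p ≠ 0 := by
  obtain ⟨v, hv⟩ : ∃ v, f.hom v ≠ 0 := by
    by_contra! h
    exact hf (by ext v; exact h v)
  obtain ⟨ξ, hξ⟩ := Module.exists_dual_forall_apply_eq_one (K := k) (s := Set.univ)
    (v := fun _ : Unit => f.hom v) ((LinearIndependent.of_subsingleton () hv).linearIndepOn _)
  refine ⟨toFunctionRep ξ, fun h => one_ne_zero (α := k) ?_⟩
  have h1 : ((f ≫ toFunctionRep ξ).hom v : G → k) 1 = 1 := by
    change ξ (B.ρ 1 (f.hom v)) = 1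
    rw [map_one]
    exact hξ () (Set.mem_univ _)
  rw [← h1, h]
  rfl

lemma eq_one_of_forall_ρ_eq [F.Additive] [F.IsEquivalence] (g' : G')
    (h : ∀ a, (F.obj (functionRep k G)).ρ g' a = a) : g' = 1 := by
  by_contra hg'
  let δ (x : G') : MonoidAlgebra k G' := MonoidAlgebra.single x 1
  let r : leftRegular k G' ⟶ leftRegular k G' := leftRegularHom _ (δ 1 - δ g')
  have hr1 : r.hom (δ 1) = δ 1 - δ g' := by
    simp [r, δ]
  have hr : r ≠ 0 := fun h0 => by
    have h2 : δ 1 - δ g' = 0 := hr1.symm.trans congr(($h0).hom (δ 1))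
    exact hg' (MonoidAlgebra.single_left_injective one_ne_zero (sub_eq_zero.mp h2)).symm
  let e := F.objObjPreimageIso (leftRegular k G')
  obtain ⟨r₀, hr₀⟩ := F.map_surjective (e.hom ≫ r ≫ e.inv)
  have hr₀' : r₀ ≠ 0 := by
    rintro rfl
    rw [F.map_zero] at hr₀
    apply hr
    rw [← cancel_epi e.hom, ← cancel_mono e.inv]
    simp [← hr₀]
  obtain ⟨p, hp⟩ := exists_comp_ne_zero hr₀'
  apply hp
  apply F.map_injective
  have hs (s : leftRegular k G' ⟶ F.obj (functionRep k G)) : r ≫ s = 0 := by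
    have h1 : s.hom (δ 1 - δ g') = 0 := by
      have h2 : (leftRegular k G').ρ g' (δ 1) = δ g' := by simp [δ]
      have h3 := hom_comm_apply s g' (δ 1)
      rw [h, h2] at h3
      exact (map_sub s.hom _ _).trans (sub_eq_zero.mpr h3.symm)
    apply (leftRegularHomEquiv _).injective
    change s.hom (r.hom (δ 1)) = 0
    rw [hr1, h1]
  rw [F.map_comp, hr₀, Category.assoc, Category.assoc, hs, Limits.comp_zero, F.map_zero]

lemma nontrivial_obj_functionRep [F.Additive] [F.Faithful] :
    Nontrivial (F.obj (functionRep k G)).V := by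
  by_contra h
  rw [not_nontrivial_iff_subsingleton] at h
  have h1 : F.map (𝟙 (functionRep k G)) = F.map 0 := by
    ext a
    exact Subsingleton.elim _ _
  have h2 := congr((($(F.map_injective h1)).hom (1 : G → k) : G → k) 1)
  exact one_ne_zero (α := k) h2

theorem isGaloisPair [F.Monoidal] [F.Additive] [F.Linear k] [F.IsEquivalence] [Finite G] :
    IsGaloisPair (translationHom F) (algEquivHom (F.obj (functionRep k G))) :=
  have := nontrivial_obj_functionRep F
  .of_bijective (fun g g' a => hom_comm_apply (F.map (leftTranslation g)) g' a)
    (canonicalMap_translationHom_bijective F) (exists_eq_algebraMap_of_fixed F)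
    (eq_one_of_forall_ρ_eq F)

theorem nonempty_mulEquiv_of_isEquivalence [F.Monoidal] [F.Additive] [F.Linear k]
    [F.IsEquivalence] [Finite G] [Finite G'] (hG : Nat.card G < 32) : Nonempty (G ≃* G') :=
  ((isGaloisPair F).baseChange (AlgebraicClosure k)).nonempty_mulEquiv_of_card_lt hG

end Rep

end

/-- All finite groups of order less than 32 are categorically rigid (over any field):
if `G` has order `< 32` and `G'` is `k`-isocategorical to `G` (there is an equivalence of
categories `Rep k G ≌ Rep k G'` whose underlying functor is `k`-linear and monoidal), then
`G` and `G'` are isomorphic as groups. -/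
theorem isomorphic_of_isocategorical_of_card_lt_32
    (k : Type) [Field k] (G G' : Type) [Group G] [Fintype G] [Group G'] [Fintype G']
    (hG : Nat.card G < 32)
    (E : Rep k G ≌ Rep k G')
    [E.functor.Additive] [E.functor.Linear k] [E.functor.Monoidal] :
    Nonempty (G ≃* G') :=
  Rep.nonempty_mulEquiv_of_isEquivalence E.functor hG
end

section
/- Let k be a field, let G be a finite abelian group and let G' be a finite group. If G and G' are k-isocategorical, i.e., there exists an equivalence of categories E : Rep k G ≌ Rep k G' whose underlying functor is k-linear (additive and k-linear) and monoidal, then G and G' are isomorphic as groups (there exists a group isomorphism G ≃* G'). -/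
open CategoryTheory

section FullyFaithful

open Functor.LaxMonoidal MonoidalCategory

variable {C D : Type*} [Category* C] [Category* D]

/-- Natural endomorphisms of the identity of `D` pull back along a fully faithful functor
`C ⥤ D`. -/
noncomputable def pullbackIdEnd (F : C ⥤ D) [F.Full] [F.Faithful] (α : 𝟭 D ⟶ 𝟭 D) :
    𝟭 C ⟶ 𝟭 C where
  app X := F.preimage (α.app (F.obj X))
  naturality X Y f := F.map_injective (by simpa using α.naturality (F.map f))

variable (F : C ⥤ D) [F.Full] [F.Faithful]

@[simp]
lemma map_pullbackIdEnd_app (α : 𝟭 D ⟶ 𝟭 D) (X : C) :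
    F.map ((pullbackIdEnd F α).app X) = α.app (F.obj X) := by
  simp [pullbackIdEnd]

lemma pullbackIdEnd_comp (α β : 𝟭 D ⟶ 𝟭 D) :
    pullbackIdEnd F (α ≫ β) = pullbackIdEnd F α ≫ pullbackIdEnd F β := by
  ext X
  apply F.map_injective
  rw [map_pullbackIdEnd_app, NatTrans.comp_app, NatTrans.comp_app, F.map_comp,
    map_pullbackIdEnd_app, map_pullbackIdEnd_app]

lemma pullbackIdEnd_injective [F.EssSurj] : Function.Injective (pullbackIdEnd F) := by
  intro α β h
  ext Y
  have hX : α.app (F.obj (F.objPreimage Y)) = β.app (F.obj (F.objPreimage Y)) := by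
    rw [← map_pullbackIdEnd_app, h, map_pullbackIdEnd_app]
  have e := F.objObjPreimageIso Y
  have h₁ := α.naturality e.hom
  have h₂ := β.naturality e.hom
  rw [hX, ← h₂] at h₁
  exact (cancel_epi ((𝟭 D).map e.hom)).1 h₁

lemma pullbackIdEnd_sum_smul {k : Type*} [Ring k] [Preadditive C] [Preadditive D] [Linear k C]
    [Linear k D] [F.Additive] [F.Linear k] {ι : Type*} (s : Finset ι) (a : ι → k)
    (α : ι → (𝟭 D ⟶ 𝟭 D)) :
    pullbackIdEnd F (∑ i ∈ s, a i • α i) = ∑ i ∈ s, a i • pullbackIdEnd F (α i) := by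
  ext X
  apply F.map_injective
  rw [map_pullbackIdEnd_app]
  simp only [NatTrans.app_sum, NatTrans.app_smul, Functor.map_sum, Functor.map_smul,
    map_pullbackIdEnd_app]

lemma isMonoidal_pullbackIdEnd [MonoidalCategory C] [MonoidalCategory D] [F.Monoidal]
    (α : 𝟭 D ⟶ 𝟭 D) [α.IsMonoidal] : (pullbackIdEnd F α).IsMonoidal where
  unit := by
    apply F.map_injective
    have h := α.naturality (ε F)
    have h' : α.app (𝟙_ D) = 𝟙 _ := by
      simpa using NatTrans.IsMonoidal.unit (τ := α)
    rw [h'] at h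
    rw [← cancel_epi (ε F)]
    simpa using h
  tensor X Y := by
    apply F.map_injective
    have h := α.naturality (μ F X Y)
    have h' : α.app (F.obj X ⊗ F.obj Y) = α.app (F.obj X) ⊗ₘ α.app (F.obj Y) := by
      simpa using NatTrans.IsMonoidal.tensor (τ := α) (F.obj X) (F.obj Y)
    rw [h'] at h
    rw [← cancel_epi (μ F X Y)]
    simpa [← Functor.LaxMonoidal.μ_natural] using h

end FullyFaithful

namespace Rep

open MonoidalCategory

variable {k H : Type} [Field k] [Group H]

/-- A central element of `H` acts by a natural endomorphism on every representation of `H`. -/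
noncomputable def centerEnd (z : Subgroup.center H) : 𝟭 (Rep.{0} k H) ⟶ 𝟭 (Rep.{0} k H) where
  app X := ofHom (ρ := X.ρ) (σ := X.ρ) ⟨X.ρ z, fun g ↦ by
    rw [← Module.End.mul_eq_comp, ← Module.End.mul_eq_comp, ← map_mul, ← map_mul,
      Subgroup.mem_center_iff.1 z.2 g]⟩
  naturality X Y f := by
    ext x
    exact (hom_comm_apply f z x).symm

lemma centerEnd_app_hom_apply (z : Subgroup.center H) (X : Rep.{0} k H) (v : X) :
    ((centerEnd z).app X).hom v = X.ρ z v := rfl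

lemma sum_smul_centerEnd_app_hom_apply {ι : Type*} (s : Finset ι) (a : ι → k)
    (z : ι → Subgroup.center H) (X : Rep k H) (v : X) :
    ((∑ i ∈ s, a i • centerEnd (k := k) (z i)).app X).hom v = ∑ i ∈ s, a i • X.ρ (z i) v := by
  rw [NatTrans.app_sum, sum_hom]
  exact Representation.IntertwiningMap.sum_apply _ _ s _ v

instance (z : Subgroup.center H) : (centerEnd (k := k) z).IsMonoidal where
  unit := by
    ext
    rfl
  tensor X Y := by
    ext
    rfl

lemma centerEnd_mul (z w : Subgroup.center H) :
    centerEnd (k := k) (z * w) = centerEnd z ≫ centerEnd w := by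
  ext X v
  have h : X.ρ (z * w : H) v = X.ρ (w * z : H) v := by
    rw [Subgroup.mem_center_iff.1 z.2 w]
  exact h.trans congr($(X.ρ.map_mul (w : H) z) v)

lemma centerEnd_injective : Function.Injective (centerEnd (k := k) (H := H)) := by
  intro z w h
  have h' := congr((NatTrans.app $h (leftRegular k H)).hom (.single 1 1))
  simp only [centerEnd_app_hom_apply, Representation.ofMulAction_single, smul_eq_mul, mul_one] at h'
  have := congr(($h').coeff (z : H))
  by_contra hzw
  simp [Subtype.val_injective.eq_iff, Ne.symm hzw] at this

/-- The action of `∑ h, f h • h` for a class function `f`, as a natural endomorphism. -/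
noncomputable def classFunctionEnd [Fintype H] (f : H → k) (hf : ∀ g h, f (g * h * g⁻¹) = f h) :
    𝟭 (Rep.{0} k H) ⟶ 𝟭 (Rep.{0} k H) where
  app X := ofHom (ρ := X.ρ) (σ := X.ρ) ⟨∑ h, f h • X.ρ h, fun g ↦ by
    rw [← Module.End.mul_eq_comp, ← Module.End.mul_eq_comp, Finset.sum_mul, Finset.mul_sum]
    refine Fintype.sum_equiv (MulAut.conj g⁻¹).toEquiv _ _ fun h ↦ ?_
    have := hf g⁻¹ h
    simp_all [← map_mul, mul_assoc]⟩
  naturality X Y φ := by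
    ext x
    simp [hom_comm_apply]

/-- Every natural endomorphism of the identity is the action of an element of `k[H]`. -/
lemma exists_idEnd_app_apply [Fintype H] (α : 𝟭 (Rep.{0} k H) ⟶ 𝟭 (Rep.{0} k H)) :
    ∃ a : H → k, ∀ (X : Rep.{0} k H) (v : X), (α.app X).hom v = ∑ h, a h • X.ρ h v := by
  let e : leftRegular k H := MonoidAlgebra.single 1 1
  refine ⟨MonoidAlgebra.coeff ((α.app (leftRegular k H)).hom e), fun X v ↦ ?_⟩
  have h := congr(($(α.naturality (leftRegularHom X v))).hom e)
  have h1 : (leftRegularHom X v).hom e = v := by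
    simp [e]
  have h2 (p : leftRegular k H) : (leftRegularHom X v).hom p =
      ∑ h, MonoidAlgebra.coeff p h • X.ρ h v :=
    Finsupp.sum_fintype _ _ (by simp)
  rw [← h2, ← congr((α.app X).hom $h1)]
  exact h

lemma exists_eq_centerEnd [Fintype H] (α : 𝟭 (Rep.{0} k H) ⟶ 𝟭 (Rep.{0} k H))
    [α.IsMonoidal] : ∃ z, α = centerEnd z := by
  classical
  obtain ⟨a, ha⟩ := exists_idEnd_app_apply α
  let e : leftRegular k H := MonoidAlgebra.single 1 1
  have hsum : ∑ h, a h = 1 := by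
    have h := NatTrans.IsMonoidal.unit (τ := α)
    have h' : α.app (𝟙_ (Rep.{0} k H)) = 𝟙 _ := by simpa using h
    have h1 := ha (𝟙_ (Rep.{0} k H)) (1 : k)
    rw [h'] at h1
    simpa using h1.symm
  have hmul (x y : H) : a x * a y = if x = y then a x else 0 := by
    have h : α.app (leftRegular k H ⊗ leftRegular k H) =
        α.app (leftRegular k H) ⊗ₘ α.app (leftRegular k H) := by
      simpa using NatTrans.IsMonoidal.tensor (τ := α) (leftRegular k H) (leftRegular k H)
    have h1 := ha (leftRegular k H ⊗ leftRegular k H) (e ⊗ₜ[k] e)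
    rw [h] at h1
    let c (x : H) : leftRegular k H →ₗ[k] k :=
      Finsupp.lapply x ∘ₗ (MonoidAlgebra.coeffLinearEquiv k).toLinearMap
    have hc (x h : H) : c x ((leftRegular k H).ρ h e) = if h = x then 1 else 0 := by
      simp [c, e, Finsupp.single_apply]
    have hce (x : H) : c x ((α.app (leftRegular k H)).hom e) = a x := by
      rw [ha]
      simp only [map_sum, map_smul, hc]
      simp
    have h2 := congr((LinearMap.mul' k k ∘ₗ TensorProduct.map (c x) (c y)) $h1)
    have hl : (LinearMap.mul' k k ∘ₗ TensorProduct.map (c x) (c y))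
        ((α.app (leftRegular k H) ⊗ₘ α.app (leftRegular k H)).hom (e ⊗ₜ[k] e)) = a x * a y := by
      rw [← hce x, ← hce y]
      rfl
    have hr (h : H) : (LinearMap.mul' k k ∘ₗ TensorProduct.map (c x) (c y))
        ((leftRegular k H ⊗ leftRegular k H).ρ h (e ⊗ₜ[k] e)) =
          if h = x then (if h = y then 1 else 0) else 0 := by
      trans c x ((leftRegular k H).ρ h e) * c y ((leftRegular k H).ρ h e)
      · rfl
      · rw [hc, hc, ite_zero_mul, one_mul]
    rw [hl.symm.trans h2, map_sum]
    simp only [map_smul]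
    refine (Finset.sum_congr rfl fun h _ ↦ congr(a h • $(hr h))).trans ?_
    simp
  obtain ⟨z, hz⟩ : ∃ z, a z ≠ 0 := by
    by_contra! h
    simp [h] at hsum
  have haz : a z = 1 := by simpa [hz] using hmul z z
  have hα (X : Rep.{0} k H) (v : X) : (α.app X).hom v = X.ρ z v := by
    rw [ha, Finset.sum_eq_single z _ (by simp), haz, one_smul]
    intro h _ hne
    have := hmul h z
    simp_all
  refine ⟨⟨z, Subgroup.mem_center_iff.2 fun g ↦ ?_⟩, ?_⟩
  · have h := hom_comm_apply (α.app (leftRegular k H)) g e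
    have h' : (leftRegular k H).ρ z ((leftRegular k H).ρ g e) =
        (leftRegular k H).ρ g ((leftRegular k H).ρ z e) := by
      rw [← hα, ← hα]
      exact h
    simp only [e, Representation.ofMulAction_single, smul_eq_mul, mul_one] at h'
    exact (MonoidAlgebra.single_left_injective one_ne_zero h').symm
  · ext X v
    exact hα X v

/-- A fully faithful monoidal functor embeds the center of the target group into that of the
source group. -/
lemma exists_centerHom {K : Type} [Group K] [Fintype H] (F : Rep.{0} k H ⥤ Rep.{0} k K)
    [F.Full] [F.Faithful] [F.EssSurj] [F.Monoidal] :
    ∃ φ : Subgroup.center K →* Subgroup.center H, Function.Injective φ ∧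
      ∀ z, pullbackIdEnd F (centerEnd z) = centerEnd (φ z) := by
  have h (z : Subgroup.center K) := by
    have := isMonoidal_pullbackIdEnd F (centerEnd (k := k) z)
    exact exists_eq_centerEnd (pullbackIdEnd F (centerEnd z))
  choose φ hφ using h
  refine ⟨.mk' φ fun z w ↦ centerEnd_injective (k := k) ?_, fun z w hzw ↦ ?_, hφ⟩
  · rw [← hφ, centerEnd_mul, centerEnd_mul, pullbackIdEnd_comp, hφ, hφ]
  · apply centerEnd_injective (k := k)
    apply pullbackIdEnd_injective F
    rw [hφ, hφ]
    exact congr(centerEnd $hzw)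

/-- If `F` identifies the center of `K` with the commutative group `H`, then `K` is commutative. -/
lemma center_eq_top_of_surjective {H : Type} [CommGroup H] [Fintype H] {K : Type} [Group K]
    [Fintype K] (F : Rep.{0} k H ⥤ Rep.{0} k K)
    [F.Full] [F.Faithful] [F.EssSurj] [F.Additive] [F.Linear k]
    (φ : Subgroup.center K → Subgroup.center H) (hφ : Function.Surjective φ)
    (h : ∀ z, pullbackIdEnd F (centerEnd z) = centerEnd (φ z)) : Subgroup.center K = ⊤ := by
  classical
  refine eq_top_iff.2 fun g _ ↦ ?_
  let f : K → k := fun x ↦ if IsConj g x then 1 else 0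
  have hf (x y : K) : f (x * y * x⁻¹) = f y := by
    have hy : IsConj y (x * y * x⁻¹) := isConj_iff.2 ⟨x, rfl⟩
    have : IsConj g (x * y * x⁻¹) ↔ IsConj g y := ⟨fun h ↦ h.trans hy.symm, fun h ↦ h.trans hy⟩
    simp only [f, this]
  obtain ⟨a, ha⟩ := exists_idEnd_app_apply (pullbackIdEnd F (classFunctionEnd f hf))
  have hc (x : H) : x ∈ Subgroup.center H := by simp [CommGroup.center_eq_top]
  choose ψ hψ using fun x : H ↦ hφ ⟨x, hc x⟩
  have key : classFunctionEnd f hf = ∑ x, a x • centerEnd (k := k) (ψ x) := by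
    apply pullbackIdEnd_injective F
    rw [pullbackIdEnd_sum_smul]
    simp only [h, hψ]
    ext X v
    exact (ha X v).trans (sum_smul_centerEnd_app_hom_apply _ a (fun x ↦ ⟨x, hc x⟩) X v).symm
  let e : leftRegular k K := MonoidAlgebra.single 1 1
  have he : ∑ x, f x • (leftRegular k K).ρ x e =
      ∑ x, a x • (leftRegular k K).ρ (ψ x) e := by
    rw [← sum_smul_centerEnd_app_hom_apply, ← key]
    simp [classFunctionEnd]
  have hcoeff := congr(MonoidAlgebra.coeff $he g)
  by_contra hg
  have hne (x : H) : (ψ x : K) ≠ g := fun hx ↦ hg (hx ▸ (ψ x).2)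
  have hfg : f g = 1 := if_pos (.refl g)
  simp [e, MonoidAlgebra.coeff_sum, Finsupp.single_apply, hne, hfg] at hcoeff

end Rep

/-- Finite abelian groups are categorically rigid: if `G` is a finite abelian group and `G'`
is a finite group `k`-isocategorical to `G` (there is an equivalence of categories
`Rep k G ≌ Rep k G'` whose underlying functor is `k`-linear and monoidal), then `G` and `G'`
are isomorphic as groups. -/
theorem isomorphic_of_isocategorical_of_abelian
    (k : Type) [Field k] (G G' : Type) [CommGroup G] [Fintype G] [Group G'] [Fintype G']
    (E : Rep k G ≌ Rep k G')
    [E.functor.Additive] [E.functor.Linear k] [E.functor.Monoidal] :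
    Nonempty (G ≃* G') := by
  let _ : E.inverse.Monoidal := E.inverseMonoidal
  obtain ⟨φ, hφ, h⟩ := Rep.exists_centerHom E.functor
  obtain ⟨ψ, hψ, -⟩ := Rep.exists_centerHom E.inverse
  have hbij : Function.Bijective φ :=
    (Nat.bijective_iff_injective_and_card φ).2
      ⟨hφ, (Nat.card_le_card_of_injective φ hφ).antisymm (Nat.card_le_card_of_injective ψ hψ)⟩
  have htop := Rep.center_eq_top_of_surjective E.functor φ hbij.2 h
  let e : Subgroup.center G' ≃* Subgroup.center G := MulEquiv.ofBijective φ hbij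
  exact ⟨(((MulEquiv.subgroupCongr htop).trans Subgroup.topEquiv).symm.trans (e.trans
    ((MulEquiv.subgroupCongr CommGroup.center_eq_top).trans Subgroup.topEquiv))).symm⟩
end
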